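/- For the complex BD_7^2 of graphs of degree at most two on seven vertices, the reduced integral homology is: H̃_i(BD_7^2; ℤ) ≅ ℤ/5ℤ if i = 4, H̃_i(BD_7^2; ℤ) ≅ ℤ^732 if i = 5, and H̃_i(BD_7^2; ℤ) = 0 for all other i. -/

import Mathlib

set_option synthInstance.maxHeartbeats 1000000
set_option maxHeartbeats 1000000

noncomputable section

namespace MatchPaper

attribute [local instance 10] Classical.propDecidable

/-! ### Guarded constructions on additive groups -/

section AddGadgets

variable {A B : Type*} [AddCommGroup A] [AddCommGroup B]

/-- Lift a homomorphism to the quotient (it genuinely descends whenever it kills `S`). -/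
def liftOrZero (S : AddSubgroup A) (f : A →+ B) : A ⧸ S →+ B :=
  if h : S ≤ f.ker then QuotientAddGroup.lift S f h else 0

/-- Descend a homomorphism to quotients (genuine whenever `f S ≤ T`). -/
def descend (S : AddSubgroup A) (T : AddSubgroup B) (f : A →+ B) : A ⧸ S →+ B ⧸ T :=
  if h : S ≤ T.comap f then QuotientAddGroup.map S T f h else 0

/-- Restrict a homomorphism to subgroups (genuine whenever `f Z ≤ Z'`). -/
def restrictHom (f : A →+ B) (Z : AddSubgroup A) (Z' : AddSubgroup B) : Z →+ Z' :=
  if h : ∀ x : Z, f x ∈ Z' then (f.comp Z.subtype).codRestrict Z' (fun x => h x) else 0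

/-- The subquotient `Z / (Bd ∩ Z)`. -/
abbrev subQuot (Z Bd : AddSubgroup A) : Type _ := Z ⧸ Bd.addSubgroupOf Z

/-- The map induced by `f` on subquotients. -/
def subQuotMap (f : A →+ B) (Z Bd : AddSubgroup A) (Z' Bd' : AddSubgroup B) :
    subQuot Z Bd →+ subQuot Z' Bd' :=
  descend (Bd.addSubgroupOf Z) (Bd'.addSubgroupOf Z') (restrictHom f Z Z')

end AddGadgets

/-! ### Chain complexes of abelian groups, group actions, quotient and fixed-difference
subcomplexes, and homology -/

section Abstract

variable (X : ℤ → Type*) [∀ i, AddCommGroup (X i)]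

/-- Transport along an equality of indices. -/
def castAE {i j : ℤ} (h : i = j) : X i ≃+ X j := by subst h; exact AddEquiv.refl _

variable (d : ∀ i : ℤ, X (i + 1) →+ X i)

/-- The boundary map leaving degree `i`. -/
def dfrom (i : ℤ) : X i →+ X (i - 1) :=
  (d (i - 1)).comp (castAE X (show i = (i - 1) + 1 by ring)).toAddMonoidHom

/-- Cycles in degree `i`. -/
def cyc (i : ℤ) : AddSubgroup (X i) := (dfrom X d i).ker

/-- Boundaries in degree `i`. -/
def bdr (i : ℤ) : AddSubgroup (X i) := (d i).range

/-- Homology of the chain complex `(X, d)` in degree `i`. -/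
abbrev Hgrp (i : ℤ) : Type _ := subQuot (cyc X d i) (bdr X d i)

variable {G : Type*} [Group G] (act : G → ∀ i : ℤ, X i ≃+ X i)

/-- The subgroup `C_i^G` generated by the elements `c - g c`. -/
def gsub (i : ℤ) : AddSubgroup (X i) :=
  AddSubgroup.closure {x | ∃ (c : X i) (g : G), x = c - act g i c}

/-- The degree-`i` part of the quotient complex `C/G`. -/
abbrev QX (i : ℤ) : Type _ := X i ⧸ gsub X act i

/-- The boundary map of the quotient complex `C/G`. -/
def qd (i : ℤ) : QX X act (i + 1) →+ QX X act i :=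
  descend (gsub X act (i + 1)) (gsub X act i) (d i)

/-- Homology of the quotient complex `C/G`. -/
abbrev HQgrp (i : ℤ) : Type _ := Hgrp (QX X act) (qd X d act) i

/-- The boundary map of the subcomplex `C^G`. -/
def sd (i : ℤ) : gsub X act (i + 1) →+ gsub X act i :=
  restrictHom (d i) (gsub X act (i + 1)) (gsub X act i)

/-- Homology of the subcomplex `C^G`. -/
abbrev HSgrp (i : ℤ) : Type _ := Hgrp (fun j => gsub X act j) (sd X d act) i

/-- The projection chain map `C → C/G`. -/
def projX (i : ℤ) : X i →+ QX X act i := QuotientAddGroup.mk' _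

/-- The map `π*` induced on homology by the projection `C → C/G`. -/
def piStar (i : ℤ) : Hgrp X d i →+ HQgrp X d act i :=
  subQuotMap (projX X act i) (cyc X d i) (bdr X d i)
    (cyc (QX X act) (qd X d act) i) (bdr (QX X act) (qd X d act) i)

/-- The chain map `φ : C/G → C`, `[c] ↦ ∑ g • c`. -/
def phiX [Fintype G] (i : ℤ) : QX X act i →+ X i :=
  liftOrZero (gsub X act i) (∑ g : G, (act g i).toAddMonoidHom)

/-- The map `φ*` induced on homology by `φ`. -/
def phiStar [Fintype G] (i : ℤ) : HQgrp X d act i →+ Hgrp X d i :=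
  subQuotMap (phiX X act i) (cyc (QX X act) (qd X d act) i) (bdr (QX X act) (qd X d act) i)
    (cyc X d i) (bdr X d i)

end Abstract

/-! ### Guarded constructions on modules -/

section LinGadgets

variable (R : Type*) [CommRing R] {M N : Type*} [AddCommGroup M] [Module R M]
  [AddCommGroup N] [Module R N]

def liftOrZeroL (S : Submodule R M) (f : M →ₗ[R] N) : (M ⧸ S) →ₗ[R] N :=
  if h : S ≤ LinearMap.ker f then S.liftQ f h else 0

def descendL (S : Submodule R M) (T : Submodule R N) (f : M →ₗ[R] N) :
    (M ⧸ S) →ₗ[R] (N ⧸ T) :=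
  if h : S ≤ T.comap f then S.mapQ T f h else 0

def restrictL (f : M →ₗ[R] N) (Z : Submodule R M) (Z' : Submodule R N) : Z →ₗ[R] Z' :=
  if h : ∀ x ∈ Z, f x ∈ Z' then f.restrict h else 0

/-- The subquotient `Z / (Bd ∩ Z)`. -/
abbrev subQuotL (Z Bd : Submodule R M) : Type _ := Z ⧸ Bd.comap Z.subtype

def subQuotMapL (f : M →ₗ[R] N) (Z Bd : Submodule R M) (Z' Bd' : Submodule R N) :
    subQuotL R Z Bd →ₗ[R] subQuotL R Z' Bd' :=
  descendL R (Bd.comap Z.subtype) (Bd'.comap Z'.subtype) (restrictL R f Z Z')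

end LinGadgets

/-! ### Reduced simplicial chains and homology of a family of finite sets

A family `K : Finset V → Prop` of finite subsets of a vertex type `V` (in our applications a
simplicial complex, in particular closed under taking subsets and containing `∅`) has reduced
simplicial chain groups over a ring `R`: the degree-`d` chain group is free on the faces of
cardinality `d + 1`, i.e. we index chain groups by the cardinality `c = d + 1` of the faces,
with the empty face (cardinality `0`, degree `-1`) giving the augmentation.  Orientations are
induced by an injection `rank : V → ℕ` of the vertices into `ℕ`. -/

section Simplicial

variable (R : Type*) [CommRing R]

/-- Chains on the faces of cardinality `c` of the family `K`. -/
abbrev SChain {V : Type*} (K : Finset V → Prop) (c : ℕ) : Type _ :=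
  {σ : Finset V // K σ ∧ σ.card = c} →₀ R

/-- The basis chain of a face, or zero for a non-face. -/
def basisOrZero {V : Type*} (K : Finset V → Prop) (c : ℕ) (τ : Finset V) : SChain R K c :=
  if h : K τ ∧ τ.card = c then Finsupp.single ⟨τ, h⟩ (1 : R) else 0

/-- The simplicial boundary map, with signs determined by the ordering of the vertices via
`rank`. -/
def bdry {V : Type*} [DecidableEq V] (rank : V → ℕ) (K : Finset V → Prop) (c : ℕ) :
    SChain R K (c + 1) →ₗ[R] SChain R K c :=
  Finsupp.lsum R fun σ => LinearMap.toSpanSingleton R _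
    (∑ v ∈ σ.1, ((-1 : ℤ) ^ ((σ.1.filter fun u => rank u < rank v).card) •
      basisOrZero R K c (σ.1.erase v)))

/-- The orientation sign of a map `f` on a face `σ`: the parity of the number of inversions. -/
def mapSign {V W : Type*} (rank : V → ℕ) (rank' : W → ℕ) (f : V → W) (σ : Finset V) : ℤ :=
  (-1) ^ (((σ ×ˢ σ).filter fun p => rank p.1 < rank p.2 ∧ rank' (f p.2) < rank' (f p.1)).card)

/-- The chain map induced by a map `f` on vertices, taking orientations into account. -/
def chainMap {V W : Type*} [DecidableEq V] [DecidableEq W] (rank : V → ℕ) (rank' : W → ℕ)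
    (f : V → W) (K : Finset V → Prop) (K' : Finset W → Prop) (c : ℕ) :
    SChain R K c →ₗ[R] SChain R K' c :=
  Finsupp.lsum R fun σ => LinearMap.toSpanSingleton R _
    (mapSign rank rank' f σ.1 • basisOrZero R K' c (σ.1.image f))

/-- Cycles among the chains on faces of cardinality `c` (for `c = 0` everything is a cycle:
the boundary map leaving degree `-1` is zero). -/
def cycLow {V : Type*} [DecidableEq V] (rank : V → ℕ) (K : Finset V → Prop) :
    (c : ℕ) → Submodule R (SChain R K c)
  | 0 => ⊤
  | (m + 1) => LinearMap.ker (bdry R rank K m)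

/-- Reduced simplicial homology at the faces of cardinality `c`, i.e. in degree `c - 1`. -/
abbrev RHc {V : Type*} [DecidableEq V] (rank : V → ℕ) (K : Finset V → Prop) (c : ℕ) : Type _ :=
  subQuotL R (cycLow R rank K c) (LinearMap.range (bdry R rank K c))

/-- Reduced simplicial homology `H̃_dg(K; R)`. -/
abbrev RH {V : Type*} [DecidableEq V] (rank : V → ℕ) (K : Finset V → Prop) (dg : ℕ) : Type _ :=
  RHc R rank K (dg + 1)

end Simplicial

/-! ### The matching complex and the complexes of graphs of bounded degree -/

/-- The standard injection of pairs into `ℕ`, inducing the lexicographic order. -/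
def rankP (m : ℕ) : Fin m × Fin m → ℕ := fun p => p.1.val * m + p.2.val

/-- A face of the matching complex `M_m`: a set of edges `(i, j)`, `i < j`, of the complete
graph on `Fin m`, no two of which share an endpoint. -/
def IsMatching (m : ℕ) (σ : Finset (Fin m × Fin m)) : Prop :=
  (∀ p ∈ σ, p.1 < p.2) ∧
    ∀ p ∈ σ, ∀ q ∈ σ, p ≠ q → p.1 ≠ q.1 ∧ p.1 ≠ q.2 ∧ p.2 ≠ q.1 ∧ p.2 ≠ q.2

/-- `H̃_dg(M_m; R)`, the reduced homology of the matching complex on `m` vertices. -/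
abbrev MH (R : Type*) [CommRing R] (m dg : ℕ) : Type _ := RH R (rankP m) (IsMatching m) dg

/-- The degree of the vertex `i` in the graph `σ` (a loop `(i, i)` counts twice). -/
def degB {n : ℕ} (σ : Finset (Fin n × Fin n)) (i : Fin n) : ℕ :=
  ∑ p ∈ σ, ((if p.1 = i then 1 else 0) + (if p.2 = i then 1 else 0))

/-- A face of `BD_n^λ`: a graph on `Fin n` (loops allowed, encoded as pairs `(i, j)` with
`i ≤ j`) in which the vertex `i` has degree at most `λ i`. -/
def IsBDGraph {n : ℕ} (lam : Fin n → ℕ) (σ : Finset (Fin n × Fin n)) : Prop :=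
  (∀ p ∈ σ, p.1 ≤ p.2) ∧ ∀ i, degB σ i ≤ lam i

/-- `H̃_dg(BD_n^λ; R)`. -/
abbrev BDH (R : Type*) [CommRing R] {n : ℕ} (lam : Fin n → ℕ) (dg : ℕ) : Type _ :=
  RH R (rankP n) (IsBDGraph lam) dg

/-! ### The Young group action on the matching complex -/

/-- The action of a permutation of the vertices on the edges of the complete graph. -/
def emap {m : ℕ} (g : Equiv.Perm (Fin m)) : Fin m × Fin m → Fin m × Fin m :=
  fun p => (min (g p.1) (g p.2), max (g p.1) (g p.2))

/-- The quotient map on edges induced by a surjection `kap` on vertices (whose fibers are the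
blocks `U_i` of the partition). -/
def kmap {N n : ℕ} (kap : Fin N → Fin n) : Fin N × Fin N → Fin n × Fin n :=
  fun p => (min (kap p.1) (kap p.2), max (kap p.1) (kap p.2))

/-- Membership of a permutation in the Young group: it preserves each block of the partition
determined by `kap`. -/
def KeepsBlocks {N n : ℕ} (kap : Fin N → Fin n) (g : Equiv.Perm (Fin N)) : Prop :=
  ∀ x, kap (g x) = kap x

section YoungAction

variable (R : Type*) [CommRing R]

/-- The action of a permutation `g` of the `N` vertices on chains. -/
def actC (N : ℕ) (K : Finset (Fin N × Fin N) → Prop) (g : Equiv.Perm (Fin N)) (c : ℕ) :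
    SChain R K c →ₗ[R] SChain R K c :=
  chainMap R (rankP N) (rankP N) (emap g) K K c

/-- The submodule of chains generated by the elements `c - g c`, `g` in the Young group. -/
def ysub (N n : ℕ) (kap : Fin N → Fin n) (K : Finset (Fin N × Fin N) → Prop) (c : ℕ) :
    Submodule R (SChain R K c) :=
  Submodule.span R {x | ∃ (ch : SChain R K c) (g : Equiv.Perm (Fin N)),
    KeepsBlocks kap g ∧ x = ch - actC R N K g c ch}

/-- The chains of the quotient complex `C̃/S_λ`. -/
abbrev QC (N n : ℕ) (kap : Fin N → Fin n) (K : Finset (Fin N × Fin N) → Prop) (c : ℕ) :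
    Type _ :=
  SChain R K c ⧸ ysub R N n kap K c

/-- The boundary map of the quotient complex `C̃/S_λ`. -/
def qbdry (N n : ℕ) (kap : Fin N → Fin n) (K : Finset (Fin N × Fin N) → Prop) (c : ℕ) :
    QC R N n kap K (c + 1) →ₗ[R] QC R N n kap K c :=
  descendL R (ysub R N n kap K (c + 1)) (ysub R N n kap K c) (bdry R (rankP N) K c)

/-- Homology of the quotient complex `C̃(M_N)/S_λ` in degree `dg`. -/
abbrev QMH (N n : ℕ) (kap : Fin N → Fin n) (dg : ℕ) : Type _ :=
  subQuotL R (LinearMap.ker (qbdry R N n kap (IsMatching N) dg))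
    (LinearMap.range (qbdry R N n kap (IsMatching N) (dg + 1)))

/-- The chain map `φ : C̃/S_λ → C̃`, `[c] ↦ ∑_{g ∈ S_λ} g c`. -/
def phiC (N n : ℕ) (kap : Fin N → Fin n) (K : Finset (Fin N × Fin N) → Prop) (c : ℕ) :
    QC R N n kap K c →ₗ[R] SChain R K c :=
  liftOrZeroL R (ysub R N n kap K c)
    (∑ g ∈ Finset.univ.filter (fun g : Equiv.Perm (Fin N) => ∀ x, kap (g x) = kap x),
      actC R N K g c)

/-- The map `φ* : H_dg(C̃(M_N)/S_λ) → H̃_dg(M_N; R)` induced by `φ`. -/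
def phiStarM (N n : ℕ) (kap : Fin N → Fin n) (dg : ℕ) :
    QMH R N n kap dg →ₗ[R] MH R N dg :=
  subQuotMapL R (phiC R N n kap (IsMatching N) (dg + 1))
    (LinearMap.ker (qbdry R N n kap (IsMatching N) dg))
    (LinearMap.range (qbdry R N n kap (IsMatching N) (dg + 1)))
    (cycLow R (rankP N) (IsMatching N) (dg + 1))
    (LinearMap.range (bdry R (rankP N) (IsMatching N) (dg + 1)))

end YoungAction

/-! ### The subfamilies `Δ_λ` and `Γ_λ` of the matching complex -/

/-- `σ` contains two distinct edges `ab`, `cd` with `a, c` in the same block and `b, d` in the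
same block. -/
def InDelta {N n : ℕ} (kap : Fin N → Fin n) (σ : Finset (Fin N × Fin N)) : Prop :=
  ∃ p ∈ σ, ∃ q ∈ σ, p ≠ q ∧
    ((kap p.1 = kap q.1 ∧ kap p.2 = kap q.2) ∨ (kap p.1 = kap q.2 ∧ kap p.2 = kap q.1))

/-- A face of `Δ_λ`. -/
def IsDelta {N n : ℕ} (kap : Fin N → Fin n) (σ : Finset (Fin N × Fin N)) : Prop :=
  IsMatching N σ ∧ InDelta kap σ

/-- A face of `Γ_λ = M_N \ Δ_λ`. -/
def IsGamma {N n : ℕ} (kap : Fin N → Fin n) (σ : Finset (Fin N × Fin N)) : Prop :=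
  IsMatching N σ ∧ ¬ InDelta kap σ

section YoungMore

variable (R : Type*) [CommRing R]

/-- The map `κ̂ : C̃(Γ_λ)/S_λ → C̃(BD_n^λ)`, `[c] ↦ κ(c)`. -/
def khat (N n : ℕ) (kap : Fin N → Fin n) (lam : Fin n → ℕ) (c : ℕ) :
    QC R N n kap (IsGamma kap) c →ₗ[R] SChain R (IsBDGraph lam) c :=
  liftOrZeroL R (ysub R N n kap (IsGamma kap) c)
    (chainMap R (rankP N) (rankP n) (kmap kap) (IsGamma kap) (IsBDGraph lam) c)

/-- The boundary map of the subcomplex `C̃(M_N; R)^{S_λ}`. -/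
def sbdry (N n : ℕ) (kap : Fin N → Fin n) (c : ℕ) :
    ysub R N n kap (IsMatching N) (c + 1) →ₗ[R] ysub R N n kap (IsMatching N) c :=
  restrictL R (bdry R (rankP N) (IsMatching N) c)
    (ysub R N n kap (IsMatching N) (c + 1)) (ysub R N n kap (IsMatching N) c)

/-- Homology of the subcomplex `C̃(M_N; R)^{S_λ}` in degree `dg`: the cycles of the
subcomplex (elements of the subcomplex with vanishing boundary) modulo the boundaries of
elements of the subcomplex. -/
abbrev SubH (N n : ℕ) (kap : Fin N → Fin n) (dg : ℕ) : Type _ :=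
  subQuotL R
    (ysub R N n kap (IsMatching N) (dg + 1) ⊓ cycLow R (rankP N) (IsMatching N) (dg + 1))
    ((ysub R N n kap (IsMatching N) (dg + 1 + 1)).map (bdry R (rankP N) (IsMatching N) (dg + 1)))

/-! ### Inclusion maps between matching complexes -/

/-- The chain map induced by the inclusion `M_m ⊆ M_{m'}`. -/
def inclChain (m m' : ℕ) (h : m ≤ m') (c : ℕ) :
    SChain R (IsMatching m) c →ₗ[R] SChain R (IsMatching m') c :=
  chainMap R (rankP m) (rankP m') (fun p => (Fin.castLE h p.1, Fin.castLE h p.2))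
    (IsMatching m) (IsMatching m') c

/-- The map `H̃_dg(M_m; R) → H̃_dg(M_{m'}; R)` induced by the inclusion. -/
def inclStar (m m' : ℕ) (h : m ≤ m') (dg : ℕ) : MH R m dg →ₗ[R] MH R m' dg :=
  subQuotMapL R (inclChain R m m' h (dg + 1))
    (cycLow R (rankP m) (IsMatching m) (dg + 1))
    (LinearMap.range (bdry R (rankP m) (IsMatching m) (dg + 1)))
    (cycLow R (rankP m') (IsMatching m') (dg + 1))
    (LinearMap.range (bdry R (rankP m') (IsMatching m') (dg + 1)))

/-! ### The pair `(M_m, M_m \ e)`, where `e` is the last edge -/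

/-- The edge `e` between the last two of the `m` vertices. -/
def eEdge (m : ℕ) (h : 2 ≤ m) : Fin m × Fin m := (⟨m - 2, by omega⟩, ⟨m - 1, by omega⟩)

/-- A face of `M_m \ e`: a matching not containing the edge `e`. -/
def MnMinusE (m : ℕ) (h : 2 ≤ m) (σ : Finset (Fin m × Fin m)) : Prop :=
  IsMatching m σ ∧ eEdge m h ∉ σ

/-- Pass from a set of edges avoiding the last two vertices of `Fin m` to a set of edges on
`Fin (m - 2)`. -/
def shrink (m : ℕ) (σ : Finset (Fin m × Fin m)) : Finset (Fin (m - 2) × Fin (m - 2)) :=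
  (σ.filter fun p => p.1.val < m - 2 ∧ p.2.val < m - 2).attach.image
    fun p => (⟨p.1.1.val, (Finset.mem_filter.mp p.2).2.1⟩,
              ⟨p.1.2.val, (Finset.mem_filter.mp p.2).2.2⟩)

/-- The chain map realizing the composition
`C̃(M_m) → C̃(M_m, M_m \ e) ≅ C̃(M_{m - 2})[1]`: a face `σ` containing `e` is written as
`σ = ± e ∧ w` and sent to `± w`, viewed in the matching complex on the remaining `m - 2`
vertices; a face not containing `e` is sent to zero. -/
def theta (m : ℕ) (hm : 2 ≤ m) (c : ℕ) :
    SChain R (IsMatching m) (c + 1) →ₗ[R] SChain R (IsMatching (m - 2)) c :=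
  Finsupp.lsum R fun σ => LinearMap.toSpanSingleton R _
    (if eEdge m hm ∈ σ.1 then
      ((-1 : ℤ) ^ c) • basisOrZero R (IsMatching (m - 2)) c (shrink m (σ.1.erase (eEdge m hm)))
     else 0)

/-- The map `H̃_dg(M_m \ e; R) → H̃_dg(M_m; R)` induced by the inclusion. -/
def inclEStar (m : ℕ) (hm : 2 ≤ m) (dg : ℕ) :
    RH R (rankP m) (MnMinusE m hm) dg →ₗ[R] MH R m dg :=
  subQuotMapL R (chainMap R (rankP m) (rankP m) id (MnMinusE m hm) (IsMatching m) (dg + 1))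
    (cycLow R (rankP m) (MnMinusE m hm) (dg + 1))
    (LinearMap.range (bdry R (rankP m) (MnMinusE m hm) (dg + 1)))
    (cycLow R (rankP m) (IsMatching m) (dg + 1))
    (LinearMap.range (bdry R (rankP m) (IsMatching m) (dg + 1)))

/-- The composition `H̃_dg(M_m; R) → H_dg(M_m, M_m \ e; R) ≅ H̃_{dg - 1}(M_{m - 2}; R)` of the
map to relative homology with the canonical isomorphism. -/
def thetaStar (m : ℕ) (hm : 2 ≤ m) (dg : ℕ) :
    MH R m dg →ₗ[R] RHc R (rankP (m - 2)) (IsMatching (m - 2)) dg :=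
  subQuotMapL R (theta R m hm dg)
    (cycLow R (rankP m) (IsMatching m) (dg + 1))
    (LinearMap.range (bdry R (rankP m) (IsMatching m) (dg + 1)))
    (cycLow R (rankP (m - 2)) (IsMatching (m - 2)) dg)
    (LinearMap.range (bdry R (rankP (m - 2)) (IsMatching (m - 2)) dg))

end YoungMore

end MatchPaper

end

namespace BDP

open MatchPaper

section generic
variable {V : Type*} [DecidableEq V] (rank : V → ℕ) (K : Finset V → Prop)

/-- The incidence sign. -/
def eps (σ : Finset V) (v : V) : ℤ := (-1) ^ ((σ.filter fun u => rank u < rank v).card)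

lemma eps_mul_self (σ : Finset V) (v : V) : eps rank σ v * eps rank σ v = 1 := by
  unfold eps
  rw [← pow_add, ← two_mul, pow_mul]; simp

lemma eps_erase_of_le {σ : Finset V} {v w : V} (h : ¬ rank w < rank v) :
    eps rank (σ.erase w) v = eps rank σ v := by
  unfold eps
  congr 2
  ext u
  simp only [Finset.mem_filter, Finset.mem_erase]
  constructor
  · rintro ⟨⟨_, h1⟩, h2⟩; exact ⟨h1, h2⟩
  · rintro ⟨h1, h2⟩
    refine ⟨⟨?_, h1⟩, h2⟩
    rintro rfl; exact h h2

lemma eps_erase_of_lt {σ : Finset V} {v w : V} (hv : v ∈ σ) (h : rank v < rank w) :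
    eps rank (σ.erase v) w = - eps rank σ w := by
  unfold eps
  have : (σ.filter fun u => rank u < rank w) =
      insert v ((σ.erase v).filter fun u => rank u < rank w) := by
    ext u
    simp only [Finset.mem_filter, Finset.mem_erase, Finset.mem_insert]
    by_cases huv : u = v
    · subst huv; simp [hv, h]
    · simp [huv]
  rw [this, Finset.card_insert_of_notMem (by simp), pow_succ]
  ring

lemma eps_anti (hr : Function.Injective rank) {σ : Finset V} {v w : V} (hv : v ∈ σ)
    (hw : w ∈ σ) (hvw : v ≠ w) :
    eps rank σ v * eps rank (σ.erase v) w = - (eps rank σ w * eps rank (σ.erase w) v) := by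
  rcases lt_or_gt_of_ne (fun h => hvw (hr h)) with h | h
  · rw [eps_erase_of_lt rank hv h, eps_erase_of_le rank (by omega : ¬ rank w < rank v)]; ring
  · rw [eps_erase_of_lt rank hw h, eps_erase_of_le rank (by omega : ¬ rank v < rank w)]; ring

variable {K}

lemma bas_zero {c : ℕ} {τ : Finset V} (h : ¬ K τ) : basisOrZero ℤ K c τ = 0 := by
  unfold basisOrZero
  rw [dif_neg]; tauto

lemma bas_eq {c : ℕ} {τ : Finset V} (h : K τ ∧ τ.card = c) :
    basisOrZero ℤ K c τ = Finsupp.single ⟨τ, h⟩ 1 := by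
  unfold basisOrZero
  rw [dif_pos h]

lemma bdry_bas {c : ℕ} {σ : Finset V} (h : K σ) (hc : σ.card = c + 1) :
    bdry ℤ rank K c (basisOrZero ℤ K (c + 1) σ) =
      ∑ v ∈ σ, eps rank σ v • basisOrZero ℤ K c (σ.erase v) := by
  rw [bas_eq ⟨h, hc⟩]
  unfold bdry
  rw [Finsupp.lsum_single]
  simp [eps]

lemma hom_ext {c : ℕ} {M : Type*} [AddCommGroup M] {f g : SChain ℤ K c →ₗ[ℤ] M}
    (h : ∀ σ, K σ → σ.card = c → f (basisOrZero ℤ K c σ) = g (basisOrZero ℤ K c σ)) : f = g := by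
  refine Finsupp.lhom_ext' fun σ => LinearMap.ext_ring ?_
  have := h σ.1 σ.2.1 σ.2.2
  rw [bas_eq σ.2] at this
  simpa using this

/-- Convexity of a family. -/
def Convex (K : Finset V → Prop) : Prop :=
  ∀ σ τ ρ : Finset V, K σ → K ρ → σ ⊆ τ → τ ⊆ ρ → K τ

lemma bdry_bdry (hr : Function.Injective rank) (hK : Convex K) (c : ℕ)
    (x : SChain ℤ K (c + 1 + 1)) : bdry ℤ rank K c (bdry ℤ rank K (c + 1) x) = 0 := by
  suffices h : (bdry ℤ rank K c) ∘ₗ (bdry ℤ rank K (c + 1)) = 0 from LinearMap.congr_fun h x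
  apply hom_ext
  intro σ hσ hc
  rw [LinearMap.comp_apply, bdry_bas rank hσ hc, map_sum, LinearMap.zero_apply]
  have key : ∀ v ∈ σ, bdry ℤ rank K c (eps rank σ v • basisOrZero ℤ K (c + 1) (σ.erase v)) =
      ∑ w ∈ σ.erase v, (eps rank σ v * eps rank (σ.erase v) w) •
        basisOrZero ℤ K c ((σ.erase v).erase w) := by
    intro v hv
    rw [map_smul]
    by_cases hk : K (σ.erase v)
    · rw [bdry_bas rank hk (by rw [Finset.card_erase_of_mem hv, hc]; rfl), Finset.smul_sum]
      simp only [smul_smul]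
    · rw [bas_zero hk, map_zero, smul_zero, eq_comm]
      apply Finset.sum_eq_zero
      intro w hw
      rw [bas_zero, smul_zero]
      intro h
      exact hk (hK _ _ _ h hσ (Finset.erase_subset _ _) (Finset.erase_subset _ _))
  rw [Finset.sum_congr rfl key, Finset.sum_sigma']
  refine Finset.sum_involution (fun p _ => ⟨p.2, p.1⟩) ?_ ?_ ?_ ?_
  · rintro ⟨v, w⟩ h
    simp only [Finset.mem_sigma, Finset.mem_erase] at h
    obtain ⟨hv, hwv, hw⟩ := h
    simp only
    rw [eps_anti rank hr hv hw (Ne.symm hwv), Finset.erase_right_comm, neg_smul, neg_add_cancel]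
  · rintro ⟨v, w⟩ h _ h2
    simp only [Finset.mem_sigma, Finset.mem_erase] at h
    simp only [Sigma.mk.injEq, heq_eq_eq] at h2
    exact h.2.1 h2.1
  · rintro ⟨v, w⟩ h
    simp only [Finset.mem_sigma, Finset.mem_erase] at h ⊢
    tauto
  · rintro ⟨v, w⟩ h; rfl

/-- The contraction along `v`. -/
noncomputable def hh (K : Finset V → Prop) (v : V) (c : ℕ) :
    SChain ℤ K c →ₗ[ℤ] SChain ℤ K (c + 1) :=
  Finsupp.lsum ℤ fun σ => LinearMap.toSpanSingleton ℤ _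
    (if v ∈ σ.1 then 0 else
      eps rank (insert v σ.1) v • basisOrZero ℤ K (c + 1) (insert v σ.1))

lemma hh_bas (v : V) {c : ℕ} {σ : Finset V} (h : K σ) (hc : σ.card = c) :
    hh rank K v c (basisOrZero ℤ K c σ) = if v ∈ σ then 0 else
      eps rank (insert v σ) v • basisOrZero ℤ K (c + 1) (insert v σ) := by
  rw [bas_eq ⟨h, hc⟩]
  unfold hh
  rw [Finsupp.lsum_single]
  simp

/-- Restriction of chains to another family. -/
noncomputable def res (K L : Finset V → Prop) (c : ℕ) : SChain ℤ K c →ₗ[ℤ] SChain ℤ L c :=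
  Finsupp.lsum ℤ fun σ => LinearMap.toSpanSingleton ℤ _ (basisOrZero ℤ L c σ.1)

lemma res_bas {L : Finset V → Prop} {c : ℕ} {σ : Finset V} (h : K σ) (hc : σ.card = c) :
    res K L c (basisOrZero ℤ K c σ) = basisOrZero ℤ L c σ := by
  rw [bas_eq ⟨h, hc⟩]
  unfold res
  rw [Finsupp.lsum_single]
  simp

/-- The family left after matching with the vertex `v`. -/
def del (K : Finset V → Prop) (v : V) (σ : Finset V) : Prop :=
  K σ ∧ v ∉ σ ∧ ¬ K (insert v σ)

lemma del_res_self (v : V) (c : ℕ) (y : SChain ℤ (del K v) c) :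
    res K (del K v) c (res (del K v) K c y) = y := by
  suffices h : res K (del K v) c ∘ₗ res (del K v) K c = LinearMap.id from
    LinearMap.congr_fun h y
  apply hom_ext
  intro σ hσ hc
  rw [LinearMap.comp_apply, res_bas hσ hc, res_bas hσ.1 hc, LinearMap.id_apply]

lemma res_bdry (hK : Convex K) (hv : ∀ σ, K σ → K (σ.erase v)) (c : ℕ)
    (x : SChain ℤ K (c + 1)) :
    res K (del K v) c (bdry ℤ rank K c x) =
      bdry ℤ rank (del K v) c (res K (del K v) (c + 1) x) := by
  suffices h : res K (del K v) c ∘ₗ bdry ℤ rank K c =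
      bdry ℤ rank (del K v) c ∘ₗ res K (del K v) (c + 1) from LinearMap.congr_fun h x
  apply hom_ext
  intro σ hσ hc
  rw [LinearMap.comp_apply, LinearMap.comp_apply, bdry_bas rank hσ hc, res_bas hσ hc, map_sum]
  have key : ∀ w ∈ σ, res K (del K v) c (eps rank σ w • basisOrZero ℤ K c (σ.erase w)) =
      eps rank σ w • basisOrZero ℤ (del K v) c (σ.erase w) := by
    intro w hw
    rw [map_smul]
    by_cases hk : K (σ.erase w)
    · rw [res_bas hk (by rw [Finset.card_erase_of_mem hw, hc]; rfl)]
    · rw [bas_zero hk, bas_zero (K := del K v) (fun h => hk h.1), map_zero]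
  rw [Finset.sum_congr rfl key]
  by_cases hd : del K v σ
  · rw [bdry_bas rank hd hc]
  · rw [bas_zero hd, map_zero]
    apply Finset.sum_eq_zero
    intro w hw
    rw [bas_zero, smul_zero]
    rintro ⟨h1, h2, h3⟩
    apply hd
    by_cases hvs : v ∈ σ
    · have : w = v := by
        by_contra hne
        exact h2 (Finset.mem_erase.mpr ⟨fun h => hne h.symm, hvs⟩)
      subst this
      rw [Finset.insert_erase hw] at h3
      exact absurd hσ h3
    · refine ⟨hσ, hvs, fun hi => h3 ?_⟩
      exact hK _ _ _ h1 hi (Finset.subset_insert _ _)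
        (Finset.insert_subset_insert _ (Finset.erase_subset _ _))

lemma res_hh (v : V) (c : ℕ) (x : SChain ℤ K c) :
    res K (del K v) (c + 1) (hh rank K v c x) = 0 := by
  suffices h : res K (del K v) (c + 1) ∘ₗ hh rank K v c = 0 from LinearMap.congr_fun h x
  apply hom_ext
  intro σ hσ hc
  rw [LinearMap.comp_apply, hh_bas rank v hσ hc, LinearMap.zero_apply]
  split_ifs with h
  · simp
  · rw [map_smul]
    by_cases hk : K (insert v σ)
    · rw [res_bas hk (by rw [Finset.card_insert_of_notMem h, hc]), bas_zero, smul_zero]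
      intro hd
      exact hd.2.1 (Finset.mem_insert_self _ _)
    · rw [bas_zero hk, map_zero, smul_zero]

/-- homotopy identity on one basis element, low degree. -/
lemma homotopy_zero (v : V) (x : SChain ℤ K 0) :
    bdry ℤ rank K 0 (hh rank K v 0 x) + res (del K v) K 0 (res K (del K v) 0 x) = x := by
  suffices h : bdry ℤ rank K 0 ∘ₗ hh rank K v 0 + res (del K v) K 0 ∘ₗ res K (del K v) 0 =
    LinearMap.id from LinearMap.congr_fun h x
  apply hom_ext
  intro σ hσ hc
  have hc' := Finset.card_eq_zero.mp hc
  simp only [LinearMap.add_apply, LinearMap.comp_apply, LinearMap.id_apply]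
  rw [hh_bas rank v hσ hc, res_bas hσ hc]
  subst hc'
  rw [if_neg (by simp), map_smul]
  by_cases hk : K (insert v ∅)
  · rw [bdry_bas rank hk (by simp), bas_zero (K := del K v) (fun h => h.2.2 hk), map_zero, add_zero,
      Finset.sum_insert (by simp), Finset.sum_empty, add_zero, smul_smul, eps_mul_self, one_smul,
      Finset.erase_insert (by simp)]
  · rw [bas_zero hk, res_bas (K := del K v) ⟨hσ, by simp, hk⟩ hc]
    simp

lemma homotopy_succ (hr : Function.Injective rank) {v : V}
    (hv : ∀ σ, K σ → K (σ.erase v)) (c : ℕ) (x : SChain ℤ K (c + 1))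
    (hx : res K (del K v) (c + 1) x = 0) :
    bdry ℤ rank K (c + 1) (hh rank K v (c + 1) x) + hh rank K v c (bdry ℤ rank K c x) = x := by
  have main : bdry ℤ rank K (c + 1) ∘ₗ hh rank K v (c + 1) ∘ₗ
      (LinearMap.id - res (del K v) K (c + 1) ∘ₗ res K (del K v) (c + 1)) +
      hh rank K v c ∘ₗ bdry ℤ rank K c ∘ₗ
      (LinearMap.id - res (del K v) K (c + 1) ∘ₗ res K (del K v) (c + 1)) =
      (LinearMap.id - res (del K v) K (c + 1) ∘ₗ res K (del K v) (c + 1)) := by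
    apply hom_ext
    intro σ hσ hc
    simp only [LinearMap.add_apply, LinearMap.comp_apply, LinearMap.id_apply,
      LinearMap.sub_apply]
    rw [res_bas hσ hc]
    by_cases hd : del K v σ
    · rw [res_bas hd hc]; simp
    rw [bas_zero hd, map_zero, sub_zero, hh_bas rank v hσ hc, bdry_bas rank hσ hc, map_sum]
    by_cases hvs : v ∈ σ
    · rw [if_pos hvs, map_zero, zero_add, Finset.sum_eq_single_of_mem v hvs]
      · rw [map_smul, hh_bas rank v (hv _ hσ) (by rw [Finset.card_erase_of_mem hvs, hc]; rfl),
          if_neg (by simp), Finset.insert_erase hvs, smul_smul, eps_mul_self, one_smul]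
      · intro w hw hwv
        rw [map_smul]
        by_cases hk : K (σ.erase w)
        · rw [hh_bas rank v hk (by rw [Finset.card_erase_of_mem hw, hc]; rfl),
            if_pos (Finset.mem_erase.mpr ⟨Ne.symm hwv, hvs⟩), smul_zero]
        · rw [bas_zero hk, map_zero, smul_zero]
    · have hi : K (insert v σ) := by
        by_contra hi
        exact hd ⟨hσ, hvs, hi⟩
      rw [if_neg hvs, map_smul, bdry_bas rank hi (by rw [Finset.card_insert_of_notMem hvs, hc]),
        Finset.sum_insert hvs, smul_add, smul_smul, eps_mul_self, one_smul,
        Finset.erase_insert hvs, add_assoc, Finset.smul_sum, ← Finset.sum_add_distrib,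
        Finset.sum_eq_zero, add_zero]
      intro w hw
      have hwv : w ≠ v := fun h => hvs (h ▸ hw)
      have e1 : (insert v σ).erase w = insert v (σ.erase w) :=
        Finset.erase_insert_of_ne (Ne.symm hwv)
      have e2 : (insert v σ).erase v = σ := Finset.erase_insert hvs
      have hs := eps_anti rank hr (Finset.mem_insert_self v σ) (Finset.mem_insert_of_mem hw)
        (Ne.symm hwv)
      rw [e1, e2] at hs
      rw [smul_smul, map_smul, e1]
      by_cases hk : K (σ.erase w)
      · rw [hh_bas rank v hk (by rw [Finset.card_erase_of_mem hw, hc]; rfl),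
          if_neg (fun h => hvs (Finset.mem_of_mem_erase h)), smul_smul, ← add_smul]
        have h4 : eps rank (insert v σ) w * eps rank (insert v σ) w = 1 := eps_mul_self _ _ _
        have h5 : eps rank (insert v σ) v * eps rank (insert v σ) v = 1 := eps_mul_self _ _ _
        have h6 : eps rank (insert v (σ.erase w)) v * eps rank (insert v (σ.erase w)) v = 1 :=
          eps_mul_self _ _ _
        have : eps rank (insert v σ) v * eps rank (insert v σ) w +
            eps rank σ w * eps rank (insert v (σ.erase w)) v = 0 := by
          have := congrArg (fun z => z * (eps rank (insert v σ) v *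
            eps rank (insert v (σ.erase w)) v)) hs
          beta_reduce at this
          have l : eps rank (insert v σ) v * eps rank σ w * (eps rank (insert v σ) v *
            eps rank (insert v (σ.erase w)) v) = eps rank σ w * eps rank (insert v (σ.erase w)) v := by
            linear_combination (eps rank σ w * eps rank (insert v (σ.erase w)) v) * h5
          have r : -(eps rank (insert v σ) w * eps rank (insert v (σ.erase w)) v) *
            (eps rank (insert v σ) v * eps rank (insert v (σ.erase w)) v) =
            - (eps rank (insert v σ) v * eps rank (insert v σ) w) := by
            linear_combination (-eps rank (insert v σ) v * eps rank (insert v σ) w) * h6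
          rw [l, r] at this
          linarith
        rw [this, zero_smul]
      · have hk2 : ¬ K (insert v (σ.erase w)) := by
          intro h
          have := hv _ h
          rw [Finset.erase_insert (fun h => hvs (Finset.mem_of_mem_erase h))] at this
          exact hk this
        rw [bas_zero hk, bas_zero hk2]
        simp
  have := LinearMap.congr_fun main x
  simpa [hx] using this

lemma bdry_mem_cycLow (hr : Function.Injective rank) (hK : Convex K) (c : ℕ)
    (x : SChain ℤ K (c + 1)) : bdry ℤ rank K c x ∈ cycLow ℤ rank K c := by
  cases c with
  | zero => exact Submodule.mem_top
  | succ c => exact bdry_bdry rank hr hK c x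

lemma acyc (hr : Function.Injective rank) {v : V} (hv : ∀ σ, K σ → K (σ.erase v)) (c : ℕ)
    (x : SChain ℤ K c) (hx : res K (del K v) c x = 0) (hz : x ∈ cycLow ℤ rank K c) :
    bdry ℤ rank K c (hh rank K v c x) = x := by
  cases c with
  | zero =>
    have := homotopy_zero rank v x
    rwa [hx, map_zero, add_zero] at this
  | succ c =>
    have := homotopy_succ rank hr hv c x hx
    rwa [LinearMap.mem_ker.mp hz, map_zero, add_zero] at this

theorem reduce (hr : Function.Injective rank) (hK : Convex K) {v : V}
    (hv : ∀ σ, K σ → K (σ.erase v)) (m : ℕ) :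
    Nonempty (RHc ℤ rank K (m + 1) ≃ₗ[ℤ] RHc ℤ rank (del K v) (m + 1)) := by
  set L := del K v with hL
  have hmap : ∀ x ∈ cycLow ℤ rank K (m + 1), res K L (m + 1) x ∈ cycLow ℤ rank L (m + 1) := by
    intro x hx
    have hx' : bdry ℤ rank K m x = 0 := hx
    change bdry ℤ rank L m _ = 0
    rw [← res_bdry rank hK hv, hx', map_zero]
  let f : cycLow ℤ rank K (m + 1) →ₗ[ℤ] RHc ℤ rank L (m + 1) :=
    (Submodule.mkQ _) ∘ₗ (res K L (m + 1)).restrict hmap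
  have hsurj : Function.Surjective f := by
    intro q
    obtain ⟨⟨y, hy⟩, rfl⟩ := Submodule.mkQ_surjective _ q
    set x := res L K (m + 1) y with hx
    have hxy : res K L (m + 1) x = y := del_res_self v _ y
    have h0 : res K L m (bdry ℤ rank K m x) = 0 := by
      rw [res_bdry rank hK hv, hxy]; exact hy
    have h1 := acyc rank hr hv m _ h0 (bdry_mem_cycLow rank hr hK m x)
    have h2 : x - hh rank K v m (bdry ℤ rank K m x) ∈ cycLow ℤ rank K (m + 1) := by
      change bdry ℤ rank K m (x - hh rank K v m (bdry ℤ rank K m x)) = 0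
      rw [map_sub, h1, sub_self]
    have h3 : res K L (m + 1) (x - hh rank K v m (bdry ℤ rank K m x)) = y := by
      rw [map_sub, hxy, res_hh, sub_zero]
    refine ⟨⟨x - hh rank K v m (bdry ℤ rank K m x), h2⟩, ?_⟩
    have h4 : (res K L (m + 1)).restrict hmap ⟨x - hh rank K v m (bdry ℤ rank K m x), h2⟩ =
      ⟨y, hy⟩ := Subtype.ext h3
    exact congrArg (Submodule.mkQ _) h4
  have hker : LinearMap.ker f =
      (LinearMap.range (bdry ℤ rank K (m + 1))).comap (cycLow ℤ rank K (m + 1)).subtype := by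
    ext ⟨x, hx⟩
    rw [LinearMap.mem_ker, Submodule.mem_comap]
    change (Submodule.mkQ ((LinearMap.range (bdry ℤ rank L (m + 1))).comap
      (cycLow ℤ rank L (m + 1)).subtype) ⟨res K L (m + 1) x, hmap x hx⟩ = 0) ↔ x ∈ _
    rw [Submodule.mkQ_apply, Submodule.Quotient.mk_eq_zero, Submodule.mem_comap]
    change res K L (m + 1) x ∈ _ ↔ _
    constructor
    · rintro ⟨y, hy⟩
      set w := res L K (m + 1 + 1) y with hw
      have hwy : res K L (m + 1 + 1) w = y := del_res_self v _ y
      have h0 : res K L (m + 1) (x - bdry ℤ rank K (m + 1) w) = 0 := by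
        rw [map_sub, res_bdry rank hK hv, hwy, hy, sub_self]
      have h1 : x - bdry ℤ rank K (m + 1) w ∈ cycLow ℤ rank K (m + 1) :=
        Submodule.sub_mem _ hx (bdry_mem_cycLow rank hr hK (m + 1) w)
      have h2 := acyc rank hr hv (m + 1) _ h0 h1
      refine ⟨hh rank K v (m + 1) (x - bdry ℤ rank K (m + 1) w) + w, ?_⟩
      rw [map_add, h2]; abel
    · rintro ⟨y, hy⟩
      refine ⟨res K L (m + 1 + 1) y, ?_⟩
      rw [← res_bdry rank hK hv, hy]
  exact ⟨(Submodule.quotEquivOfEq _ _ hker.symm).trans (f.quotKerEquivOfSurjective hsurj)⟩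

end generic
end BDP

namespace BDP

open MatchPaper

/-- Edges of the complete graph with loops. -/
abbrev E7 : Type := Fin 7 × Fin 7

lemma rankP_inj : Function.Injective (rankP 7) := by
  rintro ⟨a, b⟩ ⟨c, d⟩ h
  simp only [rankP] at h
  have := a.2; have := b.2; have := c.2; have := d.2
  have h1 : a.val = c.val := by omega
  have h2 : b.val = d.val := by omega
  exact Prod.ext (Fin.ext h1) (Fin.ext h2)

/-- contribution of an edge to the degree of a vertex -/
def ct (p : E7) (j : Fin 7) : ℕ := (if p.1 = j then 1 else 0) + (if p.2 = j then 1 else 0)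

lemma degB_eq (σ : Finset E7) (j : Fin 7) : degB σ j = ∑ p ∈ σ, ct p j := rfl

lemma degB_insert {σ : Finset E7} {p : E7} (h : p ∉ σ) (j : Fin 7) :
    degB (insert p σ) j = ct p j + degB σ j := by
  rw [degB_eq, degB_eq, Finset.sum_insert h]

lemma degB_mono {σ τ : Finset E7} (h : σ ⊆ τ) (j : Fin 7) : degB σ j ≤ degB τ j := by
  rw [degB_eq, degB_eq]
  exact Finset.sum_le_sum_of_subset h

/-- The intermediate families. -/
def KK (i : ℕ) (σ : Finset E7) : Prop :=
  IsBDGraph (fun _ : Fin 7 => 2) σ ∧ ∀ j : Fin 7, j.val < i → (j, j) ∉ σ ∧ 1 ≤ degB σ j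

lemma KK_zero : KK 0 = IsBDGraph (fun _ : Fin 7 => 2) := by
  funext σ
  simp [KK]

lemma KK_convex (i : ℕ) : Convex (KK i) := by
  rintro σ τ ρ ⟨h1, h2⟩ ⟨h3, h4⟩ h5 h6
  refine ⟨⟨fun p hp => h3.1 p (h6 hp), fun j => (degB_mono h6 j).trans (h3.2 j)⟩, fun j hj => ?_⟩
  exact ⟨fun h => (h4 j hj).1 (h6 h), (h2 j hj).2.trans (degB_mono h5 j)⟩

lemma KK_erase (i : Fin 7) (σ : Finset E7) (h : KK i σ) : KK i (σ.erase (i, i)) := by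
  obtain ⟨h1, h2⟩ := h
  have hs := Finset.erase_subset (i, i) σ
  refine ⟨⟨fun p hp => h1.1 p (hs hp), fun j => (degB_mono hs j).trans (h1.2 j)⟩, fun j hj => ?_⟩
  refine ⟨fun h => (h2 j hj).1 (hs h), ?_⟩
  have h3 := (h2 j hj).2
  by_cases hi : (i, i) ∈ σ
  · rw [← Finset.insert_erase hi, degB_insert (by simp)] at h3
    have : ct (i, i) j = 0 := by
      have : i ≠ j := fun h => by subst h; exact lt_irrefl _ hj
      simp [ct, this]
    omega
  · rwa [Finset.erase_eq_of_notMem hi]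

lemma del_KK (i : Fin 7) : del (KK i) (i, i) = KK (i + 1) := by
  funext σ
  apply propext
  constructor
  · rintro ⟨⟨h1, h2⟩, h3, h4⟩
    refine ⟨h1, fun j hj => ?_⟩
    rcases Nat.lt_succ_iff_lt_or_eq.mp hj with h | h
    · exact h2 j h
    · have hji : j = i := Fin.ext h
      subst hji
      refine ⟨h3, ?_⟩
      by_contra hd
      have hd0 : degB σ j = 0 := by omega
      apply h4
      refine ⟨⟨?_, ?_⟩, ?_⟩
      · intro p hp
        rcases Finset.mem_insert.mp hp with rfl | hp
        · exact le_refl _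
        · exact h1.1 p hp
      · intro k
        rw [degB_insert h3]
        by_cases hk : j = k
        · subst hk; simp [ct, hd0]
        · have := h1.2 k
          simpa [ct, hk] using this
      · intro k hk
        rw [degB_insert h3]
        have h5 := h2 k hk
        refine ⟨?_, by omega⟩
        rw [Finset.mem_insert]
        rintro (h | h)
        · rw [Prod.mk.injEq] at h
          rw [h.1] at hk; exact lt_irrefl _ hk
        · exact h5.1 h
  · rintro ⟨h1, h2⟩
    have h3 := h2 i (Nat.lt_succ_self _)
    refine ⟨⟨h1, fun j hj => h2 j (Nat.lt_succ_of_lt hj)⟩, h3.1, ?_⟩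
    rintro ⟨h4, _⟩
    have h5 := h4.2 i
    rw [degB_insert h3.1] at h5
    simp only [ct, if_true] at h5
    omega

/-- The reduced family: no loops, all degrees one or two. -/
def Kd (σ : Finset E7) : Prop :=
  (∀ p ∈ σ, p.1 < p.2) ∧ ∀ j, 1 ≤ degB σ j ∧ degB σ j ≤ 2

lemma Kd_eq : KK 7 = Kd := by
  funext σ
  apply propext
  constructor
  · rintro ⟨h1, h2⟩
    refine ⟨fun p hp => lt_of_le_of_ne (h1.1 p hp) ?_, fun j => ⟨(h2 j j.2).2, h1.2 j⟩⟩
    intro h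
    apply (h2 p.1 p.1.2).1
    convert hp using 1
    exact Prod.ext rfl h
  · rintro ⟨h1, h2⟩
    exact ⟨⟨fun p hp => (h1 p hp).le, fun j => (h2 j).2⟩,
      fun j _ => ⟨fun h => lt_irrefl _ (h1 _ h), (h2 j).1⟩⟩

lemma Kd_convex : Convex Kd := Kd_eq ▸ KK_convex 7

/-- Chains of the reduced family. -/
abbrev D (c : ℕ) : Type := SChain ℤ Kd c
/-- Boundary of the reduced family. -/
noncomputable abbrev dd (c : ℕ) : D (c + 1) →ₗ[ℤ] D c := bdry ℤ (rankP 7) Kd c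
/-- basis elements -/
noncomputable abbrev bb (c : ℕ) (σ : Finset E7) : D c := basisOrZero ℤ Kd c σ

theorem to_Kd (m : ℕ) :
    Nonempty (BDH ℤ (fun _ : Fin 7 => 2) m ≃ₗ[ℤ] RHc ℤ (rankP 7) Kd (m + 1)) := by
  have step : ∀ i : Fin 7, Nonempty (RHc ℤ (rankP 7) (KK i) (m + 1) ≃ₗ[ℤ]
      RHc ℤ (rankP 7) (KK (i + 1)) (m + 1)) := by
    intro i
    have := reduce (rankP 7) rankP_inj (KK_convex i) (KK_erase i) m
    rwa [del_KK] at this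
  rw [← Kd_eq]
  change Nonempty (RHc ℤ (rankP 7) (IsBDGraph (fun _ : Fin 7 => 2)) (m + 1) ≃ₗ[ℤ] _)
  rw [← KK_zero]
  obtain ⟨e0⟩ := step 0
  obtain ⟨e1⟩ := step 1
  obtain ⟨e2⟩ := step 2
  obtain ⟨e3⟩ := step 3
  obtain ⟨e4⟩ := step 4
  obtain ⟨e5⟩ := step 5
  obtain ⟨e6⟩ := step 6
  exact ⟨e0.trans <| e1.trans <| e2.trans <| e3.trans <| e4.trans <| e5.trans e6⟩

lemma sum_ct (p : E7) : ∑ j, ct p j = 2 := by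
  simp [ct, Finset.sum_add_distrib]

lemma sum_deg (σ : Finset E7) : ∑ j, degB σ j = 2 * σ.card := by
  simp only [degB_eq]
  rw [Finset.sum_comm]
  simp [sum_ct, mul_comm]

lemma Kd_card {σ : Finset E7} (h : Kd σ) : 4 ≤ σ.card ∧ σ.card ≤ 7 := by
  have h1 := sum_deg σ
  have h2 : ∑ j : Fin 7, 1 ≤ ∑ j, degB σ j := Finset.sum_le_sum fun j _ => (h.2 j).1
  have h3 : ∑ j, degB σ j ≤ ∑ j : Fin 7, 2 := Finset.sum_le_sum fun j _ => (h.2 j).2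
  simp at h2 h3
  omega

end BDP

namespace BDP

open MatchPaper

/-- packed table of the edge weights -/
def wtab : ℕ := 67273869437478462419276250236940754155188316309395743889160814941139506895211084974977865373625451323607954998809344532831265959768502053548907543374995911891745119263774474257

/-- weight of an edge: `16 ^ i + 16 ^ j` -/
def w (k : ℕ) : ℕ := Nat.mod (Nat.shiftRight wtab (Nat.mul 28 k)) 268435456

/-- all degrees at most two -/
def okN (N : ℕ) : Bool := Nat.beq (Nat.land (Nat.add N 89478485) 143165576) 0

/-- all degrees one or two -/
def vldN (N : ℕ) : Bool := Nat.beq (Nat.land (Nat.add N 17895697) 250539758) 35791394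

/-- total weight -/
def wsum : List ℕ → ℕ
  | [] => 0
  | a :: t => Nat.add (w a) (wsum t)

/-- sum of `f` over all valid lists -/
def trav (f : List ℕ → ℕ) : List ℕ → ℕ → ℕ → List ℕ → ℕ
  | [], c, N, acc => match c with
    | 0 => bif vldN N then f acc else 0
    | _ + 1 => 0
  | k :: es, c, N, acc => match c with
    | 0 => bif vldN N then f acc else 0
    | c + 1 => Nat.add (trav f es (c + 1) N acc)
        (bif okN (Nat.add N (w k)) then trav f es c (Nat.add N (w k)) (k :: acc) else 0)

/-- edges in decreasing order -/
def eds : List ℕ := [20, 19, 18, 17, 16, 15, 14, 13, 12, 11, 10, 9, 8, 7, 6, 5, 4, 3, 2, 1, 0]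

/-- signed sublists of colength one -/
def bdl : List ℕ → List (Bool × List ℕ)
  | [] => []
  | a :: t => (true, t) :: (bdl t).map (fun p => (!p.1, a :: p.2))

/-- sign of a boolean -/
def sg (b : Bool) : ℤ := bif b then 1 else -1

/-- adjacency bit -/
def adj (a b r : ℕ) : ℕ := bif Nat.beq (Nat.land a b) 0 then 0 else r

/-- packed table of the cocycle -/
def ptab : ℕ := 44462416497798471986198225364826218883637053625033074582675931012841939597138182553258574939225869182956211411898112245778008338586216978183045395606741056065943894746118474156794415712777231529263314856331089871592374419449646928926285601319122761841530562168032603102467893642171146711672084153887462999098978070019154790398627237882782805842622361215080713601672224925221002142758521592822323534417803367101540323490002679929039987780209600780832004867577973635079534866010734592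

/-- decoding of the table entries -/
def pdec (n : ℕ) : ℤ := match n with
  | 0 => 0
  | 1 => 1
  | _ => -1

/-- the cocycle on lists of edges -/
def phiL : List ℕ → ℤ
  | [a, b, c, d, e] =>
    pdec (Nat.mod (Nat.shiftRight ptab (Nat.mul 2
      (adj (w a) (w b) 1 + adj (w a) (w c) 2 + adj (w a) (w d) 4 + adj (w a) (w e) 8 +
       adj (w b) (w c) 16 + adj (w b) (w d) 32 + adj (w b) (w e) 64 +
       adj (w c) (w d) 128 + adj (w c) (w e) 256 + adj (w d) (w e) 512))) 4)
  | _ => 0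

/-- valid signed sublists -/
def bdv (l : List ℕ) : List (Bool × List ℕ) := (bdl l).filter fun p => vldN (wsum p.2)

/-- value of the cocycle on a signed sum -/
def sval : List (Bool × List ℕ) → ℤ
  | [] => 0
  | p :: t => (bif p.1 then phiL p.2 else -phiL p.2) + sval t

/-- check that the coboundary of the cocycle vanishes mod 5 -/
def chk6 (l : List ℕ) : ℕ := bif Nat.beq (Int.natAbs (sval (bdv l)) % 5) 0 then 0 else 1

end BDP

namespace BDP

open MatchPaper

/-- decode base 32 digits -/
def decL : ℕ → ℕ → List ℕ
  | 0, _ => []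
  | c + 1, n => Nat.mod n 32 :: decL c (Nat.div n 32)

/-- bit mask -/
def mask : List ℕ → ℕ
  | [] => 0
  | a :: t => Nat.lor (Nat.pow 2 a) (mask t)

/-- strictly increasing with entries below 21 -/
def srt : List ℕ → Bool
  | [] => true
  | a :: t => (match t with
    | [] => Nat.blt a 21
    | b :: _ => Nat.blt a b) && srt t

/-- sorted insertion -/
def insS (k : ℕ) : List ℕ → List ℕ
  | [] => [k]
  | a :: t => bif Nat.blt k a then k :: a :: t else a :: insS k t

/-- equality test -/
def leq : List ℕ → List ℕ → Bool
  | [], [] => true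
  | a :: s, b :: t => Nat.beq a b && leq s t
  | _, _ => false

/-- recognise a list with a single valid sublist, namely `l` -/
def isOne (l : List ℕ) : List (Bool × List ℕ) → Bool
  | [p] => leq p.2 l
  | _ => false

/-- search for an extension with a single valid sublist -/
def glS (l : List ℕ) : List ℕ → Option (List ℕ)
  | [] => none
  | k :: ks => bif vldN (Nat.add (w k) (wsum l)) && srt (insS k l) && isOne l (bdv (insS k l))
      then some (insS k l) else glS l ks

/-- the chosen extension of a four-element face -/
def glf (l : List ℕ) : List ℕ := (glS l eds).getD []

/-- check for the chosen extension -/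
def chk4 (l : List ℕ) : ℕ :=
  bif srt (glf l) && vldN (wsum (glf l)) && isOne l (bdv (glf l)) &&
    Nat.beq (glf l).length 5 && Nat.beq (Int.natAbs (phiL (glf l))) 0
  then 0 else 1

/-- force evaluation of a natural number -/
def forceN {α : Type} (n : ℕ) (K : ℕ → α) : α :=
  Nat.rec (K 0) (fun m _ => K (Nat.succ m)) n

/-- force evaluation of an integer -/
def forceZ {α : Type} (z : ℤ) (K : ℤ → α) : α := match z with
  | Int.ofNat n => forceN n fun n => K (Int.ofNat n)
  | Int.negSucc n => forceN n fun n => K (Int.negSucc n)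

/-- search trees of keys -/
inductive St where
  | nil : St
  | node (l : St) (k : ℕ) (r : St) : St

/-- insertion (continuation passing) -/
def St.add {α : Type} : St → ℕ → (St → α) → α
  | .nil, k, K => K (.node .nil k .nil)
  | .node l a r, k, K =>
    bif Nat.blt k a then l.add k (fun l' => K (.node l' a r)) else
    bif Nat.beq k a then K (.node l a r) else r.add k (fun r' => K (.node l a r'))

/-- membership -/
def St.has : St → ℕ → Bool
  | .nil, _ => false
  | .node l a r, k =>
    bif Nat.blt k a then l.has k else bif Nat.beq k a then true else r.has k

/-- search trees with integer values -/
inductive Tr where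
  | nil : Tr
  | node (l : Tr) (k : ℕ) (v : ℤ) (r : Tr) : Tr

/-- adding a value at a key (continuation passing) -/
def Tr.add {α : Type} : Tr → ℕ → ℤ → (Tr → α) → α
  | .nil, k, v, K => K (.node .nil k v .nil)
  | .node l a x r, k, v, K =>
    bif Nat.blt k a then l.add k v (fun l' => K (.node l' a x r)) else
    bif Nat.beq k a then forceZ (x + v) (fun y => K (.node l a y r)) else
    r.add k v (fun r' => K (.node l a x r'))

/-- all values vanish -/
def Tr.allz : Tr → Bool
  | .nil => true
  | .node l _ v r => Nat.beq (Int.natAbs v) 0 && l.allz && r.allz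

/-- add a signed multiple of a signed sum to a tree -/
def addAll (c : ℤ) (K : Tr → Bool) : List (Bool × List ℕ) → Tr → Bool
  | [], t => K t
  | p :: ps, t => forceN (mask p.2) fun m => forceZ (bif p.1 then c else -c) fun v =>
      t.add m v (addAll c K ps)

/-- process the certificate -/
def uloop (K : Tr → Bool) : List ℕ → Tr → Bool
  | [], t => K t
  | n :: ns, t =>
    srt (decL 6 n) && vldN (wsum (decL 6 n)) &&
    addAll (Int.subNatNat (Nat.shiftRight n 30) 64) (uloop K ns) (bdv (decL 6 n)) t

/-- process a list of lists -/
def uloops (K : Tr → Bool) : List (List ℕ) → Tr → Bool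
  | [], t => K t
  | n :: ns, t => uloop (uloops K ns) n t

/-- packed table of edge indices -/
def itab : ℕ := 1138003474592113402848714059903822072063617221816429829964215718822085632

/-- index of an edge given its endpoints -/
def ix (i j : ℕ) : ℕ := Nat.mod (Nat.shiftRight itab (Nat.mul 5 (Nat.add (Nat.mul 7 i) j))) 32

/-- the digits of a permutation -/
def pg (n a : ℕ) : ℕ := Nat.mod (Nat.shiftRight n (Nat.mul 3 a)) 8

/-- image of the edge `ab` under a permutation -/
def im (n a b : ℕ) : ℕ := ix (pg n a) (pg n b)

/-- injectivity -/
def pok (n : ℕ) : Bool :=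
  leq (insS (pg n 0) (insS (pg n 1) (insS (pg n 2) (insS (pg n 3) (insS (pg n 4)
    (insS (pg n 5) (insS (pg n 6) []))))))) [0, 1, 2, 3, 4, 5, 6]

/-- the images of the basic four-element face -/
def tauX (n : ℕ) : List ℕ := insS (im n 0 1) (insS (im n 1 2) (insS (im n 3 4) [im n 5 6]))

/-- the images of the basic five-element faces -/
def fX (n a b : ℕ) : List ℕ := [im n 0 1, im n 1 2, im n 3 4, im n a b, im n 5 6]

/-- process the permutations -/
def xloop (K : St → Bool) : List ℕ → St → Bool
  | [], t => K t
  | n :: ns, t =>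
    pok n && srt (tauX n) && vldN (wsum (tauX n)) && Nat.beq (tauX n).length 4 &&
    forceN (mask (glf (tauX n))) fun g =>
    forceN (mask (fX n 4 5)) fun m1 => forceN (mask (fX n 3 5)) fun m2 =>
    forceN (mask (fX n 4 6)) fun m3 => forceN (mask (fX n 3 6)) fun m4 =>
    (Nat.beq g m1 || Nat.beq g m2 || Nat.beq g m3 || Nat.beq g m4) &&
    t.add m1 fun t => t.add m2 fun t => t.add m3 fun t => t.add m4 (xloop K ns)

/-- process a list of lists -/
def xloops (K : St → Bool) : List (List ℕ) → St → Bool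
  | [], t => K t
  | n :: ns, t => xloop (xloops K ns) n t

/-- add the unique unknown key -/
def addU (K : St → Bool) (t : St) : List (Bool × List ℕ) → Bool
  | [p] => forceN (mask p.2) fun m => t.add m K
  | _ => false

/-- process elimination steps -/
def sloop (K : St → Bool) : List ℕ → St → Bool
  | [], t => K t
  | n :: ns, t =>
    srt (decL 6 n) && vldN (wsum (decL 6 n)) && Nat.beq (Int.natAbs (sval (bdv (decL 6 n)))) 0 &&
    addU (sloop K ns) t ((bdv (decL 6 n)).filter fun p => !(t.has (mask p.2)))

/-- process a list of lists -/
def sloops (K : St → Bool) : List (List ℕ) → St → Bool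
  | [], t => K t
  | n :: ns, t => sloop (sloops K ns) n t

/-- every valid five-element list is in the tree -/
def cover (t : St) : Bool :=
  Nat.beq (trav (fun l => bif t.has (mask l) then 0 else 1) eds 5 0 []) 0

/-- the special face -/
def sig0 : List ℕ := [0, 11, 15, 18, 20]

/-- the special six-element face -/
def rho0 : List ℕ := [5, 8, 9, 11, 13, 15]


/-- permutations (part 0) -/
def xdat0 : List ℕ := [
  452634, 1060073, 344414, 737821, 370734, 347032, 48020, 142429, 210217, 993349, 119924, 539980,
  871465, 123746, 55510, 1651524, 695520, 105140, 942634, 560427, 1615404, 1737827, 1595020,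
  88473, 1000258, 918386, 1107624, 1238545, 1258817, 639534, 722540, 1426306, 1083061, 190050,
  1247050, 1361542, 1583211, 1215697, 480452, 1345939, 273644, 202923, 1237698, 1718794, 682584,
  1354787, 1608019, 1608348, 808332, 649796, 1170568, 469224, 369068, 1084083, 115374, 146062,
  924994, 1267266, 158291, 658126, 551019, 918442, 207564, 50526, 576240, 1005697, 560028,
  1139019, 1737372, 1705809, 1128974, 703521, 706062, 1129009, 539756, 355075, 1742370, 329637,
  735553, 1074381, 808038, 571438, 1623363, 46501, 420483, 218785, 1394246, 1645252, 1059723,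
  1708189, 479458, 1660512, 152817, 1688617, 1671978, 1724618, 85085, 855141, 471380, 1127280,
  189140, 549612, 120946, 60130, 541611, 1252034, 103726, 1725633, 1253581, 189721, 1512728,
  436275, 721756, 87822, 549731, 1167537, 379442, 1466507, 1443211, 419349, 957698, 1640037,
  838824, 1155952, 1595153, 1586018, 180950, 362866, 1415218, 1651020, 844053, 1447810, 827701,
  177254, 1118446, 1257641, 218337, 473634, 144753, 583205, 854833, 813729, 140203, 1725640,
  82803, 1055915, 140910, 943117, 429282, 1170498, 343364, 190092, 380240, 345989, 1063601,
  1676584, 551691, 639541, 1344742, 924182, 1466458, 1582924, 354333, 1225742, 830368, 1447299,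
  840084, 739851, 836997, 961604, 387716, 805518, 58723, 918645, 452130, 213850, 1585836, 704921,
  584003, 871752, 989716, 281330, 1457288, 1116017, 361830, 1369732, 1135134, 387394, 571956,
  279797, 1513498, 875616, 1129485, 1401113, 1508052, 1102234, 1641185, 791924, 542605, 939057]

/-- permutations (part 1) -/
def xdat1 : List ℕ := [
  846608, 1615684, 174174, 830508, 450835, 560357, 281813, 1673357, 1628312, 954674, 137109,
  91749, 944657, 875784, 1749258, 1216922, 1467417, 531230, 354536, 695576, 1743056, 1455489,
  427686, 629636, 1360030, 276885, 579110, 641648, 1103760, 952721, 1651552, 983829, 1681932,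
  1747011, 1082718, 418005, 1377180, 985194, 667982, 344309, 125524, 738857, 331037, 414918,
  1325457, 852789, 468517, 404803, 42924, 1149834, 1223747, 439712, 976913, 579334, 1061550,
  1395800, 1320718, 351267, 1419334, 1382150, 539441, 1645084, 868749, 1725136, 1706586, 473424,
  1644587, 700980, 1345715, 1454614, 1091398, 471212, 1102899, 481488, 1393182, 1135491, 958881,
  983906, 1171793, 1515801, 1614109, 675955, 1155182, 1075851, 120918, 1330385, 975380, 283892,
  1622173, 381346, 469336, 217882, 348390, 723723, 1523865, 682507, 172851, 547057, 1138781,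
  1681988, 190225, 59626, 1434636, 72499, 821940, 1413538, 214858, 657006, 1150058, 1361584,
  1075025, 858928, 1376998, 427924, 115605]

/-- permutations -/
def xdat : List (List ℕ) := [xdat0, xdat1]

/-- elimination steps (part 0) -/
def sdat0 : List ℕ := [
  654782752, 688332896, 620176545, 689316961, 683907236, 622208162, 650486912, 688267461,
  690465952, 550873349, 518366336, 691608769, 583343233, 618962081, 622275844, 654743715,
  685120576, 689447105, 651536644, 622244160, 615817377, 689316036, 686203107, 686202978,
  550873251, 655793281, 684042530, 619027587, 517281890, 518333538, 586589379, 622108737,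
  656776389, 687289600, 653699201, 691612866, 622275840, 654747906, 691380289, 621263045,
  655860768, 622074018, 550906016, 622239906, 551820449, 687052964, 690526240, 618963009,
  585475203, 654782754, 682892452, 687222048, 585539680, 654748768, 690465984, 622244069,
  686137440, 688266337, 620079264, 584391811, 622270595, 516270244, 518265985, 687188257,
  618014946, 653698245, 691379395, 549788769, 651467939, 656778305, 682959969, 551953635,
  615850049, 654647361, 654779617, 553035936, 655860932, 621258945, 583378048, 655865024,
  687118434, 687222053, 689447107, 655795394, 691612736, 655794305, 618993762, 691379396,
  689451040, 622140513, 654579842, 621262880, 654715010, 688267458, 691509280, 654778498,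
  687251685, 615849091, 654809120, 687184000, 690367648, 620177604, 649369763, 690367712,
  684039296, 621226179, 619060288, 691412096, 690466112, 652614786, 690465824, 687251681,
  691514560, 691444800, 687186976, 690333728, 691509376, 620079136, 691416292, 690466113,
  621127712, 687219744, 691514496, 621127841, 650484900, 687184032, 650419364, 621127937,
  691412098, 683940994, 654711972, 691510468, 690464833, 653696196, 686169216, 656944449,
  653498497, 551953637, 686170340, 551952612, 656943169, 685121762, 690333760, 549689508,
  687288548, 688363680, 689352962, 621090881, 687216800, 690464800, 686170338, 656779328,
  414489764, 691416192, 691379328, 615851169, 656776320, 654712005, 688363681, 551820452,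
  655793348, 689418432, 482614402, 650487013, 482614436, 653498532, 685121698, 688266437,
  687251618, 688337154, 620177473, 656972996, 683941026, 616933440, 656971905, 653695140,
  656943297, 483662978, 689348802, 615851170, 517216420, 518399204, 517183652, 517183651,
  651401347, 518430850, 651533443, 685121600, 620079393, 516201636, 652648578, 651401380,
  691514564, 615850146, 653731044, 684039328, 688266403, 691416128, 620177697, 549723300]

/-- elimination steps (part 1) -/
def sdat1 : List ℕ := [
  656644225, 690329760, 688332898, 618996801, 689348672, 619030818, 617982213, 651534564,
  621226241, 650486944, 653735140, 616933666, 616899649, 691378304, 518332546, 656743553,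
  691247233, 684039331, 655595651, 620045473, 688332994, 687250629, 653632708, 616933669,
  688267328, 685120672, 688266401, 617982114, 517250211, 586586276, 551820417, 655726723,
  585539648, 688369856, 654714053, 617980064, 656845025, 586455204, 622210341, 518332545,
  656944448, 551886946, 656846144, 551952613, 689348706, 654813377, 620075168, 687219941,
  414489763, 651535520, 518397056, 688369984, 684989602, 621125792, 656944288, 518264962,
  691380452, 683907235, 652483714, 684041379, 683907234, 549723297, 586553508, 553068833,
  654716197, 620075172, 691281025, 649338020, 619030786, 691509377, 656972929, 515152036,
  587604129, 518333537, 551886913, 686170242, 622209314, 656742465, 587471009, 518431973,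
  583378080, 586588357, 687052961, 650352804, 690465989, 656846048, 619944100, 687249571,
  583378181, 652647552, 652483713, 656776352, 656841793, 483663010, 654710946, 689418528,
  622239808, 691280961, 687052963, 683907203, 654778433, 656977024, 617982210, 688265280,
  654813216, 552936545, 552868001, 552933473, 690363552, 656944160, 686037090, 618996834,
  587605189, 583378084, 654579874, 656841760, 518429824, 688269344, 619030626, 518298753,
  691510465, 654745797, 689314947, 553068804, 621123744, 621123747, 619030658, 516200612,
  515152035, 517251234, 549755042, 615850114, 553003040, 587636933, 689182818, 622243072,
  649369764, 622041217, 652582016, 651435073, 653696197, 585540866, 621222051, 684042467,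
  688367648, 414524579, 587606048, 687285345, 689418436, 518431907, 691416352, 518432002,
  689316960, 654710948, 691380420, 652648512, 587605153, 691380353, 621090979, 691547168,
  653700384, 690366529, 688134242, 654778593, 656846146, 518399205, 621090913, 551886979,
  622176516, 518399136, 619028640, 654680228, 689418368, 518298788, 553067680, 518264996,
  687187141, 689313856, 691444801, 655661187, 587641152, 687251650, 656977088, 687255781,
  687085697, 654813313, 653700256, 549757089, 622242050, 517250209, 548742307, 483729538,
  583311521, 651500675, 586556613, 549824803, 688266435, 584460578, 689315011, 690363586]

/-- elimination steps (part 2) -/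
def sdat2 : List ℕ := [
  620992675, 518232228, 553070885, 688330850, 584460546, 518366368, 689315968, 584392769,
  621226242, 651435172, 651534400, 616899746, 551919747, 689313920, 689319040, 651566208,
  654712004, 615851106, 651536448, 586422436, 651435138, 689313890, 688199778, 622242976,
  621160480, 548741284, 654745829, 691448896, 551819428, 518299713, 516236449, 517348516,
  518366469, 622243077, 654745664, 687219873, 583345250, 619944097, 689319168, 414523556,
  687120545, 687186049, 583377024, 518299777, 518433028, 687217825, 517351653, 651500641,
  583311524, 620079301, 622342464, 684005474, 622243136, 620174533, 587640992, 586455171,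
  617980066, 621025441, 655793283, 687186081, 686038081, 687249570, 685121765, 448077986,
  587641093, 552935553, 550903970, 548739235, 621025442, 691445986, 620178725, 653632709,
  448079011, 652582019, 687283396, 586589345, 449126530, 653735040, 691381280, 615848034,
  584325218, 690333890, 622239809, 654681248, 551819362, 551921924, 550906114, 652449923,
  583378016, 654547075, 587669699, 619029602, 481632386, 622239905, 651534565, 656742530,
  622338245, 587667587, 690198689, 687220930, 587636896, 649369731, 688270659, 621093025,
  655792259, 687216770, 551987459, 651435169, 518432996, 690527425, 584427780, 687187205,
  622242912, 586455201, 688101473, 689314945, 622277888, 622241888, 653735136, 621090978,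
  687285473, 688269507, 691547328, 651535456, 586619011, 654817568, 689346658, 684040320,
  689346656, 552933539, 690532416, 619029664, 686071873, 549822628, 622209089, 622273634,
  585508100, 549824772, 686138466, 653700224, 687219906, 586457249, 585540706, 620177698,
  656844865, 587636899, 654645379, 583310497, 651569282, 653700416, 690430017, 684042500,
  690461857, 587602048, 651569380, 689283200, 690532577, 584360097, 689317121, 687282307,
  586622209, 622239969, 684041443, 622208160, 586588324, 583309476, 654645346, 652584164,
  689217633, 687186048, 651536611, 687283395, 518366468, 553067617, 684989505, 552900771,
  616897601, 651500609, 684005506, 655896704, 654776418, 622277696, 518432899, 656778272,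
  553003169, 586586208, 656779394, 587536515, 517351714, 690527264, 622041185, 518232195,
  483729506, 689319203, 548741281, 622075041, 550836387, 553002144, 622141505, 553071939]

/-- elimination steps (part 3) -/
def sdat3 : List ℕ := [
  654678180, 549787746, 690232385, 690464962, 687287552, 584325284, 654783746, 684042370,
  654682403, 585540704, 622277890, 620042402, 684006529, 690429123, 689419360, 690330785,
  690366689, 448078946, 690527427, 622273600, 550838370, 585540867, 650352770, 654612642,
  654747875, 448045218, 682957921, 690469089, 449125506, 550771873, 691543235, 586422401,
  691510304, 655793280, 653564065, 654744737, 690430178, 655798496, 690363589, 481633378,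
  515154081, 587605155, 622238752, 654812321, 690428960, 551985216, 690363424, 620144869,
  654783552, 517351586, 654749760, 549755043, 654817569, 622276896, 585406562, 584459424,
  584292483, 690333921, 549824608, 518431906, 622139521, 653730848, 622311620, 448077988,
  688236803, 582262881, 448076963, 449125539, 622075009, 551953568, 687217824, 515186852,
  651535621, 587602080, 587602051, 620176578, 551951520, 654745761, 622205984, 655792224,
  685056065, 688269506, 687288544, 548673700, 550902947, 691547392, 651533472, 655795427,
  656779492, 587602083, 553067717, 586622148, 687288384, 690531520, 689316068, 620141729,
  548739203, 622172288, 549824675, 553064612, 687220964, 649403523, 549790883, 622176513,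
  687188225, 617880737, 656776321, 622342341, 584426755, 656778304, 654743650, 688369824,
  649371809, 689313923, 690333923, 687288448, 688270656, 654777539, 687255776, 517281923,
  618895524, 691548224, 584292515, 550771875, 653632544, 584459362, 583277732, 656943298,
  689182849, 585506946, 517318947, 688367809, 586590404, 518429859, 517351488, 687151235,
  687287584, 654783584, 584326308, 585408610, 551819426, 682926242, 553033889, 653731012,
  687186080, 687153217, 518429827, 551984291, 656944325, 683940993, 688101539, 620174368,
  620176544, 684040354, 688267489, 516234404, 689183873, 615848099, 622208064, 552933540,
  655896864, 688369861, 688333025, 690532544, 690331810, 621160673, 688134307, 649402499,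
  656939073, 654711968, 687285344, 414490786, 622336097, 653633825, 587604128, 553068641,
  622208229, 551786627, 654778432, 620177537, 687287392, 582260867, 654777440, 691542112,
  686004322, 649405537, 550905920, 583243940, 688330848, 687254851, 585507936, 587673888,
  689319008, 586592544, 655729696, 654783712, 689283203, 551854145, 691512352, 682924195]

/-- elimination steps (part 4) -/
def sdat4 : List ℕ := [
  618961058, 656939169, 622176353, 655729795, 553031843, 516236450, 584460384, 653700389,
  682958978, 622176545, 690366690, 549788835, 586622212, 622172256, 483662979, 689348833,
  552933505, 654714050, 616930464, 656841888, 655896608, 551987296, 691247202, 448076931,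
  586626308, 682892419, 518432832, 622142561, 654714018, 688332897, 687284352, 690527329,
  654777473, 621224130, 622206113, 587605024, 687219874, 583379235, 517318916, 686138626,
  583309475, 622208161, 691247234, 687287587, 690428993, 687285312, 655798500, 656976928,
  654747842, 551954530, 619029568, 655762628, 584459493, 689352768, 691443810, 553035872,
  691411074, 620141728, 622342465, 654812357, 583277697, 652584032, 654614689, 620009634,
  691247201, 689284192, 622277856, 551919744, 620174500, 655797344, 691381443, 654713888,
  582296707, 687220961, 654781696, 655797504, 653699268, 687253600, 691547232, 691280002,
  687287556, 622175427, 649371810, 655729793, 687250592, 689317058, 655794241, 651499650,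
  686137408, 654614593, 688236640, 621223107, 656878820, 616897697, 622210208, 622206149,
  622273633, 656841890, 583344257, 690531523, 587673860, 414524546, 587634851, 585407585,
  622238883, 687184003, 654817472, 518432898, 690363457, 622310432, 654779650, 586621057,
  553036033, 621157536, 691378306, 550905952, 622271616, 654645377, 687253762, 689215586,
  687283331, 481632387, 482681986, 690433088, 682924130, 515186817, 691544258, 587505825,
  656878880, 587641088, 517318819, 622271584, 617979040, 449092770, 622204992, 517316772,
  584427616, 515154084, 690362530, 619094080, 620180704, 649371777, 617846947, 690331845,
  620174465, 518431840, 651536482, 586592416, 689284355, 414522532, 685091074, 688332832,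
  517282977, 553035973, 616798370, 690331873, 653599809, 587669536, 619028610, 690231458,
  653565089, 650487938, 584390787, 622307457, 655794304, 653699266, 586592384, 518298721,
  688269570, 615782564, 653734976, 656778402, 517316768, 518365348, 682958946, 586626144,
  654681345, 622241824, 688135329, 517351652, 622272706, 518400290, 655794372, 691380418,
  687151201, 690532576, 688365761, 654779488, 585507971, 622311712, 549790818, 650454146,
  622241987, 585374849, 584392834, 549790785, 654809248, 619094245, 689283267, 688331872]

/-- elimination steps (part 5) -/
def sdat5 : List ℕ := [
  615783585, 615816353, 655897696, 620178720, 583309442, 622306501, 689415363, 584460416,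
  622306465, 622174337, 682957955, 517351552, 553003205, 622106722, 685088997, 690296930,
  654711937, 649405538, 622336161, 687188099, 622139490, 622338209, 691443776, 687188097,
  619093152, 654579777, 655896768, 655762626, 621228192, 551954563, 690329762, 622338080,
  687151169, 622041252, 691516480, 684042371, 615815330, 585407619, 587673856, 616933604,
  654779587, 682892451, 551953666, 687253729, 691279937, 518429856, 616897700, 619093088,
  655896772, 618895523, 655729924, 656978976, 622306497, 654781700, 622241986, 690433248,
  553035808, 621223968, 587670625, 654779586, 655729921, 656874528, 651467937, 682958945,
  652584000, 654812353, 654648385, 649369698, 516234369, 654783715, 586590403, 654817408,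
  621228261, 690528288, 656775330, 549824773, 619096291, 449127522, 656878882, 622175429,
  654716192, 622270592, 586556448, 617982115, 689412192, 687220932, 584458468, 482647202,
  615848100, 655792258, 690528449, 654716032, 585539715, 551954723, 553064576, 619093154,
  517318949, 622172323, 655798562, 549787812, 686137572, 654714944, 654743648, 615849124,
  687188163, 651401378, 689418529, 688234691, 621127843, 517318917, 584326275, 622210176,
  585507904, 688331873, 619027619, 586590336, 685123682, 684006498, 620140706, 586586272,
  685088995, 655661186, 691412033, 651536512, 655892673, 654711840, 691512513, 691548384,
  584326241, 620144704, 583379075, 621221984, 654744672, 688363616, 656975041, 584390754,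
  691542113, 690531424, 622311456, 655897795, 651568357, 621227331, 687285475, 654715008,
  583345283, 551954560, 517351588, 651502690, 586557729, 687254848, 656979136, 655663169,
  622272737, 621127776, 622175264, 582260899, 548708513, 656840866, 655795458, 551920901,
  653633664, 651401314, 653563969, 622238816, 618962082, 622311552, 586557732, 621227168,
  652584163, 518432995, 656979008, 482648194, 621228256, 518367363, 622270594, 651568192,
  687253731, 690528450, 691449059, 686136451, 684041474, 656709697, 621226211, 687283232,
  616897666, 622206148, 585538691, 690469058, 655892609, 651467874, 622176385, 686038113,
  449125474, 620180802, 656979138, 518366339, 654710912, 620177536, 515184804, 655897857]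

/-- elimination steps (part 6) -/
def sdat6 : List ℕ := [
  689217601, 689283169, 583377060, 652517441, 622241890, 655795425, 548742241, 691516448,
  651535458, 690531584, 618994817, 619062434, 655662209, 622175395, 651502657, 650454081,
  687283297, 483695779, 654646401, 622344384, 584460418, 549788803, 691414081, 688336960,
  683973730, 687249504, 653695106, 653699137, 620079300, 687251488, 687219776, 518333571,
  587670787, 653699361, 656874626, 584460579, 654715169, 622074020, 654809217, 620177633,
  583342210, 689414337, 622208065, 651534464, 650488098, 654816448, 622107745, 691378272,
  620144865, 654781731, 653731010, 656971841, 584392835, 651534498, 684989537, 548741217,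
  553068640, 586626339, 655893536, 551985381, 553003172, 685123648, 585408641, 586589344,
  649405569, 622176384, 483695714, 517284961, 621160512, 549789761, 518400292, 587638880,
  622272740, 655762657, 553071936, 651434114, 622273763, 691542080, 691312705, 690429122,
  587605187, 553070880, 655893601, 654648417, 587669700, 688371744, 587503713, 654747680,
  688234659, 687282272, 655762561, 582262947, 689347681, 689352931, 649405570, 622205088,
  688266336, 621160642, 551985379, 619029667, 618962017, 551985315, 656776353, 586592549,
  691444931, 690429026, 619096290, 587638881, 691544257, 518297730, 551953504, 654745632,
  691543072, 655760512, 690330720, 621227328, 686171362, 587636768, 691543233, 586490977,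
  585373827, 687282240, 691544129, 649370785, 688267329, 691509312, 582228099, 549789825,
  482679938, 619063524, 518400130, 551919776, 691381473, 553066656, 688201793, 690331680,
  656940064, 586588192, 656778465, 551951491, 549789858, 691313729, 619063426, 584359009,
  690469088, 583310467, 652649698, 652649570, 690427968, 690468928, 587606276, 656947424,
  656947394, 586491009, 686171363, 687250595, 621228096, 585505923, 656947232, 482647138,
  551953506, 688236801, 620177472, 587538561]

/-- elimination steps -/
def sdat : List (List ℕ) := [sdat0, sdat1, sdat2, sdat3, sdat4, sdat5, sdat6]

/-- certificate (part 0) -/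
def udat0 : List ℕ := [
  57564181536, 67192035457, 74636859556, 77893803105, 62934004800, 72631036098, 67261339746,
  70442589347, 70379807941, 72597681377, 71554079841, 79040132288, 68300417056, 65041374370,
  65011067169, 83297216738, 70481551555, 66152963236, 65111697539, 65081486528, 68268075203,
  68336261216, 64042179649, 68233409795, 72562810945, 70415525025, 98397725856, 65046851781,
  68334004481, 70449993858, 70415556805, 64040187072, 70449994784, 72592268418, 73530677412,
  56387643424, 68161971329, 70450064608, 67090393218, 62968542240, 80109479040, 66151982145,
  71488184481, 68263717027, 68337247297, 73602048161, 73567515744, 65113793633, 62927479873,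
  68298382432, 84407720065, 68231275618, 71419863201, 62863651108, 72595349633, 66185505952,
  77893804161, 71488184482, 70311649440, 75782006945, 68329774211, 72590107713, 73704777953,
  76922889377, 68198802593, 70411164769, 68229011620, 70479387746, 71454562400, 63765224612,
  73531695266, 67123847330, 70483586272, 72525027426, 70242344034, 71554111586, 64007711936,
  72527294757, 60816792773, 72459067556, 66148670593, 67125060865, 71489263776, 73669225600,
  68264728706, 71453550624, 67155335298, 62899329185, 67262327041, 71420029057, 72595481697,
  65080302723, 70444784802, 72597645505, 63972975813, 64041233440, 36053559456, 68333020224,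
  68302580896, 81083640101, 73635667141, 59677063489, 75748418689, 72627787937, 70414442693,
  70484596866, 70481582177, 68196640930, 66117344354, 71489001603, 68302609602, 72595449952,
  67194266819, 76927217888, 70480271489, 61718471843, 61824547013, 73596740705, 70379804835,
  72596595905, 70442588291, 68333019200, 77926344864, 70483683521, 75849014401, 66186520801,
  68299430052, 74773175458, 71489271936, 68262632578, 53234511168, 62965358819, 67262524673,
  67226810656, 67263507744, 57458140320, 66187698369, 67054640226, 71417798819, 71419893923,
  62893824164, 71521706016, 68267875457, 67226805409, 70380892451, 65043539202, 66049087651,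
  70450158624, 73698486403, 67194303685, 68334098528, 73634620577, 80148446400, 71523839104,
  71558469761, 70415394947, 70444721217, 77965171840, 67226743104, 70450060482, 62863616097,
  68232356960, 68197688547, 71487140928, 67123847233, 68300512352, 71521540161, 67158579360,
  68233371808, 70411098274, 56526087200, 67156420739, 70449862721, 68232190083, 68332985505,
  66050203810, 75746320514, 73531761824, 76891399297, 72630019169, 76820128930, 67125063808,
  68233376000, 72594401570, 57564081280, 68164165796, 68332985376, 67122864288, 62830094625,
  61893810240, 70480502980, 70376495234, 68229111936, 70415492161, 62863650944, 70346287361,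
  68267943074, 75778791586, 70444687425, 68263749861]

/-- certificate (part 1) -/
def udat1 : List ℕ := [
  96247063712, 68337116258, 71520525473, 70409067684, 71521738817, 71486054562, 79070441760,
  75784169537, 61856980132, 71521640644, 70482571360, 78000825409, 64941861026, 68333969571,
  67258031235, 71521704034, 65046751457, 72561924192, 72459102498, 67090358400, 70483651808,
  68329775333, 62968442146, 70481489216, 57598785760, 65112842338, 68233341219, 72632216772,
  71521773857, 72560879905, 66189761732, 68229079169, 66183371938, 59743088768, 70380859488,
  71487002754, 68264696930, 67226638466, 70415390883, 68268045633, 67090326626, 70447831201,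
  71519609060, 75778825377, 61857897633, 70377644128, 68333971713, 70480404641, 66155230240,
  60747553954, 70412213346, 70344091811, 70311650402, 74745124928, 70415361089, 67194304800,
  70480271524, 75782102176, 65081390304, 68334102721, 73665980706, 70448002306, 66014451874,
  68230192259, 67021119650, 65111697697, 66151950530, 66051320003, 67156451490, 62933997696,
  67228871968, 71519444097, 75680357504, 71420024996, 66084877600, 66084873412, 81186501760,
  68333969504, 66050070690, 65081288769, 68231210080, 61894832192, 68268071075, 73702815840,
  70445867138, 67159599201, 68329775266, 71483860033, 70483548256, 58669346080, 67226671200,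
  83333885216, 64041098272, 63970944160, 71556378912, 65044554913, 70477191330, 67228970112,
  68333869121, 63834430594, 67122899040, 68302513349, 70481551554, 67192166564, 71489232067,
  68267910240, 70484599905, 59712674880, 71484942563, 73636754752, 67158549664, 67228940352,
  70445866082, 73566363808, 70413359264, 66152997058, 67191020675, 65011098819, 67262457888,
  73704975552, 62898247842, 62927445156, 71489166496, 83297216576, 65041442980, 78901519524,
  72527292611, 72525027491, 65111792736, 67125064004, 75782105282, 59676924064, 72560781440,
  68261550243, 70442624098, 62863618176, 72627856449, 64974265505, 71558341857, 73669158048,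
  73700482146, 70377678978, 68230192292, 70484667619, 64975415456, 65076010115, 61756354880,
  71485956161, 70481420385, 66153029828, 72591187108, 67259111522, 70484465795, 70446949440,
  67194265665, 72597641377, 60820002881, 77964127392, 72525062307, 68267940896, 70377678979,
  71488184385, 70448034976, 73671318560, 66187702529, 62898153633, 75746253985, 73667091586,
  68261583012, 71555229923, 50984264832, 67257084162, 65046752576, 71520524450, 64976494752,
  70447996032, 81221097504, 71488121057, 68336098464, 71555330369, 61854719140, 67228968129,
  68230193282, 67123946659, 70483679392, 60749621541, 68163086500, 71557390401, 73670238336,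
  55379896384, 70484663394, 92997661892, 67020070019, 81217888453, 67225691296, 83368656065,
  76890349765, 72627990756, 68261584003, 73636754464]

/-- certificate (part 2) -/
def udat2 : List ℕ := [
  62899264673, 70412248162, 70482633825, 71419828385, 68198635681, 65073912961, 70379844899,
  77929592128, 66153981188, 71551001698, 78000920641, 68233271393, 71520655520, 49005598884,
  62931739809, 72458968228, 70410118306, 67259210948, 68335186112, 72627986561, 75852393664,
  67189972128, 66119375011, 64038050944, 65008902241, 70414481440, 68198768837, 68301464833,
  71418847361, 70377678946, 65043602496, 70346254533, 67259145313, 70481352801, 68302513216,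
  76753018020, 97323986208, 70379804803, 71549852836, 68300551365, 71553162336, 73671318593,
  63869198466, 70448814211, 75817657376, 73665979650, 74738673956, 68302576800, 71485991170,
  66084807877, 72630147169, 73635600546, 71450304642, 68302709954, 71520458881, 66151949377,
  67226675457, 70478174371, 71516362882, 70376528036, 70379844864, 75813464192, 70378626145,
  68198670497, 74779702464, 68230095009, 56490372224, 73669257248, 66187670723, 66152963200,
  68233376067, 72458052770, 62897204384, 70481555683, 65044687073, 71550934114, 67158484065,
  72596428928, 89670396064, 77929489568, 66185437381, 66187696224, 66117344416, 67225692289,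
  58598992034, 67123812482, 67054640291, 74742965475, 62897035426, 76891464768, 67194231968,
  75817720961, 70415525920, 72592202882, 56524937280, 70484667616, 70450063586, 68334066785,
  67191023843, 70309452964, 66013439107, 71452366979, 71385326852, 72630017220, 68337151040,
  71418947843, 68337283264, 74741749890, 62899329153, 68160919683, 70242344066, 67263544352,
  70482401345, 74772227168, 71549918305, 68337149154, 59574199460, 73704874210, 71521709216,
  70412311648, 65079225472, 70415395011, 68267976802, 67157334147, 62932824192, 71449257091,
  64007544005, 61894798528, 70482534529, 71419996421, 67055656067, 74641257728, 63901606049,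
  67226641473, 66148670626, 73699432610, 70449015904, 68332984483, 72595479681, 64007749825,
  68261582978, 77860315296, 68330724417, 73567511813, 68335087872, 68335049857, 72492555361,
  70449998114, 66155026594, 42531791904, 72594433220, 66084673700, 71556274272, 67193086113,
  67261411456, 64034809952, 66186517665, 68195525697, 70442590337, 67155371168, 71487137922,
  68233375904, 75815560320, 66120495264, 73566397602, 86586565829, 65111730372, 64001254464,
  62863515777, 68265778305, 70415560864, 62931775552, 70480503906, 72422268068, 75850259552,
  68335048832, 67125026976, 81184200833, 68299469952, 68162951330, 75711650980, 68198802529,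
  57599929538, 70411065506, 71554214083, 77929588801, 76919710949, 68302379169, 68261583969,
  71488053313, 70484596864, 67189975301, 71558409474, 73600866433, 67156318338, 71523735716,
  71452501250, 67260127393, 73704774816, 74745066722]

/-- certificate (part 3) -/
def udat3 : List ℕ := [
  66082609315, 72423349412, 67228837953, 72631031970, 68232321188, 70376462467, 73669158113,
  77897052421, 74675656868, 64941860928, 73635436705, 70482534528, 66081495204, 68336097442,
  74774357056, 70477227073, 73701631008, 70484597891, 57563062432, 70449116417, 68195525729,
  71554212001, 75849149568, 70450092096, 60715997313, 68163967107, 60646825124, 66189667556,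
  73663782017, 71453549728, 68265912548, 76751804580, 71553099010, 71558406369, 73668041857,
  65007888675, 71452468354, 67187742883, 64976460928, 68267911425, 70344124643, 61856982080,
  71555161185, 74710394944, 77758471330, 67192003745, 76922856611, 68163086464, 67158583424,
  71521708097, 79004381344, 70479255682, 65079223360, 74778549313, 70484663491, 74779630624,
  68337115361, 71558470785, 68302480449, 76926003232, 67224509505, 68230160544, 74776557824,
  68267907236, 68300552224, 67193118880, 55448020165, 77929557312, 64003384384, 68266895424,
  72597679392, 59574166688, 51153052832, 73701728384, 65078207520, 59710582912, 68295140449,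
  64004466913, 70415360065, 65044453537, 70415456419, 66081596513, 65008835715, 71520658594,
  76889365665, 70483549345, 68336032833, 70310537380, 73598902336, 67121817763, 68163999908,
  70376528002, 68334104768, 68161969281, 59678040226, 70480501792, 67123912800, 70375512195,
  59746168128, 67192166528, 70380722339, 70377576546, 76924035269, 70448879747, 79074667552,
  73703796994, 67259246786, 76926037152, 59572069536, 72597547233, 71557429312, 71488088325,
  66155027616, 71453586692, 71418914053, 68268012608, 66185336961, 70344091744, 77893869797,
  68264731746, 73703858372, 67055689890, 70380886112, 70483548258, 70414444801, 67261312128,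
  67159666976, 71451252867, 70415495232, 67120734371, 73601036608, 68300382273, 67194268932,
  71521574977, 67228735553, 68299470048, 67263371395, 70484735200, 75813464322, 70415427874,
  73566429248, 71348591747, 67260356768, 70483751106, 68299367620, 67256035555, 84372039712,
  67194202241, 71454566596, 66119477344, 66153028705, 68337151200, 62898117793, 74743978114,
  66150767713, 68164164768, 71551002688, 65046749248, 71519444098, 70449115168, 68297268387,
  76889364544, 75849115776, 72596595744, 67260127394, 81152880869, 65077156992, 67228772546,
  68230195427, 67123914848, 71451420930, 67192038465, 59709498562, 77965205729, 74744965184,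
  57563125792, 80112657440, 67259244769, 71558275137, 60682614080, 71550968930, 77826694305,
  56488307840, 72459002017, 87489356964, 68332985504, 72597478596, 70477159554, 75850195173,
  66049022115, 70412180577, 56522842309, 64939663524, 70311648420, 88700562720, 68296153250,
  68332820642, 77963107360, 81185317024, 55413449858]

/-- certificate (part 4) -/
def udat4 : List ℕ := [
  74672646208, 68232323269, 67194165379, 68232190049, 67262426370, 62897200160, 75783154848,
  76926204960, 80078118049, 70480337059, 70412249316, 75746387205, 70445835490, 63968714817,
  65042491650, 78936223904, 75852261441, 70449083681, 64941828389, 71521704096, 79973096612,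
  73669189793, 68198768801, 66153033956, 66152967488, 68233336960, 71418912996, 73565317381,
  65114843200, 66081560738, 70483417249, 67256034368, 72595514400, 73636687008, 68331873378,
  93968541856, 71556244737, 71419963588, 62794308739, 72595519680, 58603284512, 71521742112,
  68229077123, 71482811457, 71383230592, 71523806530, 68337183840, 61887326499, 78901552288,
  72562946112, 65076044004, 67262323809, 67259242658, 70311552065, 70482435169, 72630999105,
  67226673184, 68300544128, 72561926176, 71521641633, 70480470176, 68329777442, 66188449955,
  70275865731, 68336168000, 72423349410, 66185404481, 68329741377, 53269114148, 71384277152,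
  89807755428, 60816696417, 67261309122, 70310436004, 70345206018, 65111729216, 70415427714,
  61859076160, 80043451424, 67224509570, 61820217408, 73567380641, 67021118626, 65046718529,
  60816762018, 71487101090, 63971895328, 68301632707, 70482669664, 56525987010, 79037935680,
  70483647682, 65111696645, 61893745861, 50082659520, 82294742210, 70414441569, 57528497376,
  54342952132, 61890471073, 72525096034, 68336101602, 71553032257, 59676960929, 65112842304,
  72596497473, 68337179744, 73698451521, 67263502464, 82259127616, 68335081568, 61652343972,
  62794308705, 73565348002, 72597645377, 71518429346, 54204308641, 70450158785, 65046719648,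
  72560781601, 56489323776, 65111730241, 67121816739, 68267979074, 71523604642, 63937321088,
  61823326369, 73636683936, 68267944132, 70378726464, 68230060196, 68328627361, 78969743617,
  72627991776, 68233409632, 73703760100, 70482630752, 68336201025, 73635670241, 68329642114,
  65080302689, 60750702624, 61859078274, 71419896929, 73566429282, 66155233312, 66051317920,
  57562017056, 70447997056, 70449112259, 68233405537, 70484663490, 70412114051, 60781043777,
  72631136482, 81186434336, 68335147105, 70413395141, 70275866786, 70484634752, 72593286372,
  66116233376, 66051318816, 70207741059, 65078139044, 70415530273, 59672698018, 71383230628,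
  71557491907, 73704874048, 66986482851, 70476109986, 71550867619, 62931809344, 70484762817,
  71522588801, 75782101154, 70450097216, 71556279584, 68335049825, 70242344100, 70412214402,
  70345170016, 68300480577, 71488051363, 71453552800, 73563185313, 60816730144, 71418947680,
  59642390788, 67257047138, 70449928354, 68301527171, 68164133952, 71521704032, 70415424708,
  65081453765, 76918629473, 66182225057, 71558477025]

/-- certificate (part 5) -/
def udat5 : List ℕ := [
  70450095169, 74710522017, 65009984772, 72627957920, 67226736802, 74774388962, 55275985060,
  68262533282, 68229046436, 70415325345, 70380824833, 60715050212, 70310570212, 68266993857,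
  66051319904, 77897048261, 77927393344, 66115184768, 73671387168, 68229080129, 68265911525,
  66151979136, 70448027808, 70379675809, 73634523300, 67260260417, 80043451521, 66152933571,
  77964161184, 67194329120, 71552964739, 70378726627, 65111793889, 57595533440, 66120527139,
  57595500704, 86555138176, 67225724129, 71522621505, 73698486530, 71385359490, 67263502368,
  68336162880, 86415546532, 71518494850, 67262359616, 77961995328, 68267972768, 70415526017,
  67225692192, 72557632672, 70414444802, 68264729730, 68301497538, 71558341696, 83299375264,
  70413396164, 70447998050, 73566429347, 72527157412, 58673609921, 65980933218, 65980899458,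
  71550999715, 81181123712, 67227785314, 68302511265, 35046960288, 67259210912, 60645812517,
  52230041824, 73602048164, 72595481664, 63934079138, 58668227712, 66185538820, 71453548708,
  67222480101, 64006428802, 72632081604, 68164066435, 71451420962, 70415458498, 66188680257,
  70311549059, 72490391716, 71483894050, 68267939904, 64005513280, 68299435168, 68297169985,
  83297180736, 70480436421, 68196640832, 64038019234, 59742988385, 65075976354, 70484761632,
  70310467746, 67261310147, 70450064613, 68229046402, 70412146818, 66117282082, 67259213025,
  59711593504, 59747408928, 65011097632, 71485922465, 70415424641, 68264696897, 70482535489,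
  64005449856, 86587709472, 64005445795, 64974334213, 71554146500, 61719520417, 70380857601,
  70380859712, 77999877317, 68233273473, 68267841699, 71521739841, 67192035490, 71452435587,
  73532873859, 62930658336, 65076010081, 73636652261, 65111729184, 71554078882, 72559697027,
  81151895713, 70378726660, 59746262048, 71486020768, 71483858049, 57562049828, 70483586370,
  70483744865, 67228967968, 68232357121, 68332951682, 71520659584, 73705894112, 72631131234,
  67123947780, 70476109988, 57564111076, 72595480770, 63900590244, 70484765953, 61824510146,
  75852393792, 68164034689, 64007546912, 68300513344, 62896969892, 71555229793, 71383193730,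
  67262453921, 73565282369, 68263716960, 67221330050, 67227722948, 67224576128, 73665980644,
  70415325346, 62759672962, 43605533825, 66152933472, 70481586273, 68301631680, 68335153348,
  82293793824, 70484664384, 68332923140, 72558582946, 77826695332, 71519544578, 64042179714,
  67261210689, 70477125794, 67226709280, 74638956706, 70379776292, 64976396418, 62898280609,
  83365307489, 68268077088, 70415394913, 71420027041, 71557389507, 60821051456, 73669191938,
  62893956260, 68302613732, 66153030914, 73705958689]

/-- certificate (part 6) -/
def udat6 : List ℕ := [
  50045819008, 68334067808, 70409066659, 57599694912, 66152831105, 57599929376, 71521773761,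
  76750857377, 70380822656, 73531726977, 72626873570, 73428934820, 74605467746, 72559795362,
  68329642115, 79073483973, 76921838722, 74741885156, 74710395105, 82295789632, 70376597632,
  67221362852, 70415394912, 64042179616, 71454634112, 61891620928, 61858913409, 60679264420,
  70415558849, 66084841763, 67262520515, 68334005509, 67226771684, 74605469761, 63869198464,
  66189665344, 68332955777, 74743980226, 75777677476, 78000953408, 60751784000, 67227883649,
  66120491237, 67255933090, 66119475360, 68330823840, 74742866048, 70479388802, 70480506147,
  73463536802, 72597684416, 74708359328, 73601032320, 70481420353, 68267808930, 68267841601,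
  66150866050, 72596430976, 60646826145, 70484761793, 59608803489, 70415424709, 68197588131,
  65043603520, 65111792771, 66084873476, 77926344997, 81080461605, 62898247840, 60746474656,
  67258195042, 72593218689, 70450060485, 67259180289, 66015536226, 68337178688, 70480470081,
  70484597857, 71489168578, 65043603682, 87559673984, 68337015937, 70415395012, 55344211072,
  68164033699, 70450063424, 78967544963, 72595450051, 68197688418, 67259278433, 67194268960,
  65041443045, 70308406401, 70410152164, 70481555714, 62927512706, 67123880001, 79074663456,
  68266997920, 68233205857, 72493740357, 64007411876, 75814542464, 74741684388, 58566384769,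
  65113921665, 71521540226, 77894917248, 74779630657, 63971858497, 71450338468, 70484465761,
  73635535009, 72493740192, 67194235138, 65110547585, 75781969985, 74742933568, 68332787873,
  61887325347, 65912775844, 68268071072, 68329774244, 67053626499, 75818899520, 75813464128,
  74743948484, 70344055905, 75818769473, 61893651685, 71349574786, 68268071009, 71483857985,
  71489270944, 76922925285, 73669227616, 73701664832, 71521573026, 67227889792, 61856916609,
  70445735043, 72492655874, 70478307491, 73669125317, 67226671264, 62894972065, 68300450082,
  68198802595, 66188582051, 70345171108, 73601915041, 68233273441, 68198668385, 67194232003,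
  68335154432, 71554080833, 72493768901, 42565343264, 66083759232, 66082642018, 70412249218,
  70448881729, 70484664546, 71521769633, 61824512320, 62898253120, 67223428226, 65007787172,
  67054674050, 68198668449, 65115959522, 82190966913, 74738672800, 68295105667, 72595315809,
  79038946432, 68264696994, 61894665281, 68231241856, 68302613728, 57565255712, 65108484161,
  72527321216, 71489238274, 70242344067, 74775373920, 70446949604, 70442624129, 70480304258,
  67088229540, 70378758240, 66119477443, 64036805762, 72493768736, 72629074112, 71415666851,
  65114974273, 66187567300, 75818808384, 74738673792]

/-- certificate (part 7) -/
def udat7 : List ℕ := [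
  67123915011, 73671388192, 65080303648, 64975415557, 67262191713, 68267910401, 67226675396,
  66185540864, 70379772068, 70412280896, 64974231714, 70483586112, 72525062242, 57599563841,
  68299463808, 71489236224, 72628968645, 62930625665, 68197686403, 68197688384, 74605469826,
  67192170625, 71419893889, 63938371780, 70311649344, 68334065760, 70478307424, 70310537344,
  67260260513, 60682580288, 67226674433, 71556143233, 73532873824, 64006527104, 65008967840,
  70480470048, 74674742468, 61789872289, 66149817472, 66188720320, 67157531779, 59746262209,
  72627890433, 68301330561, 61858945153, 70377578561, 67089312005, 70311450788, 74743981250,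
  65108550914, 71487136993, 70482630784, 68198766752, 71453516964, 67226741856, 67226805445,
  73636654400, 71557323938, 66185534593, 63935227138, 71520689281, 71485988992, 68334000224,
  57461381280, 70311518273, 75817726016, 67223529602, 89741830176, 70413395009, 73698485509,
  66184388836, 62863616131, 67194266881, 68331937856, 68233404611, 68268011744, 70413228193,
  68230061220, 68332820644, 66188783841, 63970913605, 74778549280, 64004400288, 75781971105,
  40384177280, 67262191778, 64941860000, 61888405733, 71385293921, 73634588834, 68337114144,
  66155224096, 71523904833, 68330855522, 70344056994, 70449111169, 71553131618, 65079290976,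
  74741785665, 70484765792, 70412281058, 82294708288, 75746320449, 61858029765, 77825647778,
  70482535651, 68329741441, 89812184256, 70447996035, 70481588544, 66188680224, 67190004896,
  67121750177, 71518460993, 68198802629, 67263306817, 77999872064, 70449116256, 57461318816,
  68297301152, 59747408961, 70415554656, 72597477536, 68233369696, 70380857441, 76650194083,
  71522754756, 72492687456, 72597679136, 68336163936, 67225724034, 70415561025, 68300449824,
  87626818688, 68331904096, 56522946592, 71520695584, 62930721921, 83368483904, 73670239264,
  77859233952, 71489266881, 80144111776, 65043506241, 67225728228, 68297136291, 66118425797,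
  76924006624, 62928560192, 80144078976, 73699565730, 61887325346, 71522857248, 71554181345,
  68336982146, 60783238272, 75814511746, 71554245697, 71420024960, 58604369088, 70378627137,
  77996695780, 72597649600, 75782106432, 72595478656, 57492641954, 72595384449, 66153027648,
  70477258882, 72562940002, 72489375907, 70311517313, 68264630435, 71452500196, 67225557057,
  76886088865, 73702807713, 70484597856, 67226605666, 76890381473, 71453586560, 60821154880,
  61824507040, 68337282240, 68302379138, 68334917762, 79974111396, 61894796481, 67194233029,
  62928560256, 72493766752, 67122864291, 75713913059, 60749621445, 70343007329, 65115040800,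
  72627957056, 74775470210, 68268077376, 71556175970]

/-- certificate (part 8) -/
def udat8 : List ℕ := [
  67226709285, 58633560194, 73598903525, 62829010016, 67124893859, 70413395106, 71485991203,
  70482535618, 80144114917, 76856892448, 74743981314, 67226774784, 53304761408, 76650159268,
  70447998048, 72630117571, 64005585185, 68266862849, 68198806688, 70480435362, 71554178176,
  73601033477, 70481484995, 76887104673, 62930659456, 73531795749, 71553129536, 77930539205,
  73566397600, 70481320033, 68336065632, 60785304804, 73669158050, 68268042433, 68265879749,
  60821084225, 70379776128, 71452335233, 70380855459, 73566397669, 80074877090, 67260360736,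
  65111730304, 77927357602, 68328626306, 68302511268, 71521708064, 71521674305, 66185507136,
  67158614145, 72527290564, 68267976801, 81222244417, 75818899585, 66186518690, 68302511233,
  74604422209, 60749716641, 70308405412, 57565091904, 70415457312, 66152963201, 67224575104,
  62930659620, 62792145060, 72560878624, 65114839200, 67194167424, 66188617953, 65079287938,
  74738605186, 71519544580, 61893749920, 70478306467, 65073881153, 75852453953, 97257892000,
  68298251362, 73529631908, 71522850944, 68337113184, 59608799396, 72631229472, 65012111524,
  76925084865, 74741818532, 61853772066, 76650194082, 71556241539, 68331906275, 75818769440,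
  68266895522, 68337114241, 74741884993, 67256035556, 79074663617, 68335933538, 68164033633,
  65113927969, 68302379137, 68337113186, 67262327042, 68197688416, 78000823424, 71554213986,
  80147093569, 62967389381, 75784231040, 80078056773, 74741885058, 70379673763, 80112657537,
  61858066722, 70376597796, 71522722946, 61859078209, 65079325888, 65008835681, 64939694244,
  57426747620, 66182291620, 71489203523, 70377644195, 76788537508, 68301632544, 82121730208,
  68335050882, 68129464450, 73701664800, 70380758113, 68302575680, 77930572960, 67228768384,
  62932820097, 68231243010, 70484767072, 55379896546, 70448027777, 72624743651, 68263749794,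
  74641253536, 67193221184, 75816671395, 64034809984, 70311584864, 64037954656, 67121817696,
  77929486500, 65113828643, 71489198144, 66181176417, 71558341890, 68197687424, 70415560896,
  70377679108, 66120357986, 70376596740, 66155030753, 68301461635, 72355226755, 70482534465,
  66152931457, 70311650368, 70447863873, 70411164770, 66116198562, 70477159489, 62898251841,
  67192138912, 72595518496, 68265814212, 70311518370, 70481453216, 70345171008, 77929490464,
  70481453253, 70414441635, 67159599364, 66150768770, 71522621538, 64976460960, 58568615040,
  70477192289, 75849217282, 67262521409, 68302611520, 68334918785, 70450093186, 68265879777,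
  68332955876, 67124996385, 66116197441, 64004462722, 80144182400, 82294847520, 70414442690,
  72527323264, 68331805793, 79070374177, 68334950497]

/-- certificate (part 9) -/
def udat9 : List ℕ := [
  75713880194, 67263438913, 70409034915, 72489441443, 74772226276, 64007739457, 67122899107,
  68302682144, 70478208161, 62967552032, 72625822880, 71518394530, 71489266720, 68329642148,
  77966383136, 70450162848, 56351893664, 67194169635, 68333018308, 68265909444, 73703792834,
  73498106978, 70415496416, 70484765728, 71523736704, 68232292481, 70379807776, 67226771585,
  68295104675, 67191053474, 75851346976, 72594336033, 71521744128, 75784133793, 64007706689,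
  67255999586, 68267911457, 70480406657, 65043472449, 67221363873, 65079221408, 67257049153,
  71489238243, 68060259426, 62794309761, 59608803360, 73463537826, 70413399200, 73634588736,
  60646725796, 70345037988, 70484465762, 70449997029, 67021120674, 71519477825, 71516331172,
  70478339168, 65008902275, 66016648356, 71281482916, 70450157728, 71521772737, 71489233024,
  71488051362, 67255999585, 72558684389, 68300347555, 70415259812, 64976429219, 68333019168,
  71452434560, 82258078848, 77929486496, 70482534625, 68060258468, 68300449857, 68267911200,
  70415492194, 64001254564, 55448084709, 72595450050, 58497246305, 70477261060, 67159598275,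
  45753014400, 75784234181, 73701632196, 70450060450, 65079189665, 59744170181, 67261143171,
  68232327492, 71484940448, 70448981056, 65111729217]

/-- certificate -/
def udat : List (List ℕ) := [udat0, udat1, udat2, udat3, udat4, udat5, udat6, udat7, udat8, udat9]

end BDP

namespace BDP

open MatchPaper

/-- table of edges -/
def etab : List E7 := [(0, 1), (0, 2), (0, 3), (0, 4), (0, 5), (0, 6), (1, 2), (1, 3), (1, 4),
  (1, 5), (1, 6), (2, 3), (2, 4), (2, 5), (2, 6), (3, 4), (3, 5), (3, 6), (4, 5), (4, 6), (5, 6)]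

/-- the edge of given index -/
def e (k : ℕ) : E7 := etab.getD k (0, 0)

lemma e_lt : ∀ k < 21, (e k).1 < (e k).2 := by decide
lemma e_rank : ∀ b < 21, ∀ a < b, rankP 7 (e a) < rankP 7 (e b) := by decide
lemma e_surj : ∀ i j : Fin 7, i < j → ∃ k < 21, e k = (i, j) := by decide
lemma w_eq : ∀ k < 21, w k = ct (e k) 0 + 16 * (ct (e k) 1 + 16 * (ct (e k) 2 + 16 * (ct (e k) 3 +
    16 * (ct (e k) 4 + 16 * (ct (e k) 5 + 16 * ct (e k) 6))))) := by decide
lemma ct_le : ∀ k < 21, ∀ j, ct (e k) j ≤ 1 := by decide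

lemma e_inj {a b : ℕ} (ha : a < 21) (hb : b < 21) (h : e a = e b) : a = b := by
  rcases lt_trichotomy a b with h1 | h1 | h1
  · have := e_rank b hb a h1; rw [h] at this; omega
  · exact h1
  · have := e_rank a ha b h1; rw [h] at this; omega

/-- degree in a list -/
def dg (l : List ℕ) (j : Fin 7) : ℕ := (l.map fun k => ct (e k) j).sum

@[simp] lemma dg_nil (j : Fin 7) : dg [] j = 0 := rfl
@[simp] lemma dg_cons (a : ℕ) (l : List ℕ) (j : Fin 7) : dg (a :: l) j = ct (e a) j + dg l j := by
  simp [dg]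
lemma dg_append (l m : List ℕ) (j : Fin 7) : dg (l ++ m) j = dg l j + dg m j := by
  simp [dg]
lemma dg_reverse (l : List ℕ) (j : Fin 7) : dg l.reverse j = dg l j := by
  simp [dg]

lemma dg_le (l : List ℕ) (hl : ∀ k ∈ l, k < 21) (j : Fin 7) : dg l j ≤ l.length := by
  induction l with
  | nil => simp
  | cons a t ih =>
    have h1 := ih fun k hk => hl k (List.mem_cons_of_mem _ hk)
    have h2 := ct_le a (hl a List.mem_cons_self) j
    simp; omega

lemma wsum_eq (l : List ℕ) (hl : ∀ k ∈ l, k < 21) : wsum l = dg l 0 + 16 * (dg l 1 +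
    16 * (dg l 2 + 16 * (dg l 3 + 16 * (dg l 4 + 16 * (dg l 5 + 16 * dg l 6))))) := by
  induction l with
  | nil => simp [wsum]
  | cons a t ih =>
    have h1 := ih fun k hk => hl k (List.mem_cons_of_mem _ hk)
    have h2 := w_eq a (hl a List.mem_cons_self)
    change w a + wsum t = _
    rw [h1, h2]
    simp only [dg_cons]
    omega

lemma land16 (a A b B : ℕ) (ha : a < 16) (hb : b < 16) :
    (a + 16 * A) &&& (b + 16 * B) = (a &&& b) + 16 * (A &&& B) := by
  have h1 := Nat.and_mod_two_pow (a := a + 16 * A) (b := b + 16 * B) (n := 4)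
  have h2 := Nat.and_div_two_pow (a := a + 16 * A) (b := b + 16 * B) (n := 4)
  rw [show (2 : ℕ) ^ 4 = 16 from rfl] at h1 h2
  rw [show (a + 16 * A) % 16 = a by omega, show (b + 16 * B) % 16 = b by omega] at h1
  rw [show (a + 16 * A) / 16 = A by omega, show (b + 16 * B) / 16 = B by omega] at h2
  omega

lemma land_def (a b : ℕ) : Nat.land a b = a &&& b := rfl

lemma d14 : ∀ a < 16, (a &&& 14) < 16 ∧ ((a &&& 14) = 2 ↔ a = 2 ∨ a = 3) := by decide
lemma d8 : ∀ a < 16, (a &&& 8) < 16 ∧ ((a &&& 8) = 0 ↔ a < 8) := by decide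

lemma forall7 (P : Fin 7 → Prop) : (∀ j, P j) ↔ P 0 ∧ P 1 ∧ P 2 ∧ P 3 ∧ P 4 ∧ P 5 ∧ P 6 := by
  constructor
  · intro h; exact ⟨h 0, h 1, h 2, h 3, h 4, h 5, h 6⟩
  · rintro ⟨h0, h1, h2, h3, h4, h5, h6⟩ j
    fin_cases j <;> assumption

lemma vld_key (N d0 d1 d2 d3 d4 d5 d6 : ℕ) (h0 : d0 ≤ 7) (h1 : d1 ≤ 7) (h2 : d2 ≤ 7)
    (h3 : d3 ≤ 7) (h4 : d4 ≤ 7) (h5 : d5 ≤ 7) (h6 : d6 ≤ 7)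
    (hN : N = d0 + 16 * (d1 + 16 * (d2 + 16 * (d3 + 16 * (d4 + 16 * (d5 + 16 * d6)))))) :
    (N + 17895697) &&& 250539758 =
    ((d0 + 1) &&& 14) + 16 * (((d1 + 1) &&& 14) + 16 * (((d2 + 1) &&& 14) +
    16 * (((d3 + 1) &&& 14) + 16 * (((d4 + 1) &&& 14) + 16 * (((d5 + 1) &&& 14) +
    16 * ((d6 + 1) &&& 14)))))) := by
  have hA : N + 17895697 = (d0 + 1) + 16 * ((d1 + 1) + 16 * ((d2 + 1) +
      16 * ((d3 + 1) + 16 * ((d4 + 1) + 16 * ((d5 + 1) +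
      16 * (d6 + 1)))))) := by
      rw [hN]; omega
  have hB : 250539758 = 14 + 16 * (14 + 16 * (14 + 16 * (14 + 16 * (14 + 16 * (14 +
      16 * 14))))) := by norm_num
  rw [hA, hB, land16 _ _ _ _ (by omega) (by omega), land16 _ _ _ _ (by omega) (by omega),
      land16 _ _ _ _ (by omega) (by omega), land16 _ _ _ _ (by omega) (by omega),
      land16 _ _ _ _ (by omega) (by omega), land16 _ _ _ _ (by omega) (by omega)]

lemma digs (c a0 a1 a2 a3 a4 a5 a6 : ℕ) (hc : c < 16) (h0 : a0 < 16) (h1 : a1 < 16) (h2 : a2 < 16)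
    (h3 : a3 < 16) (h4 : a4 < 16) (h5 : a5 < 16) (h6 : a6 < 16) :
    a0 + 16 * (a1 + 16 * (a2 + 16 * (a3 + 16 * (a4 + 16 * (a5 + 16 * a6))))) =
      c + 16 * (c + 16 * (c + 16 * (c + 16 * (c + 16 * (c + 16 * c))))) ↔
    a0 = c ∧ a1 = c ∧ a2 = c ∧ a3 = c ∧ a4 = c ∧ a5 = c ∧ a6 = c := by
  constructor
  · intro h
    have e0 : a0 = c := by omega
    have e1 : a1 = c := by omega
    have e2 : a2 = c := by omega
    have e3 : a3 = c := by omega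
    have e4 : a4 = c := by omega
    have e5 : a5 = c := by omega
    have e6 : a6 = c := by omega
    exact ⟨e0, e1, e2, e3, e4, e5, e6⟩
  · rintro ⟨rfl, rfl, rfl, rfl, rfl, rfl, rfl⟩; rfl

lemma dig_iff (d : ℕ) (h : d ≤ 7) : ((d + 1) &&& 14) = 2 ↔ 1 ≤ d ∧ d ≤ 2 := by
  rw [(d14 (d + 1) (by omega)).2]; omega

lemma vldN_def (N : ℕ) : vldN N = true ↔ (N + 17895697) &&& 250539758 = 35791394 := by
  unfold vldN
  rw [Nat.beq_eq, land_def, Nat.add_eq]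

lemma vldN_iff (l : List ℕ) (hl : ∀ k ∈ l, k < 21) (hlen : l.length ≤ 7) :
    vldN (wsum l) = true ↔ ∀ j, 1 ≤ dg l j ∧ dg l j ≤ 2 := by
  have hb : ∀ j, dg l j ≤ 7 := fun j => (dg_le l hl j).trans hlen
  have hs : ∀ j, ((dg l j + 1) &&& 14) < 16 := fun j =>
    (d14 (dg l j + 1) (by have := hb j; omega)).1
  rw [forall7, vldN_def, vld_key _ _ _ _ _ _ _ _ (hb 0) (hb 1) (hb 2) (hb 3) (hb 4) (hb 5) (hb 6)
    (wsum_eq l hl), show 35791394 = 2 + 16 * (2 + 16 * (2 + 16 * (2 + 16 * (2 + 16 * (2 + 16 * 2)))))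
    by norm_num, digs 2 _ _ _ _ _ _ _ (by omega) (hs 0) (hs 1) (hs 2) (hs 3) (hs 4) (hs 5) (hs 6),
    dig_iff _ (hb 0), dig_iff _ (hb 1), dig_iff _ (hb 2), dig_iff _ (hb 3), dig_iff _ (hb 4),
    dig_iff _ (hb 5), dig_iff _ (hb 6)]

lemma okN_of (l : List ℕ) (hl : ∀ k ∈ l, k < 21) (hlen : l.length ≤ 7)
    (h : ∀ j, dg l j ≤ 2) : okN (wsum l) = true := by
  have h0 := h 0; have h1 := h 1; have h2 := h 2; have h3 := h 3; have h4 := h 4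
  have h5 := h 5; have h6 := h 6
  have key : Nat.land (Nat.add (wsum l) 89478485) 143165576 =
    ((dg l 0 + 5) &&& 8) + 16 * (((dg l 1 + 5) &&& 8) + 16 * (((dg l 2 + 5) &&& 8) +
    16 * (((dg l 3 + 5) &&& 8) + 16 * (((dg l 4 + 5) &&& 8) + 16 * (((dg l 5 + 5) &&& 8) +
    16 * ((dg l 6 + 5) &&& 8)))))) := by
    rw [land_def, Nat.add_eq]
    have hA : wsum l + 89478485 = (dg l 0 + 5) + 16 * ((dg l 1 + 5) + 16 * ((dg l 2 + 5) +
      16 * ((dg l 3 + 5) + 16 * ((dg l 4 + 5) + 16 * ((dg l 5 + 5) +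
      16 * (dg l 6 + 5)))))) := by
      rw [wsum_eq l hl]; omega
    have hB : 143165576 = 8 + 16 * (8 + 16 * (8 + 16 * (8 + 16 * (8 + 16 * (8 +
      16 * 8))))) := by norm_num
    rw [hA, hB, land16 _ _ _ _ (by omega) (by omega), land16 _ _ _ _ (by omega) (by omega),
      land16 _ _ _ _ (by omega) (by omega), land16 _ _ _ _ (by omega) (by omega),
      land16 _ _ _ _ (by omega) (by omega), land16 _ _ _ _ (by omega) (by omega)]
  unfold okN
  rw [key, Nat.beq_eq]
  have g0 := d8 (dg l 0 + 5) (by omega)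
  have g1 := d8 (dg l 1 + 5) (by omega)
  have g2 := d8 (dg l 2 + 5) (by omega)
  have g3 := d8 (dg l 3 + 5) (by omega)
  have g4 := d8 (dg l 4 + 5) (by omega)
  have g5 := d8 (dg l 5 + 5) (by omega)
  have g6 := d8 (dg l 6 + 5) (by omega)
  omega

/-- the set of edges of a list -/
def S (l : List ℕ) : Finset E7 := (l.map e).toFinset

@[simp] lemma S_nil : S [] = ∅ := rfl
@[simp] lemma S_cons (a : ℕ) (l : List ℕ) : S (a :: l) = insert (e a) (S l) := by simp [S]
lemma mem_S {l : List ℕ} {p : E7} : p ∈ S l ↔ ∃ k ∈ l, e k = p := by simp [S]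

/-- strictly increasing lists of indices -/
def Good (l : List ℕ) : Prop := l.Pairwise (· < ·) ∧ ∀ k ∈ l, k < 21

lemma good_of_srt : ∀ l : List ℕ, srt l = true → Good l
  | [], _ => ⟨List.Pairwise.nil, by simp⟩
  | [a], h => by
    simp [srt] at h
    exact ⟨by simp, by simpa using h⟩
  | a :: b :: t, h => by
    have h' : Nat.blt a b = true ∧ srt (b :: t) = true := by
      rw [srt, Bool.and_eq_true] at h; exact h
    have hab : a < b := by
      have := h'.1; simpa [Nat.blt_eq] using this
    have ih := good_of_srt (b :: t) h'.2
    refine ⟨?_, ?_⟩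
    · rw [List.pairwise_cons]
      refine ⟨?_, ih.1⟩
      intro k hk
      rcases List.mem_cons.mp hk with rfl | hk
      · exact hab
      · exact hab.trans ((List.pairwise_cons.mp ih.1).1 k hk)
    · intro k hk
      rcases List.mem_cons.mp hk with rfl | hk
      · exact hab.trans (ih.2 b List.mem_cons_self)
      · exact ih.2 k hk

lemma Good.tail {a : ℕ} {t : List ℕ} (h : Good (a :: t)) : Good t :=
  ⟨(List.pairwise_cons.mp h.1).2, fun k hk => h.2 k (List.mem_cons_of_mem _ hk)⟩

lemma Good.rank_lt {a : ℕ} {t : List ℕ} (h : Good (a :: t)) {u : E7} (hu : u ∈ S t) :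
    rankP 7 (e a) < rankP 7 u := by
  obtain ⟨k, hk, rfl⟩ := mem_S.mp hu
  exact e_rank k (h.2 k (List.mem_cons_of_mem _ hk)) a ((List.pairwise_cons.mp h.1).1 k hk)

lemma Good.notMem {a : ℕ} {t : List ℕ} (h : Good (a :: t)) : e a ∉ S t :=
  fun hu => lt_irrefl _ (h.rank_lt hu)

lemma Good.card : ∀ {l : List ℕ}, Good l → (S l).card = l.length
  | [], _ => rfl
  | a :: t, h => by
    rw [S_cons, Finset.card_insert_of_notMem h.notMem, h.tail.card]; rfl

lemma Good.deg (j : Fin 7) : ∀ {l : List ℕ}, Good l → degB (S l) j = dg l j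
  | [], _ => by simp [degB]
  | a :: t, h => by
    rw [S_cons, degB_insert h.notMem, h.tail.deg, dg_cons]

lemma Good.Kd_iff {l : List ℕ} (h : Good l) (hlen : l.length ≤ 7) :
    Kd (S l) ↔ vldN (wsum l) = true := by
  rw [vldN_iff l h.2 hlen]
  constructor
  · rintro ⟨_, h2⟩ j
    rw [← h.deg]; exact h2 j
  · intro h2
    refine ⟨?_, fun j => by rw [h.deg]; exact h2 j⟩
    intro p hp
    obtain ⟨k, hk, rfl⟩ := mem_S.mp hp
    exact e_lt k (h.2 k hk)

/-- the list of a set of edges -/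
def toL (σ : Finset E7) : List ℕ := (List.range 21).filter fun k => e k ∈ σ

lemma toL_good (σ : Finset E7) : Good (toL σ) := by
  refine ⟨List.Pairwise.filter _ List.pairwise_lt_range, ?_⟩
  intro k hk
  exact List.mem_range.mp (List.mem_of_mem_filter hk)

lemma S_toL {σ : Finset E7} (h : ∀ p ∈ σ, p.1 < p.2) : S (toL σ) = σ := by
  ext p
  rw [mem_S]
  constructor
  · rintro ⟨k, hk, rfl⟩
    simpa using (List.mem_filter.mp hk).2
  · intro hp
    obtain ⟨k, hk, h1⟩ := e_surj p.1 p.2 (h p hp)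
    have h1 : e k = p := h1
    refine ⟨k, List.mem_filter.mpr ⟨List.mem_range.mpr hk, by simpa [h1] using hp⟩, h1⟩

lemma toL_S {l : List ℕ} (h : Good l) : toL (S l) = l := by
  have h1 := toL_good (S l)
  refine List.Perm.eq_of_pairwise (le := (· < ·)) (fun a b _ _ h1 h2 => by omega) h1.1 h.1 ?_
  rw [List.perm_ext_iff_of_nodup (h1.1.imp (fun h => by omega)) (h.1.imp (fun h => by omega))]
  intro k
  constructor
  · intro hk
    obtain ⟨h2, h3⟩ := List.mem_filter.mp hk
    obtain ⟨k', hk', h4⟩ := mem_S.mp (by simpa using h3)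
    rw [← e_inj (h.2 k' hk') (List.mem_range.mp h2) h4]; exact hk'
  · intro hk
    refine List.mem_filter.mpr ⟨List.mem_range.mpr (h.2 k hk), ?_⟩
    simpa using mem_S.mpr ⟨k, hk, rfl⟩

lemma eds_eq : eds = (List.range 21).reverse := by decide

lemma toL_length {σ : Finset E7} (h : ∀ p ∈ σ, p.1 < p.2) : (toL σ).length = σ.card := by
  rw [← (toL_good σ).card, S_toL h]

lemma sub_eds (σ : Finset E7) : (toL σ).reverse.Sublist eds := by
  rw [eds_eq]
  exact List.Sublist.reverse List.filter_sublist

lemma good_of_sub {l : List ℕ} (h : l.Sublist eds) : Good l.reverse := by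
  rw [eds_eq] at h
  have h2 : l.reverse.Sublist (List.range 21) := by simpa using h.reverse
  exact ⟨List.pairwise_lt_range.sublist h2, fun k hk => List.mem_range.mp (h2.subset hk)⟩

lemma prune {k : ℕ} {acc l : List ℕ} (h21 : ∀ x ∈ k :: acc, x < 21)
    (hl : ∀ x ∈ l, x < 21) (hlen : l.length + (k :: acc).length ≤ 7)
    (hv : vldN (wsum (l.reverseAux (k :: acc))) = true) :
    okN (Nat.add (wsum acc) (w k)) = true := by
  rw [List.reverseAux_eq, vldN_iff] at hv
  · have : Nat.add (wsum acc) (w k) = wsum (k :: acc) := Nat.add_comm _ _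
    rw [this]
    apply okN_of _ h21 (by omega)
    intro j
    have := (hv j).2
    rw [dg_append] at this
    omega
  · intro x hx
    rcases List.mem_append.mp hx with hx | hx
    · exact hl x (List.mem_reverse.mp hx)
    · exact h21 x hx
  · simp at hlen ⊢; omega

lemma trav_zero (f : List ℕ → ℕ) : ∀ (es : List ℕ) (c : ℕ) (acc l : List ℕ),
    (∀ k ∈ es, k < 21) → (∀ k ∈ acc, k < 21) → c + acc.length ≤ 7 →
    trav f es c (wsum acc) acc = 0 → l.Sublist es → l.length = c →
    vldN (wsum (l.reverseAux acc)) = true → f (l.reverseAux acc) = 0 := by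
  intro es
  induction es with
  | nil =>
    intro c acc l _ _ _ h hs hlen hv
    have hl : l = [] := List.sublist_nil.mp hs
    subst hl
    simp at hlen
    subst hlen
    change vldN (wsum acc) = true at hv
    change f acc = 0
    simpa [trav, hv] using h
  | cons k es ih =>
    intro c acc l he ha hc h hs hlen hv
    cases c with
    | zero =>
      have hl : l = [] := List.length_eq_zero_iff.mp hlen
      subst hl
      change vldN (wsum acc) = true at hv
      change f acc = 0
      simpa [trav, hv] using h
    | succ c =>
      rw [trav] at h
      have h' : trav f es (c + 1) (wsum acc) acc +
        (bif okN (Nat.add (wsum acc) (w k)) then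
          trav f es c (Nat.add (wsum acc) (w k)) (k :: acc) else 0) = 0 := h
      obtain ⟨hA, hB⟩ := Nat.add_eq_zero_iff.mp h'
      have he' : ∀ x ∈ es, x < 21 := fun x hx => he x (List.mem_cons_of_mem _ hx)
      rcases List.sublist_cons_iff.mp hs with hs | ⟨l', rfl, hs'⟩
      · exact ih (c + 1) acc l he' ha hc hA hs hlen hv
      · have ha' : ∀ x ∈ k :: acc, x < 21 := by
          intro x hx
          rcases List.mem_cons.mp hx with rfl | hx
          · exact he _ List.mem_cons_self
          · exact ha x hx
        have hlen' : l'.length = c := by simpa using hlen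
        have hok := prune ha' (fun x hx => he' x (hs'.subset hx)) (by simp; omega) hv
        rw [hok, cond_true] at hB
        have : Nat.add (wsum acc) (w k) = wsum (k :: acc) := Nat.add_comm _ _
        rw [this] at hB
        exact ih c (k :: acc) l' he' ha' (by simp; omega) hB hs' hlen' hv

lemma trav_face {f : List ℕ → ℕ} {c : ℕ} (hc : c ≤ 7) (h : trav f eds c 0 [] = 0)
    {σ : Finset E7} (hσ : Kd σ) (hcard : σ.card = c) : f (toL σ) = 0 := by
  have hl := toL_length hσ.1
  have h2 := trav_zero f eds c [] (toL σ).reverse (by decide) (by simp) (by simpa using hc) h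
    (sub_eds σ) (by simp [hl, hcard])
  have h3 : (toL σ).reverse.reverseAux [] = toL σ := by simp [List.reverseAux_eq]
  rw [h3] at h2
  apply h2
  rw [← (toL_good σ).Kd_iff (by omega), S_toL hσ.1]
  exact hσ

end BDP

namespace BDP

open MatchPaper

lemma trav_z (f : List ℕ → ℕ) (es : List ℕ) (N : ℕ) (acc : List ℕ) :
    trav f es 0 N acc = bif vldN N then f acc else 0 := by
  cases es <;> rw [trav]

lemma trav_ns (f : List ℕ → ℕ) (c N : ℕ) (acc : List ℕ) : trav f [] (c + 1) N acc = 0 := by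
  rw [trav]

lemma trav_cs (f : List ℕ → ℕ) (k : ℕ) (es : List ℕ) (c N : ℕ) (acc : List ℕ) :
    trav f (k :: es) (c + 1) N acc = trav f es (c + 1) N acc +
      (bif okN (Nat.add N (w k)) then trav f es c (Nat.add N (w k)) (k :: acc) else 0) := by
  rw [trav, Nat.add_eq]

lemma countP_z {α : Type} (p : List α → Bool) (es : List α) :
    (List.sublistsLen 0 es).countP p = bif p [] then 1 else 0 := by
  rw [List.sublistsLen_zero, List.countP_singleton]
  cases p [] <;> simp

lemma trav_count : ∀ (es : List ℕ) (c : ℕ) (acc : List ℕ),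
    (∀ k ∈ es, k < 21) → (∀ k ∈ acc, k < 21) → c + acc.length ≤ 7 →
    trav (fun _ => 1) es c (wsum acc) acc =
      (List.sublistsLen c es).countP fun l => vldN (wsum (l.reverseAux acc)) := by
  intro es
  induction es with
  | nil =>
    intro c acc _ _ _
    cases c with
    | zero =>
      rw [trav_z, countP_z, List.reverseAux_nil]
    | succ c => rw [trav_ns, List.sublistsLen_succ_nil, List.countP_nil]
  | cons k es ih =>
    intro c acc he ha hc
    cases c with
    | zero =>
      rw [trav_z, countP_z, List.reverseAux_nil]
    | succ c =>
      have he' : ∀ x ∈ es, x < 21 := fun x hx => he x (List.mem_cons_of_mem _ hx)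
      have ha' : ∀ x ∈ k :: acc, x < 21 := by
        intro x hx
        rcases List.mem_cons.mp hx with rfl | hx
        · exact he _ List.mem_cons_self
        · exact ha x hx
      have h1 := ih (c + 1) acc he' ha hc
      have h2 := ih c (k :: acc) he' ha' (by simp; omega)
      have : Nat.add (wsum acc) (w k) = wsum (k :: acc) := Nat.add_comm _ _
      rw [trav_cs, List.sublistsLen_succ_cons, List.countP_append, List.countP_map, h1]
      congr 1
      by_cases hok : okN (Nat.add (wsum acc) (w k)) = true
      · rw [hok, cond_true, this, h2]
        exact List.countP_congr fun l _ => by rw [Function.comp_apply, List.reverseAux_cons]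
      · rw [Bool.not_eq_true] at hok
        rw [hok, cond_false, eq_comm, List.countP_eq_zero]
        intro l hl hv
        rw [Function.comp_apply, List.reverseAux_cons] at hv
        obtain ⟨hs, hlen⟩ := List.mem_sublistsLen.mp hl
        have := prune ha' (fun x hx => he' x (hs.subset hx)) (by simp; omega) hv
        rw [hok] at this
        exact absurd this (by decide)

lemma card_faces {c n : ℕ} (hc : c ≤ 7) (h : trav (fun _ => 1) eds c 0 [] = n) :
    Nat.card {σ : Finset E7 // Kd σ ∧ σ.card = c} = n := by
  have h1 := trav_count eds c [] (by decide) (by simp) (by simpa using hc)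
  change trav (fun _ => 1) eds c 0 [] = _ at h1
  rw [h, List.countP_eq_length_filter] at h1
  set L := (List.sublistsLen c eds).filter fun l => vldN (wsum (l.reverseAux [])) with hL
  have hnd : L.Nodup := (List.nodup_sublistsLen c (by decide)).filter _
  have hmem : ∀ l, l ∈ L ↔ (l.Sublist eds ∧ l.length = c) ∧ vldN (wsum l.reverse) = true := by
    intro l
    rw [hL, List.mem_filter, List.mem_sublistsLen]
    simp [List.reverseAux_eq]
  have hb : Nat.card {σ : Finset E7 // Kd σ ∧ σ.card = c} = Nat.card {l // l ∈ L} := by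
    refine Nat.card_congr (Equiv.ofBijective (fun σ => ⟨(toL σ.1).reverse, ?_⟩) ⟨?_, ?_⟩)
    · obtain ⟨σ, hσ, hcard⟩ := σ
      have hl := toL_length hσ.1
      rw [hmem]
      refine ⟨⟨sub_eds σ, by simp [hl, hcard]⟩, ?_⟩
      rw [List.reverse_reverse, ← (toL_good σ).Kd_iff (by simp [hl]; omega), S_toL hσ.1]
      exact hσ
    · rintro ⟨σ, hσ, _⟩ ⟨τ, hτ, _⟩ hst
      have : (toL σ).reverse = (toL τ).reverse := congrArg Subtype.val hst
      have := congrArg S (List.reverse_injective this)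
      rw [S_toL hσ.1, S_toL hτ.1] at this
      exact Subtype.ext this
    · rintro ⟨l, hl⟩
      obtain ⟨⟨h2, h3⟩, h4⟩ := (hmem l).mp hl
      have hg := good_of_sub h2
      refine ⟨⟨S l.reverse, (hg.Kd_iff (by simp; omega)).mpr h4, by rw [hg.card]; simpa⟩, ?_⟩
      apply Subtype.ext
      change (toL (S l.reverse)).reverse = l
      rw [toL_S hg, List.reverse_reverse]
  rw [hb, h1]
  have : {l // l ∈ L} ≃ {l // l ∈ L.toFinset} := Equiv.subtypeEquivRight (by simp)
  rw [Nat.card_congr this, Nat.card_eq_fintype_card, Fintype.card_coe,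
    List.toFinset_card_of_nodup hnd]

end BDP

namespace BDP

open MatchPaper

lemma eps_least {a : ℕ} {t : List ℕ} (h : Good (a :: t)) :
    eps (rankP 7) (insert (e a) (S t)) (e a) = 1 := by
  unfold eps
  rw [Finset.filter_eq_empty_iff.mpr]
  · rfl
  · intro u hu hlt
    rcases Finset.mem_insert.mp hu with rfl | hu
    · exact lt_irrefl _ hlt
    · have := h.rank_lt hu; omega

lemma eps_tail {a : ℕ} {t : List ℕ} (h : Good (a :: t)) {v : E7} (hv : v ∈ S t) :
    eps (rankP 7) (insert (e a) (S t)) v = - eps (rankP 7) (S t) v := by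
  have := eps_erase_of_lt (rankP 7) (Finset.mem_insert_self (e a) (S t)) (h.rank_lt hv)
  rw [Finset.erase_insert h.notMem] at this
  rw [this, neg_neg]

lemma sg_not (b : Bool) : sg (!b) = - sg b := by cases b <;> rfl

lemma list_sum_neg {M ι : Type*} [AddCommGroup M] (f : ι → M) (l : List ι) :
    (l.map fun p => - f p).sum = - (l.map f).sum := by
  induction l with
  | nil => simp
  | cons a t ih => simp [ih, add_comm]

lemma bdl_sum {M : Type*} [AddCommGroup M] : ∀ (l : List ℕ) (F : Finset E7 → M), Good l →
    ∑ v ∈ S l, eps (rankP 7) (S l) v • F ((S l).erase v) =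
      ((bdl l).map fun p => sg p.1 • F (S p.2)).sum
  | [], F, _ => by simp [bdl]
  | a :: t, F, h => by
    rw [S_cons, Finset.sum_insert h.notMem, eps_least h, one_smul, Finset.erase_insert h.notMem]
    have ih := bdl_sum t (fun σ => F (insert (e a) σ)) h.tail
    have h1 : ∀ v ∈ S t, eps (rankP 7) (insert (e a) (S t)) v • F ((insert (e a) (S t)).erase v) =
        - (eps (rankP 7) (S t) v • F (insert (e a) ((S t).erase v))) := by
      intro v hv
      have hne : e a ≠ v := fun h' => h.notMem (h' ▸ hv)
      rw [eps_tail h hv, Finset.erase_insert_of_ne hne, neg_smul]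
    rw [Finset.sum_congr rfl h1, Finset.sum_neg_distrib, ih, ← list_sum_neg, bdl, List.map_cons,
      List.sum_cons, List.map_map]
    have h2 : sg (true, t).1 • F (S (true, t).2) = F (S t) := by simp [sg]
    rw [h2]
    congr 2
    apply List.map_congr_left
    intro p _
    simp [sg_not]

lemma bdl_mem : ∀ (l : List ℕ) (p : Bool × List ℕ), p ∈ bdl l →
    p.2.Sublist l ∧ p.2.length + 1 = l.length
  | [], p, h => by simp [bdl] at h
  | a :: t, p, h => by
    rw [bdl] at h
    rcases List.mem_cons.mp h with rfl | h
    · exact ⟨List.sublist_cons_self _ _, rfl⟩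
    · obtain ⟨q, hq, rfl⟩ := List.mem_map.mp h
      obtain ⟨h1, h2⟩ := bdl_mem t q hq
      exact ⟨h1.cons_cons a, by simp [h2]⟩

lemma Good.sub {l m : List ℕ} (h : Good l) (hs : m.Sublist l) : Good m :=
  ⟨h.1.sublist hs, fun k hk => h.2 k (hs.subset hk)⟩

/-- A good list whose set of edges is a face. -/
def Vl (c : ℕ) (l : List ℕ) : Prop := Good l ∧ vldN (wsum l) = true ∧ l.length = c

lemma Vl.Kd {c : ℕ} {l : List ℕ} (h : Vl c l) (hc : c ≤ 7) : Kd (S l) :=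
  (h.1.Kd_iff (by rw [h.2.2]; exact hc)).mpr h.2.1

lemma Vl.card {c : ℕ} {l : List ℕ} (h : Vl c l) : (S l).card = c := by
  rw [h.1.card, h.2.2]

lemma bdv_mem {c : ℕ} {l : List ℕ} (h : Vl (c + 1) l) {p : Bool × List ℕ} (hp : p ∈ bdv l) :
    Vl c p.2 := by
  obtain ⟨h1, h2⟩ := List.mem_filter.mp hp
  obtain ⟨h3, h4⟩ := bdl_mem l p h1
  have := h.2.2
  exact ⟨h.1.sub h3, h2, by omega⟩

lemma sum_filter {M ι : Type*} [AddCommGroup M] (f : ι → M) (q : ι → Bool) (l : List ι)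
    (h : ∀ p ∈ l, q p = false → f p = 0) : ((l.filter q).map f).sum = (l.map f).sum := by
  induction l with
  | nil => rfl
  | cons a t ih =>
    have ih' := ih fun p hp => h p (List.mem_cons_of_mem _ hp)
    by_cases hq : q a = true
    · rw [List.filter_cons_of_pos hq, List.map_cons, List.map_cons, List.sum_cons, List.sum_cons,
        ih']
    · rw [List.filter_cons_of_neg hq, List.map_cons, List.sum_cons, ih',
        h a List.mem_cons_self (by simpa using hq), zero_add]

lemma dd_bdv {c : ℕ} {l : List ℕ} (h : Vl (c + 1) l) (hc : c + 1 ≤ 7) :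
    dd c (bb (c + 1) (S l)) = ((bdv l).map fun p => sg p.1 • bb c (S p.2)).sum := by
  rw [bdry_bas (rankP 7) (h.Kd hc) h.card, bdl_sum l (fun σ => bb c σ) h.1, bdv, sum_filter]
  intro p hp hq
  obtain ⟨h3, h4⟩ := bdl_mem l p hp
  have := h.2.2
  have hk : ¬ Kd (S p.2) := by
    rw [(h.1.sub h3).Kd_iff (by omega), hq]
    decide
  rw [bb, bas_zero hk, smul_zero]

/-- The cocycle. -/
noncomputable def phiZ : D 5 →ₗ[ℤ] ℤ :=
  Finsupp.lsum ℤ fun σ => LinearMap.toSpanSingleton ℤ ℤ (phiL (toL σ.1))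

lemma phiZ_bb {σ : Finset E7} (h : Kd σ) (hc : σ.card = 5) : phiZ (bb 5 σ) = phiL (toL σ) := by
  rw [bb, bas_eq ⟨h, hc⟩, phiZ, Finsupp.lsum_single]
  simp

lemma phiZ_S {l : List ℕ} (h : Vl 5 l) : phiZ (bb 5 (S l)) = phiL l := by
  rw [phiZ_bb (h.Kd (by norm_num)) h.card, toL_S h.1]

lemma phiZ_sum (L : List (Bool × List ℕ)) (h : ∀ p ∈ L, Vl 5 p.2) :
    phiZ (L.map fun p => sg p.1 • bb 5 (S p.2)).sum = sval L := by
  induction L with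
  | nil => simp [sval]
  | cons p t ih =>
    rw [List.map_cons, List.sum_cons, map_add, ih fun q hq => h q (List.mem_cons_of_mem _ hq),
      map_smul, phiZ_S (h p List.mem_cons_self), sval]
    cases p.1 <;> simp [sg]

lemma phiZ_dd {l : List ℕ} (h : Vl 6 l) : phiZ (dd 5 (bb 6 (S l))) = sval (bdv l) := by
  rw [dd_bdv h (by norm_num), phiZ_sum]
  intro p hp
  exact bdv_mem h hp

lemma toL_Vl {c : ℕ} (hc : c ≤ 7) {σ : Finset E7} (h : Kd σ) (hcard : σ.card = c) :
    Vl c (toL σ) := by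
  have hl := toL_length h.1
  refine ⟨toL_good σ, ?_, by omega⟩
  rw [← (toL_good σ).Kd_iff (by omega), S_toL h.1]
  exact h

/-- decoding of masks -/
def decm (n : ℕ) : Finset E7 := ((Finset.range 21).filter fun k => n.testBit k = true).image e

lemma mask_testBit (l : List ℕ) (k : ℕ) : (mask l).testBit k = true ↔ k ∈ l := by
  induction l with
  | nil => simp [mask]
  | cons a t ih =>
    have : mask (a :: t) = 2 ^ a ||| mask t := rfl
    rw [this, Nat.testBit_or, Bool.or_eq_true, ih, Nat.testBit_two_pow, List.mem_cons,
      decide_eq_true_eq]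
    tauto

lemma decm_mask {l : List ℕ} (h : ∀ k ∈ l, k < 21) : decm (mask l) = S l := by
  ext p
  rw [mem_S, decm, Finset.mem_image]
  constructor
  · rintro ⟨k, hk, rfl⟩
    exact ⟨k, (mask_testBit l k).mp (Finset.mem_filter.mp hk).2, rfl⟩
  · rintro ⟨k, hk, rfl⟩
    exact ⟨k, Finset.mem_filter.mpr ⟨Finset.mem_range.mpr (h k hk), (mask_testBit l k).mpr hk⟩, rfl⟩

/-- chain of a mask -/
noncomputable def bm (n : ℕ) : D 5 := bb 5 (decm n)

lemma bm_mask {l : List ℕ} (h : ∀ k ∈ l, k < 21) : bm (mask l) = bb 5 (S l) := by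
  rw [bm, decm_mask h]

lemma forceN_eq {α : Type} (n : ℕ) (K : ℕ → α) : forceN n K = K n := by
  cases n <;> rfl

lemma forceZ_eq {α : Type} (z : ℤ) (K : ℤ → α) : forceZ z K = K z := by
  cases z with
  | ofNat n => exact forceN_eq n fun n => K (Int.ofNat n)
  | negSucc n => exact forceN_eq n fun n => K (Int.negSucc n)

/-- value of a tree -/
noncomputable def Tr.vl : Tr → D 5
  | .nil => 0
  | .node l k v r => l.vl + v • bm k + r.vl

lemma Tr.allz_vl : ∀ t : Tr, t.allz = true → t.vl = 0
  | .nil, _ => rfl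
  | .node l k v r, h => by
    rw [Tr.allz, Bool.and_eq_true, Bool.and_eq_true, Nat.beq_eq, Int.natAbs_eq_zero] at h
    rw [Tr.vl, l.allz_vl h.1.2, r.allz_vl h.2, h.1.1]
    simp

lemma Tr.add_sound : ∀ (t : Tr) (k : ℕ) (v : ℤ) (K : Tr → Bool), t.add k v K = true →
    ∃ t' : Tr, t'.vl = t.vl + v • bm k ∧ K t' = true
  | .nil, k, v, K, h => ⟨.node .nil k v .nil, by simp [Tr.vl], h⟩
  | .node l a x r, k, v, K, h => by
    rw [Tr.add] at h
    by_cases h1 : Nat.blt k a = true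
    · rw [h1, cond_true] at h
      obtain ⟨t', h2, h3⟩ := l.add_sound k v _ h
      refine ⟨_, ?_, h3⟩
      rw [Tr.vl, Tr.vl, h2]; abel
    · rw [Bool.not_eq_true] at h1
      rw [h1, cond_false] at h
      by_cases h2 : Nat.beq k a = true
      · rw [h2, cond_true, forceZ_eq] at h
        refine ⟨_, ?_, h⟩
        rw [Nat.beq_eq] at h2
        rw [Tr.vl, Tr.vl, h2, add_smul]; abel
      · rw [Bool.not_eq_true] at h2
        rw [h2, cond_false] at h
        obtain ⟨t', h2, h3⟩ := r.add_sound k v _ h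
        refine ⟨_, ?_, h3⟩
        rw [Tr.vl, Tr.vl, h2]; abel

lemma addAll_sound (c : ℤ) (K : Tr → Bool) : ∀ (L : List (Bool × List ℕ)) (t : Tr),
    (∀ p ∈ L, ∀ k ∈ p.2, k < 21) → addAll c K L t = true →
    ∃ t' : Tr, t'.vl = t.vl + c • (L.map fun p => sg p.1 • bb 5 (S p.2)).sum ∧ K t' = true
  | [], t, _, h => ⟨t, by simp, h⟩
  | p :: ps, t, hL, h => by
    rw [addAll, forceN_eq, forceZ_eq] at h
    obtain ⟨t1, h1, h2⟩ := Tr.add_sound _ _ _ _ h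
    obtain ⟨t2, h3, h4⟩ := addAll_sound c K ps t1 (fun q hq => hL q (List.mem_cons_of_mem _ hq)) h2
    refine ⟨t2, ?_, h4⟩
    rw [h3, h1, bm_mask (hL p List.mem_cons_self), List.map_cons, List.sum_cons, smul_add,
      ← add_assoc, smul_smul]
    congr 3
    cases p.1 <;> simp [sg]

lemma decL_length : ∀ c n : ℕ, (decL c n).length = c
  | 0, _ => rfl
  | c + 1, n => by rw [decL, List.length_cons, decL_length]

lemma decL_Vl {n : ℕ} (h1 : srt (decL 6 n) = true) (h2 : vldN (wsum (decL 6 n)) = true) :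
    Vl 6 (decL 6 n) := ⟨good_of_srt _ h1, h2, decL_length _ _⟩

lemma uloop_sound (K : Tr → Bool) : ∀ (L : List ℕ) (t : Tr), uloop K L t = true →
    ∃ t' : Tr, t'.vl - t.vl ∈ LinearMap.range (dd 5) ∧ K t' = true
  | [], t, h => ⟨t, by simp, h⟩
  | n :: ns, t, h => by
    rw [uloop, Bool.and_eq_true, Bool.and_eq_true] at h
    obtain ⟨⟨h1, h2⟩, h3⟩ := h
    have hv := decL_Vl h1 h2
    obtain ⟨t1, h4, h5⟩ := addAll_sound _ _ _ _ (fun p hp => (bdv_mem hv hp).1.2) h3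
    obtain ⟨t2, h6, h7⟩ := uloop_sound K ns t1 h5
    refine ⟨t2, ?_, h7⟩
    rw [← dd_bdv hv (by norm_num)] at h4
    have : t2.vl - t.vl = (t2.vl - t1.vl) +
        Int.subNatNat (Nat.shiftRight n 30) 64 • dd 5 (bb 6 (S (decL 6 n))) := by
      rw [h4]; abel
    rw [this]
    exact Submodule.add_mem _ h6 (Submodule.smul_mem _ _ ⟨_, rfl⟩)

lemma uloops_sound (K : Tr → Bool) : ∀ (L : List (List ℕ)) (t : Tr), uloops K L t = true →
    ∃ t' : Tr, t'.vl - t.vl ∈ LinearMap.range (dd 5) ∧ K t' = true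
  | [], t, h => ⟨t, by simp, h⟩
  | n :: ns, t, h => by
    rw [uloops] at h
    obtain ⟨t1, h4, h5⟩ := uloop_sound _ _ _ h
    obtain ⟨t2, h6, h7⟩ := uloops_sound K ns t1 h5
    refine ⟨t2, ?_, h7⟩
    have : t2.vl - t.vl = (t2.vl - t1.vl) + (t1.vl - t.vl) := by abel
    rw [this]
    exact Submodule.add_mem _ h6 h4

/-- all keys satisfy a property -/
def St.All (P : ℕ → Prop) : St → Prop
  | .nil => True
  | .node l k r => l.All P ∧ P k ∧ r.All P

lemma St.has_sound {P : ℕ → Prop} : ∀ (t : St) (k : ℕ), t.All P → t.has k = true → P k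
  | .nil, k, _, h => by rw [St.has] at h; exact absurd h (by decide)
  | .node l a r, k, hP, h => by
    obtain ⟨p1, p2, p3⟩ := hP
    rw [St.has] at h
    by_cases h1 : Nat.blt k a = true
    · rw [h1, cond_true] at h
      exact l.has_sound k p1 h
    · rw [Bool.not_eq_true] at h1
      rw [h1, cond_false] at h
      by_cases h2 : Nat.beq k a = true
      · rw [Nat.beq_eq] at h2
        rw [h2]; exact p2
      · rw [Bool.not_eq_true] at h2
        rw [h2, cond_false] at h
        exact r.has_sound k p3 h

lemma St.add_sound {P : ℕ → Prop} : ∀ (t : St) (k : ℕ) (K : St → Bool), t.All P → P k →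
    t.add k K = true → ∃ t' : St, t'.All P ∧ K t' = true
  | .nil, k, K, _, hk, h => ⟨.node .nil k .nil, ⟨trivial, hk, trivial⟩, h⟩
  | .node l a r, k, K, hP, hk, h => by
    obtain ⟨p1, p2, p3⟩ := hP
    rw [St.add] at h
    by_cases h1 : Nat.blt k a = true
    · rw [h1, cond_true] at h
      obtain ⟨t', h2, h3⟩ := l.add_sound k _ p1 hk h
      exact ⟨.node t' a r, ⟨h2, p2, p3⟩, h3⟩
    · rw [Bool.not_eq_true] at h1
      rw [h1, cond_false] at h
      by_cases h2 : Nat.beq k a = true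
      · rw [h2, cond_true] at h
        exact ⟨.node l a r, ⟨p1, p2, p3⟩, h⟩
      · rw [Bool.not_eq_true] at h2
        rw [h2, cond_false] at h
        obtain ⟨t', h2, h3⟩ := r.add_sound k _ p3 hk h
        exact ⟨.node l a t', ⟨p1, p2, h2⟩, h3⟩

end BDP

namespace BDP

open MatchPaper

section generic
variable {V : Type*} [DecidableEq V] (rank : V → ℕ) (f : V → V)

/-- number of inversions -/
def inv (σ : Finset V) : ℕ :=
  ∑ a ∈ σ, ∑ b ∈ σ, if rank a < rank b ∧ rank (f b) < rank (f a) then 1 else 0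

lemma mapSign_eq (σ : Finset V) : mapSign rank rank f σ = (-1) ^ inv rank f σ := by
  rw [mapSign, inv, Finset.card_filter, Finset.sum_product]

lemma inv_insert {τ : Finset V} {v : V} (hv : v ∉ τ) : inv rank f (insert v τ) = inv rank f τ +
    (∑ b ∈ τ, if rank v < rank b ∧ rank (f b) < rank (f v) then 1 else 0) +
    (∑ a ∈ τ, if rank a < rank v ∧ rank (f v) < rank (f a) then 1 else 0) := by
  unfold inv
  rw [Finset.sum_insert hv, Finset.sum_insert hv]
  have : ∀ a ∈ τ, (∑ b ∈ insert v τ,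
      if rank a < rank b ∧ rank (f b) < rank (f a) then 1 else 0) =
      (if rank a < rank v ∧ rank (f v) < rank (f a) then 1 else 0) +
      ∑ b ∈ τ, if rank a < rank b ∧ rank (f b) < rank (f a) then 1 else 0 :=
    fun a _ => Finset.sum_insert hv
  rw [Finset.sum_congr rfl this, Finset.sum_add_distrib]
  simp only [lt_irrefl, false_and, if_false]
  omega

lemma sign_key (hr : Function.Injective rank) {τ : Finset V} {v : V} (hv : v ∉ τ)
    (hinj : Set.InjOn f (insert v τ : Finset V)) :
    mapSign rank rank f (insert v τ) * eps rank ((insert v τ).image f) (f v) =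
      eps rank (insert v τ) v * mapSign rank rank f τ := by
  have h1 : (((insert v τ).image f).filter fun u => rank u < rank (f v)).card =
      ∑ a ∈ τ, if rank (f a) < rank (f v) then 1 else 0 := by
    rw [Finset.filter_image, Finset.card_image_of_injOn, Finset.card_filter, Finset.sum_insert hv]
    · simp
    · intro a ha b hb hab
      exact hinj (Finset.mem_filter.mp ha).1 (Finset.mem_filter.mp hb).1 hab
  have h2 : ((insert v τ).filter fun u => rank u < rank v).card =
      ∑ a ∈ τ, if rank a < rank v then 1 else 0 := by
    rw [Finset.card_filter, Finset.sum_insert hv]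
    simp
  rw [mapSign_eq, mapSign_eq, eps, eps, h1, h2, inv_insert rank f hv, ← pow_add, ← pow_add]
  set A := ∑ b ∈ τ, if rank v < rank b ∧ rank (f b) < rank (f v) then 1 else 0 with hA
  set B := ∑ a ∈ τ, if rank a < rank v ∧ rank (f v) < rank (f a) then 1 else 0 with hB
  set C := ∑ a ∈ τ, if rank a < rank v ∧ rank (f a) < rank (f v) then 1 else 0 with hC
  have h3 : (∑ a ∈ τ, if rank (f a) < rank (f v) then 1 else 0) = C + A := by
    rw [hC, hA, ← Finset.sum_add_distrib]
    apply Finset.sum_congr rfl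
    intro a ha
    have hne : rank a ≠ rank v := fun h => hv (hr h ▸ ha)
    split_ifs <;> omega
  have h4 : (∑ a ∈ τ, if rank a < rank v then 1 else 0) = C + B := by
    rw [hC, hB, ← Finset.sum_add_distrib]
    apply Finset.sum_congr rfl
    intro a ha
    have hne : rank (f a) ≠ rank (f v) := fun h => hv
      (hinj (Finset.mem_coe.mpr (Finset.mem_insert_of_mem ha))
        (Finset.mem_coe.mpr (Finset.mem_insert_self v τ)) (hr h) ▸ ha)
    split_ifs <;> omega
  rw [h3, h4, show inv rank f τ + A + B + (C + A) = 2 * A + (C + B + inv rank f τ) by ring,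
    pow_add, pow_mul]
  simp

variable {K : Finset V → Prop}

lemma chainMap_bas {c : ℕ} {σ : Finset V} (h : K σ) (hc : σ.card = c) :
    chainMap ℤ rank rank f K K c (basisOrZero ℤ K c σ) =
      mapSign rank rank f σ • basisOrZero ℤ K c (σ.image f) := by
  rw [bas_eq ⟨h, hc⟩]
  unfold chainMap
  rw [Finsupp.lsum_single]
  simp

lemma chainMap_bdry (hr : Function.Injective rank)
    (hinj : ∀ σ, K σ → Set.InjOn f σ)
    (hK : ∀ σ τ, K σ → τ ⊆ σ → (K (τ.image f) ↔ K τ)) (c : ℕ) (x : SChain ℤ K (c + 1)) :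
    bdry ℤ rank K c (chainMap ℤ rank rank f K K (c + 1) x) =
      chainMap ℤ rank rank f K K c (bdry ℤ rank K c x) := by
  suffices h : bdry ℤ rank K c ∘ₗ chainMap ℤ rank rank f K K (c + 1) =
      chainMap ℤ rank rank f K K c ∘ₗ bdry ℤ rank K c from LinearMap.congr_fun h x
  apply hom_ext
  intro σ hσ hc
  have hi := hinj σ hσ
  rw [LinearMap.comp_apply, LinearMap.comp_apply, chainMap_bas rank f hσ hc, map_smul,
    bdry_bas rank ((hK σ σ hσ (Finset.Subset.refl _)).mpr hσ)
      (by rw [Finset.card_image_of_injOn hi, hc]),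
    bdry_bas rank hσ hc, map_sum, Finset.sum_image hi, Finset.smul_sum]
  apply Finset.sum_congr rfl
  intro v hv
  have him : (σ.image f).erase (f v) = (σ.erase v).image f := by
    ext u
    simp only [Finset.mem_erase, Finset.mem_image]
    constructor
    · rintro ⟨h1, a, ha, rfl⟩
      exact ⟨a, ⟨fun h => h1 (by rw [h]), ha⟩, rfl⟩
    · rintro ⟨a, ⟨h1, ha⟩, rfl⟩
      exact ⟨fun h => h1 (hi ha hv h), a, ha, rfl⟩
  rw [him, map_smul]
  by_cases hk : K (σ.erase v)
  · rw [chainMap_bas rank f hk (by rw [Finset.card_erase_of_mem hv, hc]; rfl), smul_smul, smul_smul]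
    congr 1
    have := sign_key rank f hr (Finset.notMem_erase v σ) (by rwa [Finset.insert_erase hv])
    rwa [Finset.insert_erase hv] at this
  · rw [bas_zero hk, bas_zero (mt (hK σ _ hσ (Finset.erase_subset _ _)).mp hk)]
    simp

end generic

lemma emap_lt (x : Equiv.Perm (Fin 7)) {p : E7} (h : p.1 < p.2) : (emap x p).1 < (emap x p).2 := by
  have hne : x p.1 ≠ x p.2 := fun h' => h.ne (x.injective h')
  simpa [emap, eq_comm] using hne

lemma ct_emap (x : Equiv.Perm (Fin 7)) (p : E7) (j : Fin 7) : ct (emap x p) (x j) = ct p j := by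
  unfold ct emap
  rcases le_total (x p.1) (x p.2) with h | h
  · simp [h]
  · simp [h, add_comm]

lemma emap_inj (x : Equiv.Perm (Fin 7)) {p q : E7} (hp : p.1 < p.2) (hq : q.1 < q.2)
    (h : emap x p = emap x q) : p = q := by
  have h1 : ∀ j, ct p j = ct q j := fun j => by rw [← ct_emap x, h, ct_emap]
  have a1 := h1 p.1
  have a2 := h1 p.2
  have b1 := h1 q.1
  have b2 := h1 q.2
  obtain ⟨p1, p2⟩ := p
  obtain ⟨q1, q2⟩ := q
  simp only [ct, if_true] at *
  have hp' := hp.ne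
  have hq' := hq.ne
  by_cases c1 : q1 = p1
  · subst c1
    by_cases c2 : q2 = p2
    · rw [c2]
    · simp [c2, hp'] at a2
  · by_cases c2 : q2 = p1
    · subst c2
      by_cases c3 : q1 = p2
      · subst c3
        exact absurd hp (not_lt.mpr hq.le)
      · simp [c3, hp'] at a2
    · simp [c1, c2] at a1

lemma Kd_image (x : Equiv.Perm (Fin 7)) {τ : Finset E7} (h : ∀ p ∈ τ, p.1 < p.2) :
    Kd (τ.image (emap x)) ↔ Kd τ := by
  have hi : Set.InjOn (emap x) τ := fun p hp q hq hpq => emap_inj x (h p hp) (h q hq) hpq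
  have hd : ∀ j, degB (τ.image (emap x)) (x j) = degB τ j := by
    intro j
    rw [degB_eq, degB_eq, Finset.sum_image hi]
    exact Finset.sum_congr rfl fun p _ => ct_emap x p j
  constructor
  · rintro ⟨_, h2⟩
    exact ⟨h, fun j => by rw [← hd]; exact h2 _⟩
  · rintro ⟨_, h2⟩
    refine ⟨?_, fun j => ?_⟩
    · intro q hq
      obtain ⟨p, hp, rfl⟩ := Finset.mem_image.mp hq
      exact emap_lt x (h p hp)
    · have := hd (x.symm j)
      rw [Equiv.apply_symm_apply] at this
      rw [this]; exact h2 _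

/-- action of permutations on chains -/
noncomputable def T (x : Equiv.Perm (Fin 7)) (c : ℕ) : D c →ₗ[ℤ] D c :=
  chainMap ℤ (rankP 7) (rankP 7) (emap x) Kd Kd c

lemma T_dd (x : Equiv.Perm (Fin 7)) (c : ℕ) (y : D (c + 1)) : dd c (T x (c + 1) y) =
    T x c (dd c y) := by
  apply chainMap_bdry (rankP 7) (emap x) rankP_inj
  · intro σ hσ p hp q hq h
    exact emap_inj x (hσ.1 p hp) (hσ.1 q hq) h
  · intro σ τ hσ hs
    exact Kd_image x fun p hp => hσ.1 p (hs hp)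

lemma T_range (x : Equiv.Perm (Fin 7)) (c : ℕ) {y : D c} (h : y ∈ LinearMap.range (dd c)) :
    T x c y ∈ LinearMap.range (dd c) := by
  obtain ⟨z, rfl⟩ := h
  exact ⟨T x (c + 1) z, T_dd x c z⟩

lemma T_bb (x : Equiv.Perm (Fin 7)) {c : ℕ} {σ : Finset E7} (h : Kd σ) (hc : σ.card = c) :
    ∃ s : ℤ, s * s = 1 ∧ T x c (bb c σ) = s • bb c (σ.image (emap x)) := by
  refine ⟨mapSign (rankP 7) (rankP 7) (emap x) σ, ?_, chainMap_bas (rankP 7) (emap x) h hc⟩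
  rw [mapSign_eq, ← pow_add, ← two_mul, pow_mul]
  simp

/-- the basic faces -/
def FF (p : E7) : Finset E7 := {(0, 1), (1, 2), (3, 4), p, (5, 6)}

lemma S_F1 : S [0, 6, 15, 18, 20] = FF (4, 5) := by decide
lemma S_F2 : S [0, 6, 15, 16, 20] = FF (3, 5) := by decide
lemma FF_s1 : (FF (4, 5)).image (emap (Equiv.swap 5 6)) = FF (4, 6) := by decide +kernel
lemma FF_s2 : (FF (3, 5)).image (emap (Equiv.swap 5 6)) = FF (3, 6) := by decide +kernel
lemma FF_y1 : (FF (4, 5)).image (emap (Equiv.swap 3 5 * Equiv.swap 4 6)) = FF (3, 6) := by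
  decide +kernel
lemma FF_y2 : (FF (3, 5)).image (emap (Equiv.swap 3 5 * Equiv.swap 4 6)) = FF (3, 5) := by
  decide +kernel

lemma emap_mul (x y : Equiv.Perm (Fin 7)) (σ : Finset E7) :
    σ.image (emap (x * y)) = (σ.image (emap y)).image (emap x) := by
  rw [Finset.image_image]
  apply Finset.image_congr
  intro p _
  simp only [emap, Function.comp_apply, Equiv.Perm.mul_apply]
  rcases le_total (y p.1) (y p.2) with h | h
  · simp [h]
  · simp [h, min_comm, max_comm]

lemma F1_Vl : Vl 5 [0, 6, 15, 18, 20] := ⟨good_of_srt _ (by decide +kernel), by decide +kernel, rfl⟩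
lemma F2_Vl : Vl 5 [0, 6, 15, 16, 20] := ⟨good_of_srt _ (by decide +kernel), by decide +kernel, rfl⟩

/-- membership of the image of a basic face -/
def Mem (N : Submodule ℤ (D 5)) (x : Equiv.Perm (Fin 7)) (p : E7) : Prop :=
  bb 5 ((FF p).image (emap x)) ∈ N

lemma Mem12 {N : Submodule ℤ (D 5)} (hN : LinearMap.range (dd 5) ≤ N)
    (hu : bb 5 (FF (4, 5)) - bb 5 (FF (3, 5)) ∈ LinearMap.range (dd 5))
    (x : Equiv.Perm (Fin 7)) : Mem N x (4, 5) ↔ Mem N x (3, 5) := by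
  have h := hN (T_range x 5 hu)
  have k1 := F1_Vl.Kd (by norm_num)
  have k2 := F2_Vl.Kd (by norm_num)
  have c1 := F1_Vl.card
  have c2 := F2_Vl.card
  rw [S_F1] at k1 c1
  rw [S_F2] at k2 c2
  obtain ⟨s1, h1, e1⟩ := T_bb x k1 c1
  obtain ⟨s2, h2, e2⟩ := T_bb x k2 c2
  rw [map_sub, e1, e2] at h
  unfold Mem
  constructor
  · intro hm
    have h3 := N.sub_mem (N.smul_mem s1 hm) h
    rw [sub_sub_cancel] at h3
    have h4 := N.smul_mem s2 h3
    rwa [smul_smul, h2, one_smul] at h4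
  · intro hm
    have h3 := N.add_mem h (N.smul_mem s2 hm)
    rw [sub_add_cancel] at h3
    have h4 := N.smul_mem s1 h3
    rwa [smul_smul, h1, one_smul] at h4

lemma four {a b c d : Prop} (h : a ∨ b ∨ c ∨ d) (h1 : a ↔ b) (h2 : c ↔ d) (h3 : d ↔ b) :
    a ∧ b ∧ c ∧ d := by tauto

lemma Mem_all {N : Submodule ℤ (D 5)} (hN : LinearMap.range (dd 5) ≤ N)
    (hu : bb 5 (FF (4, 5)) - bb 5 (FF (3, 5)) ∈ LinearMap.range (dd 5))
    (x : Equiv.Perm (Fin 7)) (h : Mem N x (4, 5) ∨ Mem N x (3, 5) ∨ Mem N x (4, 6) ∨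
    Mem N x (3, 6)) : Mem N x (4, 5) ∧ Mem N x (3, 5) ∧ Mem N x (4, 6) ∧ Mem N x (3, 6) := by
  have h1 := Mem12 hN hu x
  have h2 := Mem12 hN hu (x * Equiv.swap 5 6)
  have h3 := Mem12 hN hu (x * (Equiv.swap 3 5 * Equiv.swap 4 6))
  unfold Mem at h h1 h2 h3 ⊢
  rw [emap_mul, emap_mul, FF_s1, FF_s2] at h2
  rw [emap_mul x, emap_mul x, FF_y1, FF_y2] at h3
  exact four h h1 h2 h3

end BDP

namespace BDP

open MatchPaper

set_option maxRecDepth 100000 in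
theorem c4 : trav (fun _ => 1) eds 4 0 [] = 315 := by decide +kernel

set_option maxRecDepth 100000 in
theorem c5 : trav (fun _ => 1) eds 5 0 [] = 2625 := by decide +kernel

set_option maxRecDepth 100000 in
theorem c6 : trav (fun _ => 1) eds 6 0 [] = 3507 := by decide +kernel

set_option maxRecDepth 100000 in
theorem c7 : trav (fun _ => 1) eds 7 0 [] = 465 := by decide +kernel

theorem k6 : trav chk6 eds 6 0 [] = 0 := by decide +kernel

theorem k4 : trav chk4 eds 4 0 [] = 0 := by decide +kernel

theorem kr : (srt rho0 && vldN (wsum rho0) && Nat.beq (Int.natAbs (sval (bdv rho0))) 5) = true := by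
  decide +kernel

theorem ks : (srt sig0 && vldN (wsum sig0)) = true ∧ phiL sig0 = 1 := by decide +kernel

theorem ku : uloops Tr.allz udat (.node (.node .nil (mask [0, 6, 15, 16, 20]) 1 .nil)
    (mask [0, 6, 15, 18, 20]) (-1) .nil) = true := by decide +kernel

theorem kx : xloops (fun t => sloops cover sdat t) xdat (.node .nil (mask sig0) .nil) = true := by
  decide +kernel

end BDP

namespace BDP

open MatchPaper

lemma leq_eq : ∀ l m : List ℕ, leq l m = true → l = m
  | [], [], _ => rfl
  | [], _ :: _, h => by rw [leq] at h; exact absurd h (by decide); all_goals simp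
  | _ :: _, [], h => by rw [leq] at h; exact absurd h (by decide); all_goals simp
  | a :: s, b :: t, h => by
    rw [leq, Bool.and_eq_true, Nat.beq_eq] at h
    rw [h.1, leq_eq s t h.2]

lemma isOne_eq (l : List ℕ) (L : List (Bool × List ℕ)) (h : isOne l L = true) :
    ∃ b, L = [(b, l)] := by
  match L, h with
  | [], h => exact absurd h (by simp [isOne])
  | [p], h =>
    rw [isOne] at h
    have := leq_eq _ _ h
    exact ⟨p.1, by rw [← this]⟩
  | _ :: _ :: _, h => exact absurd h (by simp [isOne])

lemma cond_zero {b : Bool} (h : (bif b then 0 else 1) = 0) : b = true := by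
  cases b
  · exact absurd h (by decide)
  · rfl

lemma glf_spec {τ : Finset E7} (h : Kd τ) (hc : τ.card = 4) :
    Vl 5 (glf (toL τ)) ∧ (∃ b, bdv (glf (toL τ)) = [(b, toL τ)]) ∧ phiL (glf (toL τ)) = 0 := by
  have h1 : chk4 (toL τ) = 0 := trav_face (by norm_num) k4 h hc
  have h2 := cond_zero h1
  rw [Bool.and_eq_true, Bool.and_eq_true, Bool.and_eq_true, Bool.and_eq_true, Nat.beq_eq, Nat.beq_eq,
    Int.natAbs_eq_zero] at h2
  obtain ⟨⟨⟨⟨a1, a2⟩, a3⟩, a4⟩, a5⟩ := h2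
  exact ⟨⟨good_of_srt _ a1, a2, a4⟩, isOne_eq _ _ a3, a5⟩

/-- sign of a singleton -/
def hsg (L : List (Bool × List ℕ)) : ℤ := match L with
  | [p] => sg p.1
  | _ => 0

lemma hsg_one (p : Bool × List ℕ) : hsg [p] = sg p.1 := rfl

/-- sign of the chosen extension -/
def gsg (l : List ℕ) : ℤ := hsg (bdv (glf l))

/-- the section of the boundary map -/
noncomputable def gG : D 4 →ₗ[ℤ] D 5 :=
  Finsupp.lsum ℤ fun τ => LinearMap.toSpanSingleton ℤ _
    (gsg (toL τ.1) • bb 5 (S (glf (toL τ.1))))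

lemma gG_bb {τ : Finset E7} (h : Kd τ) (hc : τ.card = 4) :
    gG (bb 4 τ) = gsg (toL τ) • bb 5 (S (glf (toL τ))) := by
  rw [bb, bas_eq ⟨h, hc⟩, gG, Finsupp.lsum_single]
  simp

lemma sg_sq (b : Bool) : sg b * sg b = 1 := by cases b <;> rfl

lemma gsg_eq {l : List ℕ} {b : Bool} (h : bdv (glf l) = [(b, l)]) : gsg l = sg b := by
  unfold gsg
  rw [h]
  exact hsg_one _

lemma dd_gG (y : D 4) : dd 4 (gG y) = y := by
  suffices h : dd 4 ∘ₗ gG = LinearMap.id from LinearMap.congr_fun h y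
  apply hom_ext
  intro τ h hc
  obtain ⟨h1, ⟨b, h2⟩, h3⟩ := glf_spec h hc
  change dd 4 (gG (bb 4 τ)) = bb 4 τ
  rw [gG_bb h hc, map_smul, dd_bdv h1 (by norm_num), gsg_eq h2, h2]
  simp only [List.map_cons, List.map_nil, List.sum_cons, List.sum_nil, add_zero]
  rw [smul_smul, sg_sq, one_smul, S_toL h.1]

lemma phiZ_gG (y : D 4) : phiZ (gG y) = 0 := by
  suffices h : phiZ ∘ₗ gG = 0 from LinearMap.congr_fun h y
  apply hom_ext
  intro τ h hc
  obtain ⟨h1, ⟨b, h2⟩, h3⟩ := glf_spec h hc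
  change phiZ (gG (bb 4 τ)) = 0
  rw [gG_bb h hc, map_smul, phiZ_S h1, h3, smul_zero]

/-- the cocycle mod five -/
noncomputable def phiM : D 5 →ₗ[ℤ] ZMod 5 := (Int.castAddHom (ZMod 5)).toIntLinearMap ∘ₗ phiZ

lemma phiM_apply (z : D 5) : phiM z = ((phiZ z : ℤ) : ZMod 5) := rfl

lemma phiM_zero (z : D 5) : phiM z = 0 ↔ (5 : ℤ) ∣ phiZ z := by
  rw [phiM_apply, ZMod.intCast_zmod_eq_zero_iff_dvd]
  rfl

lemma phiM_dd (y : D 6) : phiM (dd 5 y) = 0 := by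
  suffices h : phiM ∘ₗ dd 5 = 0 from LinearMap.congr_fun h y
  apply hom_ext
  intro σ h hc
  have h1 : chk6 (toL σ) = 0 := trav_face (by norm_num) k6 h hc
  have h2 := cond_zero h1
  rw [Nat.beq_eq] at h2
  change phiM (dd 5 (bb 6 σ)) = 0
  rw [phiM_zero, ← S_toL h.1, phiZ_dd (toL_Vl (by norm_num) h hc)]
  omega

/-- boundaries together with the image of the section -/
noncomputable def NN : Submodule ℤ (D 5) := LinearMap.range (dd 5) ⊔ LinearMap.range gG

lemma NN_dd (y : D 6) : dd 5 y ∈ NN := Submodule.mem_sup_left ⟨y, rfl⟩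

lemma NN_phi {z : D 5} (h : z ∈ NN) : (5 : ℤ) ∣ phiZ z := by
  obtain ⟨a, ⟨y, rfl⟩, b, ⟨t, rfl⟩, rfl⟩ := Submodule.mem_sup.mp h
  rw [map_add, phiZ_gG, add_zero, ← phiM_zero]
  exact phiM_dd y

lemma NN_glf {τ : Finset E7} (h : Kd τ) (hc : τ.card = 4) : bb 5 (S (glf (toL τ))) ∈ NN := by
  obtain ⟨h1, ⟨b, h2⟩, h3⟩ := glf_spec h hc
  have h4 : gG (gsg (toL τ) • bb 4 τ) ∈ NN := Submodule.mem_sup_right ⟨_, rfl⟩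
  rwa [map_smul, gG_bb h hc, smul_smul, gsg_eq h2, sg_sq, one_smul] at h4

lemma pdec_val (n : ℕ) : pdec n = 0 ∨ pdec n = 1 ∨ pdec n = -1 := by
  unfold pdec
  split <;> simp

lemma phiL_val (l : List ℕ) : phiL l = 0 ∨ phiL l = 1 ∨ phiL l = -1 := by
  unfold phiL
  split
  · exact pdec_val _
  · exact Or.inl rfl

lemma phiZ_val (σ : Finset E7) : phiZ (bb 5 σ) = 0 ∨ phiZ (bb 5 σ) = 1 ∨ phiZ (bb 5 σ) = -1 := by
  by_cases h : Kd σ ∧ σ.card = 5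
  · rw [phiZ_bb h.1 h.2]; exact phiL_val _
  · left
    have : bb 5 σ = 0 := by
      unfold bb basisOrZero
      rw [dif_neg h]
    rw [this, map_zero]

/-- the special chain -/
noncomputable def s0 : D 5 := bb 5 (S sig0)

lemma sig0_Vl : Vl 5 sig0 := by
  have h := ks.1
  rw [Bool.and_eq_true] at h
  exact ⟨good_of_srt _ h.1, h.2, rfl⟩

lemma phiZ_s0 : phiZ s0 = 1 := by
  rw [s0, phiZ_S sig0_Vl]; exact ks.2

/-- deviation -/
noncomputable def dev : D 5 →ₗ[ℤ] D 5 := LinearMap.id - LinearMap.toSpanSingleton ℤ _ s0 ∘ₗ phiZ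

lemma dev_apply (z : D 5) : dev z = z - phiZ z • s0 := by
  simp [dev]

lemma dev_of_mem {σ : Finset E7} (h : bb 5 σ ∈ NN) : dev (bb 5 σ) ∈ NN := by
  have h1 := NN_phi h
  have h2 : phiZ (bb 5 σ) = 0 := by
    rcases phiZ_val σ with h3 | h3 | h3
    · exact h3
    · rw [h3] at h1; exact absurd h1 (by decide)
    · rw [h3] at h1; exact absurd h1 (by decide)
  rw [dev_apply, h2, zero_smul, sub_zero]
  exact h

/-- the invariant -/
def Inv (n : ℕ) : Prop := dev (bm n) ∈ NN

lemma hu : bb 5 (FF (4, 5)) - bb 5 (FF (3, 5)) ∈ LinearMap.range (dd 5) := by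
  obtain ⟨t, h1, h2⟩ := uloops_sound _ _ _ ku
  rw [t.allz_vl h2] at h1
  have h3 : Tr.vl (.node (.node .nil (mask [0, 6, 15, 16, 20]) 1 .nil)
    (mask [0, 6, 15, 18, 20]) (-1) .nil) = bb 5 (FF (3, 5)) - bb 5 (FF (4, 5)) := by
    have hnil : Tr.nil.vl = 0 := rfl
    rw [Tr.vl, Tr.vl, Tr.vl, bm_mask F1_Vl.1.2, bm_mask F2_Vl.1.2, S_F1, S_F2]
    simp only [hnil, zero_add, add_zero, one_smul, neg_smul]
    rw [sub_eq_add_neg]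
  rw [h3, zero_sub, neg_sub] at h1
  exact h1

lemma insS_perm (k : ℕ) : ∀ l : List ℕ, (insS k l).Perm (k :: l)
  | [] => List.Perm.refl _
  | a :: t => by
    rw [insS]
    cases Nat.blt k a
    · rw [cond_false]
      exact ((insS_perm k t).cons a).trans (List.Perm.swap k a t)
    · exact List.Perm.refl _

lemma pok_perm {n : ℕ} (h : pok n = true) :
    ∃ x : Equiv.Perm (Fin 7), ∀ i : Fin 7, (x i).val = pg n i.val := by
  have h1 := leq_eq _ _ h
  have h2 : [pg n 0, pg n 1, pg n 2, pg n 3, pg n 4, pg n 5, pg n 6].Perm [0, 1, 2, 3, 4, 5, 6] := by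
    rw [← h1]
    symm
    refine (insS_perm _ _).trans (List.Perm.cons _ ?_)
    refine (insS_perm _ _).trans (List.Perm.cons _ ?_)
    refine (insS_perm _ _).trans (List.Perm.cons _ ?_)
    refine (insS_perm _ _).trans (List.Perm.cons _ ?_)
    refine (insS_perm _ _).trans (List.Perm.cons _ ?_)
    refine (insS_perm _ _).trans (List.Perm.cons _ ?_)
    exact insS_perm _ _
  have h3 : List.ofFn (fun i : Fin 7 => pg n i.val) =
      [pg n 0, pg n 1, pg n 2, pg n 3, pg n 4, pg n 5, pg n 6] := by
    simp [List.ofFn_succ]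
  rw [← h3] at h2
  have hlt : ∀ i : Fin 7, pg n i.val < 7 := by
    intro i
    have h4 : pg n i.val ∈ [0, 1, 2, 3, 4, 5, 6] := h2.subset (List.mem_ofFn.mpr ⟨i, rfl⟩)
    simp at h4
    omega
  have hinj : Function.Injective (fun i : Fin 7 => pg n i.val) :=
    List.nodup_ofFn.mp (h2.nodup_iff.mpr (by decide))
  have hinj2 : Function.Injective (fun i : Fin 7 => (⟨pg n i.val, hlt i⟩ : Fin 7)) := by
    intro i j hij
    exact hinj (congrArg Fin.val hij)
  exact ⟨Equiv.ofBijective _ (Finite.injective_iff_bijective.mp hinj2), fun i => rfl⟩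

lemma e_ix : ∀ i j : Fin 7, i ≠ j → e (ix i j) = (min i j, max i j) ∧ ix i j < 21 := by
  decide +kernel

lemma e_im {n : ℕ} {x : Equiv.Perm (Fin 7)} (hx : ∀ i : Fin 7, (x i).val = pg n i.val)
    (a b : Fin 7) (hab : a ≠ b) :
    e (im n a.val b.val) = emap x (a, b) ∧ im n a.val b.val < 21 := by
  rw [im, ← hx, ← hx]
  exact e_ix _ _ fun h => hab (x.injective h)

lemma fX_spec {n : ℕ} {x : Equiv.Perm (Fin 7)} (hx : ∀ i : Fin 7, (x i).val = pg n i.val)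
    (a b : Fin 7) (hab : a ≠ b) :
    bm (mask (fX n a.val b.val)) = bb 5 ((FF (a, b)).image (emap x)) := by
  obtain ⟨a1, b1⟩ := e_im hx 0 1 (by decide)
  obtain ⟨a2, b2⟩ := e_im hx 1 2 (by decide)
  obtain ⟨a3, b3⟩ := e_im hx 3 4 (by decide)
  obtain ⟨a4, b4⟩ := e_im hx a b hab
  obtain ⟨a5, b5⟩ := e_im hx 5 6 (by decide)
  have hf : fX n a.val b.val = [im n (0 : Fin 7).val (1 : Fin 7).val,
    im n (1 : Fin 7).val (2 : Fin 7).val, im n (3 : Fin 7).val (4 : Fin 7).val,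
    im n a.val b.val, im n (5 : Fin 7).val (6 : Fin 7).val] := rfl
  rw [hf, bm_mask]
  · rw [S_cons, S_cons, S_cons, S_cons, S_cons, S_nil, a1, a2, a3, a4, a5, FF]
    simp only [Finset.image_insert, Finset.image_singleton]
    rfl
  · intro k hk
    simp only [List.mem_cons, List.not_mem_nil, or_false] at hk
    rcases hk with rfl | rfl | rfl | rfl | rfl <;> assumption

lemma xloop_sound (K : St → Bool) : ∀ (L : List ℕ) (t : St), t.All Inv → xloop K L t = true →
    ∃ t' : St, t'.All Inv ∧ K t' = true
  | [], t, ht, h => ⟨t, ht, h⟩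
  | n :: ns, t, ht, h => by
    rw [xloop, forceN_eq, forceN_eq, forceN_eq, forceN_eq, forceN_eq, Bool.and_eq_true,
      Bool.and_eq_true, Bool.and_eq_true, Bool.and_eq_true, Bool.and_eq_true, Bool.or_eq_true,
      Bool.or_eq_true, Bool.or_eq_true, Nat.beq_eq, Nat.beq_eq, Nat.beq_eq, Nat.beq_eq,
      Nat.beq_eq] at h
    obtain ⟨⟨⟨⟨h1, h2⟩, h3⟩, h4⟩, h5, h6⟩ := h
    obtain ⟨x, hx⟩ := pok_perm h1
    have hv : Vl 4 (tauX n) := ⟨good_of_srt _ h2, h3, h4⟩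
    have hg := NN_glf (hv.Kd (by norm_num)) hv.card
    have hg2 := (glf_spec (hv.Kd (by norm_num)) hv.card).1
    rw [toL_S hv.1] at hg hg2
    rw [← bm_mask hg2.1.2] at hg
    have f1 : bm (mask (fX n 4 5)) = _ := fX_spec hx 4 5 (by decide)
    have f2 : bm (mask (fX n 3 5)) = _ := fX_spec hx 3 5 (by decide)
    have f3 : bm (mask (fX n 4 6)) = _ := fX_spec hx 4 6 (by decide)
    have f4 : bm (mask (fX n 3 6)) = _ := fX_spec hx 3 6 (by decide)
    have hm : Mem NN x (4, 5) ∨ Mem NN x (3, 5) ∨ Mem NN x (4, 6) ∨ Mem NN x (3, 6) := by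
      unfold Mem
      rw [← f1, ← f2, ← f3, ← f4]
      rcases h5 with ((h5 | h5) | h5) | h5
      · exact Or.inl (h5 ▸ hg)
      · exact Or.inr (Or.inl (h5 ▸ hg))
      · exact Or.inr (Or.inr (Or.inl (h5 ▸ hg)))
      · exact Or.inr (Or.inr (Or.inr (h5 ▸ hg)))
    obtain ⟨m1, m2, m3, m4⟩ := Mem_all (N := NN) le_sup_left hu x hm
    have i1 : Inv (mask (fX n 4 5)) := by rw [Inv, f1]; exact dev_of_mem m1
    have i2 : Inv (mask (fX n 3 5)) := by rw [Inv, f2]; exact dev_of_mem m2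
    have i3 : Inv (mask (fX n 4 6)) := by rw [Inv, f3]; exact dev_of_mem m3
    have i4 : Inv (mask (fX n 3 6)) := by rw [Inv, f4]; exact dev_of_mem m4
    obtain ⟨t1, p1, q1⟩ := t.add_sound _ _ ht i1 h6
    obtain ⟨t2, p2, q2⟩ := t1.add_sound _ _ p1 i2 q1
    obtain ⟨t3, p3, q3⟩ := t2.add_sound _ _ p2 i3 q2
    obtain ⟨t4, p4, q4⟩ := t3.add_sound _ _ p3 i4 q3
    exact xloop_sound K ns t4 p4 q4

lemma xloops_sound (K : St → Bool) : ∀ (L : List (List ℕ)) (t : St), t.All Inv →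
    xloops K L t = true → ∃ t' : St, t'.All Inv ∧ K t' = true
  | [], t, ht, h => ⟨t, ht, h⟩
  | n :: ns, t, ht, h => by
    rw [xloops] at h
    obtain ⟨t1, p1, q1⟩ := xloop_sound _ _ _ ht h
    exact xloops_sound K ns t1 p1 q1

lemma filter_mem {ι : Type*} (N : Submodule ℤ (D 5)) (f : ι → D 5) (q : ι → Bool) (L : List ι)
    (h : ∀ r ∈ L, q r = false → f r ∈ N) :
    (L.map f).sum - ((L.filter q).map f).sum ∈ N := by
  induction L with
  | nil => simp
  | cons a t ih =>
    have ih' := ih fun r hr => h r (List.mem_cons_of_mem _ hr)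
    by_cases hq : q a = true
    · rw [List.filter_cons_of_pos hq, List.map_cons, List.map_cons, List.sum_cons, List.sum_cons,
        add_sub_add_left_eq_sub]
      exact ih'
    · rw [List.filter_cons_of_neg hq, List.map_cons, List.sum_cons, add_sub_assoc]
      exact N.add_mem (h a List.mem_cons_self (by simpa using hq)) ih'

lemma dev_sum (L : List (Bool × List ℕ)) :
    dev (L.map fun p => sg p.1 • bb 5 (S p.2)).sum =
      (L.map fun p => sg p.1 • dev (bb 5 (S p.2))).sum := by
  induction L with
  | nil => simp
  | cons a t ih =>
    rw [List.map_cons, List.sum_cons, map_add, ih, map_smul, List.map_cons, List.sum_cons]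

lemma addU_sound {K : St → Bool} {t : St} {L : List (Bool × List ℕ)} (h : addU K t L = true) :
    ∃ p, L = [p] ∧ t.add (mask p.2) K = true := by
  match L, h with
  | [], h => exact absurd h (by simp [addU])
  | [p], h =>
    rw [addU, forceN_eq] at h
    exact ⟨p, rfl, h⟩
  | _ :: _ :: _, h => exact absurd h (by simp [addU])

lemma sloop_sound (K : St → Bool) : ∀ (L : List ℕ) (t : St), t.All Inv → sloop K L t = true →
    ∃ t' : St, t'.All Inv ∧ K t' = true
  | [], t, ht, h => ⟨t, ht, h⟩
  | n :: ns, t, ht, h => by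
    rw [sloop, Bool.and_eq_true, Bool.and_eq_true, Bool.and_eq_true, Nat.beq_eq,
      Int.natAbs_eq_zero] at h
    obtain ⟨⟨⟨h1, h2⟩, h3⟩, h4⟩ := h
    have hv := decL_Vl h1 h2
    obtain ⟨p, hp, h5⟩ := addU_sound h4
    have hpm : p ∈ bdv (decL 6 n) := by
      have : p ∈ [p] := List.mem_singleton.mpr rfl
      rw [← hp] at this
      exact List.mem_of_mem_filter this
    have hd : dev (dd 5 (bb 6 (S (decL 6 n)))) ∈ NN := by
      rw [dev_apply, phiZ_dd hv, h3, zero_smul, sub_zero]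
      exact NN_dd _
    rw [dd_bdv hv (by norm_num), dev_sum] at hd
    have h6 := filter_mem NN (fun p : Bool × List ℕ => sg p.1 • dev (bb 5 (S p.2)))
      (fun p => !(t.has (mask p.2))) (bdv (decL 6 n)) (by
        intro r hr hq
        have hh : t.has (mask r.2) = true := by simpa using hq
        have h7 := t.has_sound _ ht hh
        rw [Inv, bm_mask (bdv_mem hv hr).1.2] at h7
        exact NN.smul_mem _ h7)
    rw [hp] at h6
    have h8 := NN.sub_mem hd h6
    rw [sub_sub_cancel] at h8
    simp only [List.map_cons, List.map_nil, List.sum_cons, List.sum_nil, add_zero] at h8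
    have h9 := NN.smul_mem (sg p.1) h8
    rw [smul_smul, sg_sq, one_smul, ← bm_mask (bdv_mem hv hpm).1.2] at h9
    obtain ⟨t1, p1, q1⟩ := t.add_sound _ _ ht h9 h5
    exact sloop_sound K ns t1 p1 q1

lemma sloops_sound (K : St → Bool) : ∀ (L : List (List ℕ)) (t : St), t.All Inv →
    sloops K L t = true → ∃ t' : St, t'.All Inv ∧ K t' = true
  | [], t, ht, h => ⟨t, ht, h⟩
  | n :: ns, t, ht, h => by
    rw [sloops] at h
    obtain ⟨t1, p1, q1⟩ := sloop_sound _ _ _ ht h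
    exact sloops_sound K ns t1 p1 q1

lemma cover_sound {t : St} (ht : t.All Inv) (h : cover t = true) {σ : Finset E7} (hσ : Kd σ)
    (hc : σ.card = 5) : dev (bb 5 σ) ∈ NN := by
  rw [cover, Nat.beq_eq] at h
  have h1 := cond_zero (trav_face (by norm_num) h hσ hc)
  have h2 := t.has_sound _ ht h1
  rwa [Inv, bm_mask (toL_good σ).2, S_toL hσ.1] at h2

lemma dev_bb {σ : Finset E7} (hσ : Kd σ) (hc : σ.card = 5) : dev (bb 5 σ) ∈ NN := by
  obtain ⟨t1, p1, q1⟩ := xloops_sound _ xdat (.node .nil (mask sig0) .nil) (by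
    refine ⟨trivial, ?_, trivial⟩
    rw [Inv, bm_mask sig0_Vl.1.2, dev_apply]
    change s0 - phiZ s0 • s0 ∈ NN
    rw [phiZ_s0, one_smul, sub_self]
    exact NN.zero_mem) kx
  obtain ⟨t2, p2, q2⟩ := sloops_sound cover sdat t1 p1 q1
  exact cover_sound p2 q2 hσ hc

lemma dev_mem (z : D 5) : dev z ∈ NN := by
  rw [← Submodule.Quotient.mk_eq_zero]
  suffices h : NN.mkQ ∘ₗ dev = 0 from LinearMap.congr_fun h z
  apply hom_ext
  intro σ hσ hc
  exact (Submodule.Quotient.mk_eq_zero NN).mpr (dev_bb hσ hc)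

lemma five_s0 : (5 : ℤ) • s0 ∈ NN := by
  have h := kr
  rw [Bool.and_eq_true, Bool.and_eq_true, Nat.beq_eq] at h
  have hv : Vl 6 rho0 := ⟨good_of_srt _ h.1.1, h.1.2, rfl⟩
  have h1 := NN.sub_mem (NN_dd (bb 6 (S rho0))) (dev_mem (dd 5 (bb 6 (S rho0))))
  rw [dev_apply, sub_sub_cancel, phiZ_dd hv] at h1
  rcases Int.natAbs_eq (sval (bdv rho0)) with h2 | h2
  · rw [h2, h.2] at h1; exact h1
  · rw [h2, h.2, neg_smul] at h1; exact NN.neg_mem_iff.mp h1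

lemma mem_NN {z : D 5} (h : (5 : ℤ) ∣ phiZ z) : z ∈ NN := by
  obtain ⟨m, hm⟩ := h
  have h1 := dev_mem z
  rw [dev_apply, hm, mul_comm, mul_smul] at h1
  have h2 := NN.add_mem h1 (NN.smul_mem m five_s0)
  rwa [sub_add_cancel] at h2

lemma exact5 {z : D 5} (hz : dd 4 z = 0) (h : phiM z = 0) : z ∈ LinearMap.range (dd 5) := by
  obtain ⟨a, ⟨y, rfl⟩, b, ⟨t, rfl⟩, h1⟩ := Submodule.mem_sup.mp (mem_NN ((phiM_zero z).mp h))
  rw [← h1, map_add, dd_gG] at hz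
  have h2 : dd 4 (dd 5 y) = 0 := bdry_bdry (rankP 7) rankP_inj Kd_convex 4 y
  rw [h2, zero_add] at hz
  rw [← h1, hz, map_zero, add_zero]
  exact ⟨y, rfl⟩

lemma phiM_cyc : ∃ z : D 5, dd 4 z = 0 ∧ phiM z = 1 := by
  refine ⟨s0 - gG (dd 4 s0), ?_, ?_⟩
  · rw [map_sub, dd_gG, sub_self]
  · rw [phiM_apply, map_sub, phiZ_gG, phiZ_s0]
    simp

end BDP

namespace BDP

open MatchPaper

lemma rh_zero {c : ℕ} (h : ∀ z ∈ cycLow ℤ (rankP 7) Kd c, z ∈ LinearMap.range (dd c))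
    (x : RHc ℤ (rankP 7) Kd c) : x = 0 := by
  obtain ⟨z, rfl⟩ := Submodule.Quotient.mk_surjective _ x
  exact (Submodule.Quotient.mk_eq_zero _).mpr (h z.1 z.2)

lemma D_zero {c : ℕ} (h : c < 4 ∨ 7 < c) (z : D c) : z = 0 := by
  ext σ
  have := Kd_card σ.2.1
  have := σ.2.2
  omega

lemma H_small {c : ℕ} (h : c < 4 ∨ 7 < c) (x : RHc ℤ (rankP 7) Kd c) : x = 0 :=
  rh_zero (fun z _ => by rw [D_zero h z]; exact Submodule.zero_mem _) x

lemma H_four (x : RHc ℤ (rankP 7) Kd 4) : x = 0 :=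
  rh_zero (fun z _ => ⟨gG z, dd_gG z⟩) x

/-- evaluation of the cocycle on cycles -/
noncomputable def fM : cycLow ℤ (rankP 7) Kd 5 →ₗ[ℤ] ZMod 5 :=
  phiM ∘ₗ (cycLow ℤ (rankP 7) Kd 5).subtype

lemma fM_surj : Function.Surjective fM := by
  intro a
  obtain ⟨z, h1, h2⟩ := phiM_cyc
  refine ⟨(a.val : ℤ) • ⟨z, h1⟩, ?_⟩
  rw [map_smul]
  change (a.val : ℤ) • phiM z = a
  rw [h2]
  simp

lemma fM_ker : (LinearMap.range (dd 5)).comap (cycLow ℤ (rankP 7) Kd 5).subtype =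
    LinearMap.ker fM := by
  ext z
  rw [Submodule.mem_comap, LinearMap.mem_ker]
  constructor
  · rintro ⟨y, hy⟩
    change phiM ((cycLow ℤ (rankP 7) Kd 5).subtype z) = 0
    rw [← hy]
    exact phiM_dd y
  · intro h
    exact exact5 z.2 h

theorem H_five : Nonempty (RHc ℤ (rankP 7) Kd 5 ≃ₗ[ℤ] ZMod 5) :=
  ⟨(Submodule.quotEquivOfEq _ _ fM_ker).trans (fM.quotKerEquivOfSurjective fM_surj)⟩

lemma ct_inj : ∀ v w : E7, v.1 < v.2 → w.1 < w.2 → (∀ j, ct v j = ct w j) → v = w := by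
  decide +kernel

lemma deg7 {σ : Finset E7} (h : Kd σ) (hc : σ.card = 7) (j : Fin 7) : degB σ j = 2 := by
  have h1 := sum_deg σ
  have h2 : ∑ j, degB σ j = ∑ j : Fin 7, 2 := by rw [h1, hc]; simp
  exact (Finset.sum_eq_sum_iff_of_le (fun j _ => (h.2 j).2)).mp h2 j (Finset.mem_univ _)

lemma deg_erase {σ : Finset E7} {v : E7} (hv : v ∈ σ) (j : Fin 7) :
    degB σ j = ct v j + degB (σ.erase v) j := by
  conv_lhs => rw [← Finset.insert_erase hv]
  exact degB_insert (Finset.notMem_erase v σ) j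

lemma Kd_erase {σ : Finset E7} (h : Kd σ) (hc : σ.card = 7) {v : E7} (hv : v ∈ σ) :
    Kd (σ.erase v) := by
  refine ⟨fun p hp => h.1 p (Finset.mem_of_mem_erase hp), fun j => ?_⟩
  have h1 := deg7 h hc j
  have h2 := deg_erase hv j
  have h3 : ct v j ≤ 1 := by
    have := h.1 v hv
    unfold ct
    split_ifs with h4 h5
    · rw [h4, h5] at this; exact absurd this (lt_irrefl _)
    all_goals omega
  omega

lemma face_unique {σ ρ : Finset E7} (h : Kd σ) (hc : σ.card = 7) (h' : Kd ρ) (hc' : ρ.card = 7)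
    {v w : E7} (hv : v ∈ σ) (hw : w ∈ ρ) (he : ρ.erase w = σ.erase v) : w = v ∧ ρ = σ := by
  have h1 : w = v := by
    refine ct_inj w v (h'.1 w hw) (h.1 v hv) fun j => ?_
    have a1 := deg7 h hc j
    have a2 := deg7 h' hc' j
    have a3 := deg_erase hv j
    have a4 := deg_erase hw j
    rw [he] at a4
    omega
  refine ⟨h1, ?_⟩
  rw [← Finset.insert_erase hw, ← Finset.insert_erase hv, he, h1]

lemma bb_apply {c : ℕ} {τ : Finset E7} (ρ : {σ : Finset E7 // Kd σ ∧ σ.card = c})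
    (h : Kd τ ∧ τ.card = c) : bb c τ ρ = if τ = ρ.1 then 1 else 0 := by
  classical
  rw [bb, bas_eq h, Finsupp.single_apply]
  simp only [Subtype.ext_iff]

lemma dd_coef (y : D 7) {σ : Finset E7} (h : Kd σ ∧ σ.card = 7) {v : E7} (hv : v ∈ σ)
    (h6 : Kd (σ.erase v) ∧ (σ.erase v).card = 6) :
    (dd 6 y) ⟨σ.erase v, h6⟩ = eps (rankP 7) σ v * y ⟨σ, h⟩ := by
  suffices hs : (Finsupp.lapply (R := ℤ) ⟨σ.erase v, h6⟩ : D 6 →ₗ[ℤ] ℤ) ∘ₗ dd 6 =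
      eps (rankP 7) σ v • (Finsupp.lapply (R := ℤ) ⟨σ, h⟩ : D 7 →ₗ[ℤ] ℤ) from
    LinearMap.congr_fun hs y
  apply hom_ext
  intro ρ hρ hc
  change (dd 6 (bb 7 ρ)) ⟨σ.erase v, h6⟩ = eps (rankP 7) σ v * (bb 7 ρ) ⟨σ, h⟩
  rw [bb_apply _ ⟨hρ, hc⟩, dd, bdry_bas (rankP 7) hρ hc, Finsupp.finsetSum_apply]
  have key : ∀ w ∈ ρ, (eps (rankP 7) ρ w • basisOrZero ℤ Kd 6 (ρ.erase w)) ⟨σ.erase v, h6⟩ =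
      if ρ.erase w = σ.erase v then eps (rankP 7) ρ w else 0 := by
    intro w hw
    rw [Finsupp.smul_apply, bb_apply _ ⟨Kd_erase hρ hc hw, by rw [Finset.card_erase_of_mem hw, hc]⟩]
    split_ifs <;> simp
  rw [Finset.sum_congr rfl key]
  by_cases hs : ρ = σ
  · subst hs
    rw [Finset.sum_eq_single v]
    · simp
    · intro w hw hne
      rw [if_neg]
      exact fun he => hne (face_unique h.1 h.2 hρ hc hv hw he).1
    · exact fun hn => absurd hv hn
  · rw [if_neg hs, mul_zero]
    refine Finset.sum_eq_zero fun w hw => ?_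
    rw [if_neg]
    exact fun he => hs (face_unique h.1 h.2 hρ hc hv hw he).2

lemma exists_v {σ : Finset E7} (h : Kd σ ∧ σ.card = 7) :
    ∃ v ∈ σ, Kd (σ.erase v) ∧ (σ.erase v).card = 6 := by
  obtain ⟨v, hv⟩ := Finset.card_pos.mp (by rw [h.2]; norm_num : 0 < σ.card)
  exact ⟨v, hv, Kd_erase h.1 h.2 hv, by rw [Finset.card_erase_of_mem hv, h.2]⟩

lemma dvd_coef {n : ℤ} {z : D 6} {y : D 7} (hz : dd 6 y = n • z)
    (σ : {σ : Finset E7 // Kd σ ∧ σ.card = 7}) : n ∣ y σ := by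
  obtain ⟨v, hv, h6⟩ := exists_v σ.2
  have h1 := dd_coef y σ.2 hv h6
  rw [hz, Finsupp.smul_apply, smul_eq_mul] at h1
  have h2 : y σ = n * (eps (rankP 7) σ.1 v * z ⟨σ.1.erase v, h6⟩) := by
    have h3 := congrArg (fun t => eps (rankP 7) σ.1 v * t) h1
    rw [← mul_assoc (eps (rankP 7) σ.1 v) (eps (rankP 7) σ.1 v), eps_mul_self, one_mul] at h3
    rw [← h3]
    ring
  exact ⟨_, h2⟩

lemma dd6_inj : Function.Injective (dd 6) := by
  rw [← LinearMap.ker_eq_bot, LinearMap.ker_eq_bot']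
  intro y hy
  ext σ
  have := dvd_coef (n := 0) (z := 0) (y := y) (by rw [hy, smul_zero]) σ
  exact zero_dvd_iff.mp this

lemma H_seven (x : RHc ℤ (rankP 7) Kd 7) : x = 0 := by
  refine rh_zero (fun z hz => ?_) x
  have : z = 0 := dd6_inj (by rw [map_zero]; exact hz)
  rw [this]
  exact Submodule.zero_mem _

lemma pure6 {n : ℤ} (hn : n ≠ 0) {z : D 6} (h : n • z ∈ LinearMap.range (dd 6)) :
    z ∈ LinearMap.range (dd 6) := by
  obtain ⟨y, hy⟩ := h
  have h1 := dvd_coef hy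
  have h2 : y = n • (y.mapRange (fun a => a / n) (Int.zero_ediv n) : D 7) := by
    ext σ
    rw [Finsupp.smul_apply, Finsupp.mapRange_apply, smul_eq_mul, Int.mul_ediv_cancel' (h1 σ)]
  rw [h2, map_smul] at hy
  exact ⟨_, smul_right_injective _ hn hy⟩

instance : Module.IsTorsionFree ℤ (RHc ℤ (rankP 7) Kd 6) := by
  refine Module.IsTorsionFree.of_smul_eq_zero fun n x hx => ?_
  by_cases hn : n = 0
  · exact Or.inl hn
  · right
    obtain ⟨z, rfl⟩ := Submodule.Quotient.mk_surjective _ x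
    rw [← Submodule.Quotient.mk_smul] at hx
    have h := (Submodule.Quotient.mk_eq_zero _).mp hx
    exact (Submodule.Quotient.mk_eq_zero _).mpr (pure6 hn h)

lemma fr (c n : ℕ) (hc : c ≤ 7) (h : trav (fun _ => 1) eds c 0 [] = n) :
    Module.finrank ℤ (D c) = n := by
  rw [Module.finrank_eq_nat_card_basis (Finsupp.basisSingleOne (R := ℤ)
    (ι := {σ : Finset E7 // Kd σ ∧ σ.card = c}))]
  exact card_faces hc h

lemma rn {M N : Type} [AddCommGroup M] [AddCommGroup N] (f : M →ₗ[ℤ] N) [Module.Finite ℤ M] :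
    Module.finrank ℤ (LinearMap.range f) + Module.finrank ℤ (LinearMap.ker f) =
      Module.finrank ℤ M := by
  rw [← f.quotKerEquivRange.finrank_eq]
  exact Submodule.finrank_quotient_add_finrank _

lemma dd_le (c : ℕ) : LinearMap.range (dd (c + 1)) ≤ cycLow ℤ (rankP 7) Kd (c + 1) := by
  rintro _ ⟨y, rfl⟩
  exact bdry_bdry (rankP 7) rankP_inj Kd_convex c y

lemma fin_eq (c : ℕ) : Module.finrank ℤ (RHc ℤ (rankP 7) Kd (c + 1)) +
    Module.finrank ℤ (LinearMap.range (dd (c + 1))) =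
      Module.finrank ℤ (LinearMap.ker (dd c)) := by
  rw [← (Submodule.comapSubtypeEquivOfLe (dd_le c)).finrank_eq]
  exact Submodule.finrank_quotient_add_finrank _

lemma fr_five : Module.finrank ℤ (RHc ℤ (rankP 7) Kd 5) = 0 := by
  obtain ⟨f⟩ := H_five
  rw [f.finrank_eq, Module.finrank_eq_zero_iff_isTorsion]
  intro x
  refine ⟨⟨5, by simp⟩, ?_⟩
  change (5 : ℤ) • x = 0
  revert x
  decide

lemma arith {h6 r6 k5 h5 r5 k4 n6 n5 r4 : ℕ} (e1 : h6 + r6 = k5) (e2 : h5 + r5 = k4)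
    (e3 : r5 + k5 = n6) (e4 : r4 + k4 = n5) (e5 : r6 = 465) (e6 : r4 = 315) (e7 : n5 = 2625)
    (e8 : n6 = 3507) (e9 : h5 = 0) : h6 = 732 := by
  omega

lemma fr_six : Module.finrank ℤ (RHc ℤ (rankP 7) Kd 6) = 732 := by
  have e1 := fin_eq 5
  have e2 := fin_eq 4
  have e3 := rn (dd 5)
  have e4 := rn (dd 4)
  have e5 : Module.finrank ℤ (LinearMap.range (dd 6)) = 465 := by
    rw [LinearMap.finrank_range_of_inj dd6_inj]
    exact fr 7 465 (by norm_num) c7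
  have e6 : Module.finrank ℤ (LinearMap.range (dd 4)) = 315 := by
    rw [LinearMap.range_eq_top.mpr fun y => ⟨gG y, dd_gG y⟩, finrank_top]
    exact fr 4 315 (by norm_num) c4
  have e7 := fr 5 2625 (by norm_num) c5
  have e8 := fr 6 3507 (by norm_num) c6
  have e9 := fr_five
  exact arith e1 e2 e3 e4 e5 e6 e7 e8 e9

theorem H_six : Nonempty (RHc ℤ (rankP 7) Kd 6 ≃ₗ[ℤ] (Fin 732 → ℤ)) :=
  ⟨(Module.finBasisOfFinrankEq ℤ _ fr_six).equivFun⟩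

theorem final :
    Nonempty (BDH ℤ (fun _ : Fin 7 => 2) 4 ≃+ ZMod 5) ∧
      Nonempty (BDH ℤ (fun _ : Fin 7 => 2) 5 ≃+ (Fin 732 → ℤ)) ∧
      ∀ i : ℕ, i ≠ 4 → i ≠ 5 → ∀ x : BDH ℤ (fun _ : Fin 7 => 2) i, x = 0 := by
  refine ⟨?_, ?_, ?_⟩
  · obtain ⟨f⟩ := to_Kd 4
    obtain ⟨g⟩ := H_five
    exact ⟨(f.trans g).toAddEquiv⟩
  · obtain ⟨f⟩ := to_Kd 5
    obtain ⟨g⟩ := H_six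
    exact ⟨(f.trans g).toAddEquiv⟩
  · intro i h4 h5 x
    obtain ⟨f⟩ := to_Kd i
    have h : f x = 0 := by
      by_cases h3 : i = 3
      · subst h3; exact H_four _
      by_cases h6 : i = 6
      · subst h6; exact H_seven _
      exact H_small (by omega) _
    exact (LinearEquiv.map_eq_zero_iff f).mp h

end BDP

open MatchPaper in
/-- The reduced integral homology of `BD₇²` is `ℤ/5` in degree `4`,
`ℤ^732` in degree `5`, and zero in all other degrees. -/
theorem homology_of_BD_7_2 :
    Nonempty (BDH ℤ (fun _ : Fin 7 => 2) 4 ≃+ ZMod 5) ∧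
      Nonempty (BDH ℤ (fun _ : Fin 7 => 2) 5 ≃+ (Fin 732 → ℤ)) ∧
      ∀ i : ℕ, i ≠ 4 → i ≠ 5 → ∀ x : BDH ℤ (fun _ : Fin 7 => 2) i, x = 0 := by
  exact BDP.final
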